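/- arXiv:2111.02761 — 10 statements merged into one kernel-verified Lean document; each statement's English description precedes it below -/
import Mathlib

section
/- Define ℓ : [0,T) → [L0,L] by ℓ(t) = inf{ l ∈ [L0,L] : G(t,l) < Gc(l) }. Then ℓ is well defined (the set is nonempty since G(t,L) = 0 < Gc(L)), ℓ is non-decreasing and right-continuous, ℓ(0) = L0, and ℓ satisfies Griffith's criterion (i)–(iii). -/
open Set Filter Topology MeasureTheory
open scoped ENNReal

/-- The quasi-static evolution `ℓ(t) = inf { l ∈ [L0,L] : G(t,l) < Gc(l) }`,
where `G(t,l) = f(t)² · 𝒢(l)` (computed in `ℝ≥0∞`). -/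
noncomputable def griffithEvolution (L0 L : ℝ) (f : ℝ → ℝ) (Gr : ℝ → ℝ≥0∞)
    (Gc : ℝ → ℝ) (t : ℝ) : ℝ :=
  sInf {l | l ∈ Set.Icc L0 L ∧ ENNReal.ofReal (f t ^ 2) * Gr l < ENNReal.ofReal (Gc l)}

/-- Griffith's criterion for a non-decreasing, right-continuous evolution
`ℓ : [0,T) → [L0,L]` with `ℓ(0) = L0`, with energy release `G(t,l) = f(t)²·Gr(l)` and
toughness `Gc`:  (i) `G(t,ℓ(t)) ≤ Gc(ℓ(t))`;  (ii) if `G(t,ℓ(t)) < Gc(ℓ(t))` then the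
right derivative of `ℓ` at `t` exists and equals `0`;  (iii) at every jump point `t`
one has `G(t,l) ≥ Gc(l)` for all `l ∈ [ℓ⁻(t), ℓ(t))`, where the left limit `ℓ⁻(t)` of the
monotone function `ℓ` is `sSup (ℓ '' [0,t))` (and `ℓ⁻(0) := L0`). -/
def GriffithCriterion (L0 L T : ℝ) (f : ℝ → ℝ) (Gr : ℝ → ℝ≥0∞) (Gc : ℝ → ℝ)
    (ℓ : ℝ → ℝ) : Prop :=
  MonotoneOn ℓ (Set.Ico 0 T) ∧
  (∀ t ∈ Set.Ico (0:ℝ) T, Filter.Tendsto ℓ (nhdsWithin t (Set.Ioo t T)) (nhds (ℓ t))) ∧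
  ℓ 0 = L0 ∧
  (∀ t ∈ Set.Ico (0:ℝ) T, ℓ t ∈ Set.Icc L0 L) ∧
  (∀ t ∈ Set.Ico (0:ℝ) T,
      ENNReal.ofReal (f t ^ 2) * Gr (ℓ t) ≤ ENNReal.ofReal (Gc (ℓ t))) ∧
  (∀ t ∈ Set.Ico (0:ℝ) T,
      ENNReal.ofReal (f t ^ 2) * Gr (ℓ t) < ENNReal.ofReal (Gc (ℓ t)) →
      HasDerivWithinAt ℓ 0 (Set.Ico t T) t) ∧
  (∀ t ∈ Set.Ico (0:ℝ) T,
      (if t = 0 then L0 else sSup (ℓ '' Set.Ico 0 t)) ≠ ℓ t →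
      ∀ l, (if t = 0 then L0 else sSup (ℓ '' Set.Ico 0 t)) ≤ l → l < ℓ t →
        ENNReal.ofReal (Gc l) ≤ ENNReal.ofReal (f t ^ 2) * Gr l)

/-- The function `ℓ(t) = inf{ l ∈ [L0,L] : G(t,l) < Gc(l) }` is well
defined (the set is nonempty since `G(t,L) = 0 < Gc(L)`), non-decreasing, right-continuous,
satisfies `ℓ(0) = L0`, and satisfies Griffith's criterion (i)–(iii). -/
theorem griffith_evolution_exists
    (L0 L T : ℝ) (hL0 : 0 < L0) (hL0L : L0 < L) (hT : 0 < T)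
    (f : ℝ → ℝ) (hf : ContDiffOn ℝ 1 f (Set.Icc 0 T)) (hf0 : f 0 = 0)
    (hf' : ∀ t ∈ Set.Icc (0:ℝ) T, 0 < derivWithin f (Set.Icc 0 T) t)
    (Lam : Finset ℝ) (hLam : (Lam : Set ℝ) ⊆ Set.Ioo 0 L)
    (E : ℝ → ℝ) (hEc : ContinuousOn E (Set.Ioc 0 L)) (hEm : AntitoneOn E (Set.Ioc 0 L))
    (hE1 : ContDiffOn ℝ 1 E (Set.Ioo 0 L \ (Lam : Set ℝ)))
    (Gr : ℝ → ℝ≥0∞)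
    (hGr : ∀ l ∈ Set.Ioo 0 L \ (Lam : Set ℝ), Gr l = ENNReal.ofReal (-(deriv E l)))
    (hGrL : Gr L = 0)
    (hGrLam : ∀ l ∈ (Lam : Set ℝ), Gr l = Filter.liminf Gr (nhdsWithin l (Set.Ioi l)))
    (GA GB : ℝ) (hGA : 0 < GA) (hGB : 0 < GB)
    (Gc : ℝ → ℝ) (hGcv : ∀ l ∈ Set.Ioc (0:ℝ) L, Gc l = GA ∨ Gc l = GB)
    (hGcrc : ∀ l ∈ Set.Ioo (0:ℝ) L,
      Filter.Tendsto Gc (nhdsWithin l (Set.Ioi l)) (nhds (Gc l)))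
    (hGcc : ∀ l₁ ∈ Set.Ioo 0 L \ (Lam : Set ℝ), ∀ l₂ ∈ Set.Ioo 0 L \ (Lam : Set ℝ),
      l₁ ≤ l₂ → (∀ s ∈ Set.Icc l₁ l₂, s ∉ (Lam : Set ℝ)) → Gc l₁ = Gc l₂) :
    (∀ t ∈ Set.Ico (0:ℝ) T,
      {l | l ∈ Set.Icc L0 L ∧
        ENNReal.ofReal (f t ^ 2) * Gr l < ENNReal.ofReal (Gc l)}.Nonempty) ∧
    GriffithCriterion L0 L T f Gr Gc (griffithEvolution L0 L f Gr Gc) := by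
  classical
  set ℓ := griffithEvolution L0 L f Gr Gc with hℓ
  have hL : 0 < L := hL0.trans hL0L
  have hGcpos : ∀ l ∈ Set.Ioc (0:ℝ) L, 0 < Gc l := by
    intro l hl
    rcases hGcv l hl with h | h <;> rw [h] <;> assumption
  have hIcc : ∀ l ∈ Set.Icc L0 L, l ∈ Set.Ioc (0:ℝ) L := fun l hl => ⟨hL0.trans_le hl.1, hl.2⟩
  -- properties of f
  have hfc : ContinuousOn f (Set.Icc 0 T) := hf.continuousOn
  have hfm : StrictMonoOn f (Set.Icc 0 T) := by
    refine strictMonoOn_of_deriv_pos (convex_Icc 0 T) hfc ?_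
    intro x hx
    rw [interior_Icc] at hx
    rw [← derivWithin_of_mem_nhds (Icc_mem_nhds hx.1 hx.2)]
    exact hf' x (Ioo_subset_Icc_self hx)
  have h0mem : (0:ℝ) ∈ Set.Icc 0 T := ⟨le_rfl, hT.le⟩
  have hfpos : ∀ t ∈ Set.Icc (0:ℝ) T, 0 < t → 0 < f t := by
    intro t ht h
    have := hfm h0mem ht h
    rwa [hf0] at this
  have hfnn : ∀ t ∈ Set.Icc (0:ℝ) T, 0 ≤ f t := by
    intro t ht
    have := hfm.monotoneOn h0mem ht ht.1
    rwa [hf0] at this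
  have hsqm : ∀ s ∈ Set.Icc (0:ℝ) T, ∀ t ∈ Set.Icc (0:ℝ) T, s ≤ t → f s ^ 2 ≤ f t ^ 2 := by
    intro s hs t ht hst
    exact pow_le_pow_left₀ (hfnn s hs) (hfm.monotoneOn hs ht hst) 2
  -- the admissible sets
  set S : ℝ → Set ℝ := fun t => {l | l ∈ Set.Icc L0 L ∧
        ENNReal.ofReal (f t ^ 2) * Gr l < ENNReal.ofReal (Gc l)} with hS
  have hℓS : ∀ t, ℓ t = sInf (S t) := fun t => rfl
  have hLS : ∀ t, L ∈ S t := by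
    intro t
    refine ⟨⟨hL0L.le, le_rfl⟩, ?_⟩
    rw [hGrL, mul_zero]
    exact ENNReal.ofReal_pos.2 (hGcpos L ⟨hL, le_rfl⟩)
  have hbdd : ∀ t, BddBelow (S t) := fun t => ⟨L0, fun l hl => hl.1.1⟩
  have hle : ∀ t, ∀ l ∈ S t, ℓ t ≤ l := fun t l hl => csInf_le (hbdd t) hl
  have hℓmem : ∀ t, ℓ t ∈ Set.Icc L0 L := fun t =>
    ⟨le_csInf ⟨L, hLS t⟩ fun l hl => hl.1.1, hle t L (hLS t)⟩
  have hbelow : ∀ t l, L0 ≤ l → l < ℓ t →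
      ENNReal.ofReal (Gc l) ≤ ENNReal.ofReal (f t ^ 2) * Gr l := by
    intro t l h1 h2
    by_contra h
    push Not at h
    exact absurd (hle t l ⟨⟨h1, h2.le.trans (hℓmem t).2⟩, h⟩) (not_le.2 h2)
  have hmono : MonotoneOn ℓ (Set.Ico 0 T) := by
    intro s hs t ht hst
    refine csInf_le_csInf (hbdd s) ⟨L, hLS t⟩ ?_
    intro l hl
    refine ⟨hl.1, lt_of_le_of_lt ?_ hl.2⟩
    gcongr
    exact hfnn s (Ico_subset_Icc_self hs)
    exact hfm.monotoneOn (Ico_subset_Icc_self hs) (Ico_subset_Icc_self ht) hst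
  have hS0 : S 0 = Set.Icc L0 L := by
    ext l
    constructor
    · exact fun h => h.1
    · intro h
      refine ⟨h, ?_⟩
      simp only [hf0]
      simpa using hGcpos l (hIcc l h)
  have hℓ0 : ℓ 0 = L0 := by
    rw [hℓS, hS0, csInf_Icc hL0L.le]
  -- persistence
  have hpers : ∀ t ∈ Set.Ico (0:ℝ) T, ∀ l ∈ S t, Gr l ≠ ⊤ →
      ∀ᶠ t' in 𝓝[Set.Ico t T] t, l ∈ S t' := by
    intro t ht l hl hfin
    have h1 : Tendsto f (𝓝[Set.Ico t T] t) (𝓝 (f t)) :=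
      (hfc t (Ico_subset_Icc_self ht)).mono_left
        (nhdsWithin_mono _ (fun x hx => ⟨ht.1.trans hx.1, hx.2.le⟩))
    have h2 : Tendsto (fun t' => ENNReal.ofReal (f t' ^ 2) * Gr l) (𝓝[Set.Ico t T] t)
        (𝓝 (ENNReal.ofReal (f t ^ 2) * Gr l)) :=
      ENNReal.Tendsto.mul_const (ENNReal.tendsto_ofReal (h1.pow 2)) (Or.inr hfin)
    filter_upwards [h2.eventually_lt_const hl.2] with t' ht'
    exact ⟨hl.1, ht'⟩
  have hfinpos : ∀ t ∈ Set.Ico (0:ℝ) T, 0 < t → ∀ l ∈ S t, Gr l ≠ ⊤ := by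
    intro t ht h0 l hl htop
    have h := hl.2
    have hp := hfpos t (Ico_subset_Icc_self ht) h0
    rw [htop, ENNReal.mul_top (by simpa using hp.ne')] at h
    exact not_top_lt h
  have hopen : IsOpen (Set.Ioo 0 L \ (Lam : Set ℝ)) :=
    isOpen_Ioo.sdiff Lam.finite_toSet.isClosed
  -- near a point, to its right, no points of Lam
  have hnoLam : ∀ l : ℝ, ∀ᶠ s in 𝓝[>] l, s ∉ (Lam : Set ℝ) := by
    intro l
    have : ((Lam : Set ℝ) \ {l})ᶜ ∈ 𝓝 l :=
      (Lam.finite_toSet.subset sdiff_subset).isClosed.isOpen_compl.mem_nhds (by simp)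
    filter_upwards [mem_nhdsWithin_of_mem_nhds this, self_mem_nhdsWithin] with s hs hs' hsL
    exact hs ⟨hsL, ne_of_gt hs'⟩
  have hgood : ∀ t ∈ Set.Ico (0:ℝ) T, ∀ r, ℓ t < r → ∃ l ∈ S t, l < r ∧ Gr l ≠ ⊤ := by
    intro t ht r hr
    rcases ht.1.eq_or_lt with h0 | h0
    · subst h0
      rw [hℓ0] at hr
      have hev : ∀ᶠ s in 𝓝[>] L0, s ∉ (Lam : Set ℝ) ∧ s ∈ Set.Ioo L0 (min r L) :=
        (hnoLam L0).and (Ioo_mem_nhdsGT (lt_min hr hL0L))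
      obtain ⟨s, hs1, hs2⟩ := hev.exists
      have hsL : s < L := hs2.2.trans_le (min_le_right _ _)
      refine ⟨s, ?_, hs2.2.trans_le (min_le_left _ _), ?_⟩
      · rw [hS0]
        exact ⟨hs2.1.le, hsL.le⟩
      · rw [hGr s ⟨⟨hL0.trans hs2.1, hsL⟩, hs1⟩]
        exact ENNReal.ofReal_ne_top
    · obtain ⟨l, hl, hlr⟩ := exists_lt_of_csInf_lt ⟨L, hLS t⟩ hr
      exact ⟨l, hl, hlr, hfinpos t ht h0 l hl⟩
  have hrc : ∀ t ∈ Set.Ico (0:ℝ) T, Tendsto ℓ (𝓝[Set.Ico t T] t) (𝓝 (ℓ t)) := by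
    intro t ht
    rw [tendsto_order]
    constructor
    · intro a ha
      filter_upwards [self_mem_nhdsWithin] with s hs
      exact ha.trans_le (hmono ht ⟨ht.1.trans hs.1, hs.2⟩ hs.1)
    · intro r hr
      obtain ⟨l, hl, hlr, hfin⟩ := hgood t ht r hr
      filter_upwards [hpers t ht l hl hfin] with s hs
      exact (hle s l hs).trans_lt hlr
  -- Gr equals its right liminf everywhere
  have hlim : ∀ l ∈ Set.Ioo (0:ℝ) L, Gr l = Filter.liminf Gr (𝓝[>] l) := by
    intro l hl
    by_cases hlam : l ∈ (Lam : Set ℝ)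
    · exact hGrLam l hlam
    · have hmem : l ∈ Set.Ioo 0 L \ (Lam : Set ℝ) := ⟨hl, hlam⟩
      have hd : ContinuousAt (deriv E) l :=
        (hE1.continuousOn_deriv_of_isOpen hopen le_rfl).continuousAt (hopen.mem_nhds hmem)
      have h1 : Tendsto (fun s => ENNReal.ofReal (-(deriv E s))) (𝓝 l) (𝓝 (Gr l)) := by
        rw [hGr l hmem]
        exact ENNReal.tendsto_ofReal hd.tendsto.neg
      have h2 : Tendsto Gr (𝓝 l) (𝓝 (Gr l)) := by
        refine h1.congr' ?_
        filter_upwards [hopen.mem_nhds hmem] with s hs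
        exact (hGr s hs).symm
      exact (h2.mono_left nhdsWithin_le_nhds).liminf_eq.symm
  -- Gc is locally constant to the right
  have hGcev : ∀ l ∈ Set.Ioo (0:ℝ) L, ∀ᶠ s in 𝓝[>] l, Gc s = Gc l := by
    intro l hl
    have hfinset : IsClosed (({GA, GB} : Set ℝ) \ {Gc l}) :=
      (((Set.finite_singleton GB).insert GA).subset sdiff_subset).isClosed
    have h1 := (hGcrc l hl).eventually (hfinset.isOpen_compl.mem_nhds (by simp))
    filter_upwards [h1, Ioo_mem_nhdsGT hl.2] with s hs hs2
    by_contra hne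
    refine hs ⟨?_, hne⟩
    rcases hGcv s ⟨hl.1.trans hs2.1, hs2.2.le⟩ with h | h <;> simp [h]
  have hi : ∀ t ∈ Set.Ico (0:ℝ) T,
      ENNReal.ofReal (f t ^ 2) * Gr (ℓ t) ≤ ENNReal.ofReal (Gc (ℓ t)) := by
    intro t ht
    by_cases hin : ℓ t ∈ S t
    · exact hin.2.le
    have hltL : ℓ t < L := lt_of_le_of_ne (hℓmem t).2 (fun h => hin (h ▸ hLS t))
    have hl : ℓ t ∈ Set.Ioo 0 L := ⟨hL0.trans_le (hℓmem t).1, hltL⟩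
    have hc : 0 < ENNReal.ofReal (f t ^ 2) := by
      rcases ht.1.eq_or_lt with h0 | h0
      · exfalso
        apply hin
        rw [← h0, hS0]
        exact hℓmem 0
      · have := hfpos t (Ico_subset_Icc_self ht) h0
        exact ENNReal.ofReal_pos.2 (by positivity)
    have hfr : ∃ᶠ s in 𝓝[>] (ℓ t), s ∈ S t := by
      rw [(nhdsGT_basis (ℓ t)).frequently_iff]
      intro r hr
      obtain ⟨l, hlS, hlr⟩ := exists_lt_of_csInf_lt ⟨L, hLS t⟩ hr
      have hne : ℓ t ≠ l := fun h => hin (h ▸ hlS)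
      exact ⟨l, ⟨lt_of_le_of_ne (hle t l hlS) hne, hlr⟩, hlS⟩
    have h2 : Gr (ℓ t) ≤ ENNReal.ofReal (Gc (ℓ t)) / ENNReal.ofReal (f t ^ 2) := by
      rw [hlim _ hl]
      refine liminf_le_of_frequently_le' ((hfr.and_eventually (hGcev _ hl)).mono ?_)
      rintro s ⟨hs1, hs2⟩
      rw [ENNReal.le_div_iff_mul_le (Or.inl hc.ne') (Or.inl ENNReal.ofReal_ne_top), mul_comm,
        ← hs2]
      exact hs1.2.le
    rw [ENNReal.le_div_iff_mul_le (Or.inl hc.ne') (Or.inl ENNReal.ofReal_ne_top), mul_comm] at h2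
    exact h2
  have hii0 : HasDerivWithinAt ℓ 0 (Set.Ico 0 T) 0 := by
    set m := min GA GB with hm
    have hmpos : 0 < m := lt_min hGA hGB
    have hGcm : ∀ l ∈ Set.Ioc (0:ℝ) L, m ≤ Gc l := by
      intro l hl
      rcases hGcv l hl with h | h <;> rw [h]
      · exact min_le_left _ _
      · exact min_le_right _ _
    obtain ⟨r, hr, hrL⟩ := (mem_nhdsGT_iff_exists_Ioo_subset).1 (hnoLam L0)
    have hr : L0 < r := hr
    have h0T : (0:ℝ) ∈ Set.Ico 0 T := ⟨le_rfl, hT⟩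
    have hsmall : ∀ᶠ t in 𝓝[Set.Ico 0 T] (0:ℝ), ℓ t < r := by
      refine (hrc 0 h0T).eventually_lt_const ?_
      rw [hℓ0]; exact hr
    have hkey : ∀ᶠ t in 𝓝[Set.Ico 0 T] (0:ℝ),
        ‖ℓ t - L0‖ ≤ (E L0 - E L) / m * ‖f t ^ 2‖ := by
      filter_upwards [hsmall, self_mem_nhdsWithin] with t htr ht
      rw [Real.norm_of_nonneg (sub_nonneg.2 (hℓmem t).1), Real.norm_of_nonneg (sq_nonneg _)]
      rcases ht.1.eq_or_lt with h0 | h0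
      · rw [← h0, hℓ0, hf0]; simp
      have hp := hfpos t (Ico_subset_Icc_self ht) h0
      have hsub : Set.Ioo L0 (ℓ t) ⊆ Set.Ioo 0 L \ (Lam : Set ℝ) := fun s hs =>
        ⟨⟨hL0.trans hs.1, hs.2.trans_le (hℓmem t).2⟩, hrL ⟨hs.1, hs.2.trans htr⟩⟩
      have hmv := (convex_Icc L0 (ℓ t)).image_sub_le_mul_sub_of_deriv_le (f := E)
        (C := - (m / f t ^ 2))
        (hEc.mono fun s hs => ⟨hL0.trans_le hs.1, hs.2.trans (hℓmem t).2⟩)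
        (by
          rw [interior_Icc]
          exact (hE1.differentiableOn one_ne_zero).mono hsub)
        (by
          rw [interior_Icc]
          intro s hs
          have h1 := hbelow t s hs.1.le hs.2
          have hs0 : s ∈ Set.Ioc 0 L := Ioo_subset_Ioc_self (hsub hs).1
          rw [hGr s (hsub hs), ← ENNReal.ofReal_mul (sq_nonneg _),
            ENNReal.ofReal_le_ofReal_iff'] at h1
          have h2 : Gc s ≤ f t ^ 2 * -deriv E s := h1.resolve_right (not_le.2 (hGcpos s hs0))
          have h3 : m / f t ^ 2 ≤ - deriv E s := by
            rw [div_le_iff₀ (by positivity)]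
            linarith [hGcm s hs0]
          linarith)
        L0 ⟨le_rfl, (hℓmem t).1⟩ (ℓ t) ⟨(hℓmem t).1, le_rfl⟩ (hℓmem t).1
      have hEL : E L ≤ E (ℓ t) := hEm (hIcc _ (hℓmem t)) ⟨hL, le_rfl⟩ (hℓmem t).2
      have h4 : m / f t ^ 2 * (ℓ t - L0) ≤ E L0 - E L := by linarith
      have h5 : ℓ t - L0 = (m / f t ^ 2 * (ℓ t - L0)) / m * f t ^ 2 := by
        field_simp
      rw [h5]
      gcongr
    have hfd : HasDerivWithinAt f (derivWithin f (Set.Icc 0 T) 0) (Set.Ico 0 T) 0 :=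
      ((hf.differentiableOn one_ne_zero) 0 h0mem).hasDerivWithinAt.mono Ico_subset_Icc_self
    have hfd2 := hfd.pow 2
    have hz : HasDerivWithinAt (fun t => f t ^ 2) 0 (Set.Ico 0 T) 0 := by
      have he : (0:ℝ) = ((2:ℕ):ℝ) * f 0 ^ (2 - 1) * derivWithin f (Set.Icc 0 T) 0 := by
        simp [hf0]
      exact hfd2.congr_deriv he.symm
    rw [hasDerivWithinAt_iff_isLittleO] at hz ⊢
    simp only [hf0, hℓ0, smul_zero, sub_zero, ne_eq, OfNat.ofNat_ne_zero, not_false_eq_true,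
      zero_pow] at hz ⊢
    exact (Asymptotics.IsBigO.of_bound _ hkey).trans_isLittleO hz
  refine ⟨fun t _ => ⟨L, hLS t⟩, hmono, ?_, hℓ0, fun t _ => hℓmem t, hi, ?_, ?_⟩
  · intro t ht
    exact (hrc t ht).mono_left (nhdsWithin_mono _ Ioo_subset_Ico_self)
  · intro t ht hlt
    rcases ht.1.eq_or_lt with h0 | h0
    · rw [← h0]; exact hii0
    have hin : ℓ t ∈ S t := ⟨hℓmem t, hlt⟩
    refine (hasDerivWithinAt_const t (Set.Ico t T) (ℓ t)).congr_of_eventuallyEq ?_ rfl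
    filter_upwards [hpers t ht _ hin (hfinpos t ht h0 _ hin), self_mem_nhdsWithin] with s hs hs2
    exact le_antisymm (hle s _ hs) (hmono ht ⟨ht.1.trans hs2.1, hs2.2⟩ hs2.1)
  · intro t ht _ l hl1 hl2
    refine hbelow t l (le_trans ?_ hl1) hl2
    split_ifs with h0
    · exact le_rfl
    · rw [← hℓ0]
      refine le_csSup ⟨L, ?_⟩ ⟨0, ⟨le_rfl, lt_of_le_of_ne ht.1 (Ne.symm h0)⟩, rfl⟩
      rintro _ ⟨s, _, rfl⟩
      exact (hℓmem s).2
end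

section
/- If ℓ₁, ℓ₂ : [0,T) → [L0,L] are both non-decreasing and right-continuous, satisfy ℓ₁(0) = ℓ₂(0) = L0, and both satisfy Griffith's criterion (i)–(iii), then ℓ₁(t) = ℓ₂(t) for every t ∈ [0,T). -/
open Set Filter Topology MeasureTheory
open scoped ENNReal

lemma griffith_aux_left (L0 T : ℝ) (ℓ : ℝ → ℝ) (hmono : MonotoneOn ℓ (Set.Ico 0 T))
    (s : ℝ) (hs0 : 0 < s) (hsT : s < T) (hsup : sSup (ℓ '' Set.Ico 0 s) = ℓ s) :
    ContinuousWithinAt ℓ (Set.Iic s) s := by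
  rw [ContinuousWithinAt, tendsto_order]
  have hpos : ∀ᶠ x in 𝓝[≤] s, 0 < x := mem_nhdsWithin_of_mem_nhds (Ioi_mem_nhds hs0)
  constructor
  · intro a ha
    rw [← hsup] at ha
    obtain ⟨_, ⟨r, hr, rfl⟩, har⟩ :=
      exists_lt_of_lt_csSup ((Set.nonempty_Ico.2 hs0).image ℓ) ha
    have h1 : ∀ᶠ x in 𝓝[≤] s, r < x := mem_nhdsWithin_of_mem_nhds (Ioi_mem_nhds hr.2)
    filter_upwards [h1, self_mem_nhdsWithin] with x hx hx'
    exact har.trans_le (hmono ⟨hr.1, hr.2.trans hsT⟩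
      ⟨hr.1.trans hx.le, lt_of_le_of_lt hx' hsT⟩ hx.le)
  · intro a ha
    filter_upwards [hpos, self_mem_nhdsWithin] with x hx hx'
    exact (hmono ⟨hx.le, lt_of_le_of_lt hx' hsT⟩ ⟨hs0.le, hsT⟩ hx').trans_lt ha

lemma griffith_aux_barrier (L0 L T : ℝ) (f : ℝ → ℝ) (Gr : ℝ → ℝ≥0∞) (Gc : ℝ → ℝ)
    (hF : ∀ s t, 0 ≤ s → s ≤ t → t < T → f s ^ 2 ≤ f t ^ 2)
    (ℓ : ℝ → ℝ) (h : GriffithCriterion L0 L T f Gr Gc ℓ) (t : ℝ) (ht : t ∈ Set.Ico 0 T)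
    (l' b : ℝ) (hl' : L0 ≤ l') (hlt : l' < ℓ t) (hlb : l' < b)
    (hG : ∀ l ∈ Set.Ico l' b,
      ENNReal.ofReal (f t ^ 2) * Gr l < ENNReal.ofReal (Gc l)) : False := by
  obtain ⟨hmono, hrc, h0, hran, -, hii, hiii⟩ := h
  have hG' : ∀ s, 0 ≤ s → s ≤ t → ∀ l ∈ Set.Ico l' b,
      ENNReal.ofReal (f s ^ 2) * Gr l < ENNReal.ofReal (Gc l) := by
    intro s hs hst l hl
    refine lt_of_le_of_lt ?_ (hG l hl)
    exact mul_le_mul_left (ENNReal.ofReal_le_ofReal (hF s t hs hst ht.2)) _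
  set S : Set ℝ := {s | s ∈ Set.Icc 0 t ∧ l' < ℓ s} with hS
  have htS : t ∈ S := ⟨⟨ht.1, le_rfl⟩, hlt⟩
  have hbdd : BddBelow S := ⟨0, fun s hs => hs.1.1⟩
  set τ := sInf S with hτ
  have hτ0 : 0 ≤ τ := le_csInf ⟨t, htS⟩ fun s hs => hs.1.1
  have hτt : τ ≤ t := csInf_le hbdd htS
  have hτT : τ < T := hτt.trans_lt ht.2
  have hbelow : ∀ s, 0 ≤ s → s < τ → ℓ s ≤ l' := by
    intro s hs hsτ
    by_contra hc
    exact absurd (csInf_le hbdd (show s ∈ S from ⟨⟨hs, hsτ.le.trans hτt⟩, not_le.1 hc⟩))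
      (not_le.2 hsτ)
  have habove : ∀ s, τ < s → s < T → l' < ℓ s := by
    intro s hs hsT
    obtain ⟨r, hr, hrs⟩ := exists_lt_of_csInf_lt ⟨t, htS⟩ hs
    exact hr.2.trans_le (hmono ⟨hr.1.1, hr.1.2.trans_lt ht.2⟩
      ⟨hr.1.1.trans hrs.le, hsT⟩ hrs.le)
  have hτle : ℓ τ ≤ l' := by
    by_contra hc
    rw [not_le] at hc
    have hm : (if τ = 0 then L0 else sSup (ℓ '' Set.Ico 0 τ)) ≤ l' := by
      split_ifs with h
      · exact hl'
      · have : 0 < τ := lt_of_le_of_ne hτ0 (Ne.symm h)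
        refine csSup_le ((Set.nonempty_Ico.2 this).image ℓ) ?_
        rintro _ ⟨s, hs, rfl⟩
        exact hbelow s hs.1 hs.2
    exact absurd (hG' τ hτ0 hτt l' ⟨le_rfl, hlb⟩)
      (not_lt.2 (hiii τ ⟨hτ0, hτT⟩ (hm.trans_lt hc).ne l' hm hc))
  have hτlt : τ < t := by
    rcases hτt.lt_or_eq with h | h
    · exact h
    · rw [h] at hτle
      exact absurd hlt (not_lt.2 hτle)
  have hrcτ := hrc τ ⟨hτ0, hτT⟩
  have hnb : 𝓝[Set.Ioo τ T] τ = 𝓝[>] τ := nhdsWithin_Ioo_eq_nhdsGT hτT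
  rw [hnb] at hrcτ
  have hτeq : ℓ τ = l' := by
    refine le_antisymm hτle (ge_of_tendsto hrcτ ?_)
    filter_upwards [Ioo_mem_nhdsGT hτT] with s hs
    exact (habove s hs.1 hs.2).le
  have hev : ∀ᶠ s in 𝓝[>] τ, ℓ s < b := hrcτ.eventually_lt_const (by rw [hτeq]; exact hlb)
  obtain ⟨v, hvb, hτv, hvt⟩ := (hev.and (Ioo_mem_nhdsGT hτlt)).exists
  have hvT : v < T := hvt.trans ht.2
  have hin : ∀ s ∈ Set.Icc τ v, ℓ s ∈ Set.Ico l' b := by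
    intro s hs
    have hsm : s ∈ Set.Ico 0 T := ⟨hτ0.trans hs.1, hs.2.trans_lt hvT⟩
    constructor
    · rw [← hτeq]
      exact hmono ⟨hτ0, hτT⟩ hsm hs.1
    · exact (hmono hsm ⟨hτ0.trans hτv.le, hvT⟩ hs.2).trans_lt hvb
  have hder : ∀ s ∈ Set.Icc τ v, HasDerivWithinAt ℓ 0 (Set.Ici s) s := by
    intro s hs
    have hsm : s ∈ Set.Ico 0 T := ⟨hτ0.trans hs.1, hs.2.trans_lt hvT⟩
    exact (hii s hsm (hG' s hsm.1 (hs.2.trans hvt.le) _ (hin s hs))).mono_of_mem_nhdsWithin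
      (Ico_mem_nhdsGE hsm.2)
  have hcont : ContinuousOn ℓ (Set.Icc τ v) := by
    intro s hs
    rcases hs.1.lt_or_eq with h | h
    · have hs0 : 0 < s := hτ0.trans_lt h
      have hsT : s < T := hs.2.trans_lt hvT
      have hsup : sSup (ℓ '' Set.Ico 0 s) = ℓ s := by
        by_contra hne
        have hub : ∀ y ∈ ℓ '' Set.Ico 0 s, y ≤ ℓ s := by
          rintro _ ⟨r, hr, rfl⟩
          exact hmono ⟨hr.1, hr.2.trans hsT⟩ ⟨hs0.le, hsT⟩ hr.2.le
        have hle : sSup (ℓ '' Set.Ico 0 s) ≤ ℓ s :=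
          csSup_le ((Set.nonempty_Ico.2 hs0).image ℓ) hub
        have hge : l' ≤ sSup (ℓ '' Set.Ico 0 s) := by
          rw [← hτeq]
          exact le_csSup ⟨_, hub⟩ ⟨τ, ⟨hτ0, h⟩, rfl⟩
        have hj := hiii s ⟨hs0.le, hsT⟩
        rw [if_neg hs0.ne'] at hj
        exact absurd (hG' s hs0.le (hs.2.trans hvt.le) _ ⟨hge, hle.trans_lt (hin s hs).2⟩)
          (not_lt.2 (hj hne _ le_rfl (lt_of_le_of_ne hle hne)))
      have hl := griffith_aux_left L0 T ℓ hmono s hs0 hsT hsup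
      have hr := (hder s hs).continuousWithinAt
      have := hl.union hr
      rw [Set.Iic_union_Ici] at this
      exact this.mono (Set.subset_univ _)
    · subst h
      exact (hder _ hs).continuousWithinAt.mono Set.Icc_subset_Ici_self
  have hconst := constant_of_has_deriv_right_zero hcont
    (fun s hs => hder s (Set.Ico_subset_Icc_self hs)) v ⟨hτv.le, le_rfl⟩
  have := habove v hτv hvT
  rw [hconst, hτeq] at this
  exact lt_irrefl _ this

lemma griffith_aux_reg (L : ℝ) (Lam : Finset ℝ) (E : ℝ → ℝ)
    (hE1 : ContDiffOn ℝ 1 E (Set.Ioo 0 L \ (Lam : Set ℝ)))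
    (Gr : ℝ → ℝ≥0∞)
    (hGr : ∀ l ∈ Set.Ioo 0 L \ (Lam : Set ℝ), Gr l = ENNReal.ofReal (-(deriv E l)))
    (Gc : ℝ → ℝ)
    (hGcrc : ∀ l ∈ Set.Ioo (0:ℝ) L,
      Filter.Tendsto Gc (nhdsWithin l (Set.Ioi l)) (nhds (Gc l)))
    (c : ℝ≥0∞) (hc : c ≠ ⊤) (l : ℝ) (hl : l ∈ Set.Ioo 0 L \ (Lam : Set ℝ))
    (hlt : c * Gr l < ENNReal.ofReal (Gc l)) :
    ∃ b, l < b ∧ ∀ x ∈ Set.Ico l b, c * Gr x < ENNReal.ofReal (Gc x) := by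
  have hopen : IsOpen (Set.Ioo 0 L \ (Lam : Set ℝ)) :=
    isOpen_Ioo.sdiff Lam.finite_toSet.isClosed
  have hU := hopen.mem_nhds hl
  have hd : ContinuousAt (deriv E) l :=
    (hE1.continuousOn_deriv_of_isOpen hopen le_rfl).continuousAt hU
  have hg : Tendsto Gr (𝓝 l) (𝓝 (Gr l)) := by
    rw [hGr l hl]
    refine (ENNReal.tendsto_ofReal hd.neg).congr' ?_
    filter_upwards [hU] with x hx
    exact (hGr x hx).symm
  have h1 : Tendsto (fun x => c * Gr x) (𝓝[>] l) (𝓝 (c * Gr l)) :=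
    (ENNReal.Tendsto.const_mul hg (Or.inr hc)).mono_left nhdsWithin_le_nhds
  have h2 := ENNReal.tendsto_ofReal (hGcrc l hl.1)
  obtain ⟨b, hb, hsub⟩ := mem_nhdsGT_iff_exists_Ioo_subset.1 (h1.eventually_lt h2 hlt)
  refine ⟨b, hb, fun x hx => ?_⟩
  rcases hx.1.lt_or_eq with h | h
  · exact hsub ⟨h, hx.2⟩
  · rw [← h]
    exact hlt

lemma griffith_aux_loc (L : ℝ) (Lam : Finset ℝ) (E : ℝ → ℝ)
    (hE1 : ContDiffOn ℝ 1 E (Set.Ioo 0 L \ (Lam : Set ℝ)))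
    (Gr : ℝ → ℝ≥0∞)
    (hGr : ∀ l ∈ Set.Ioo 0 L \ (Lam : Set ℝ), Gr l = ENNReal.ofReal (-(deriv E l)))
    (hGrLam : ∀ l ∈ (Lam : Set ℝ), Gr l = Filter.liminf Gr (nhdsWithin l (Set.Ioi l)))
    (Gc : ℝ → ℝ)
    (hGcrc : ∀ l ∈ Set.Ioo (0:ℝ) L,
      Filter.Tendsto Gc (nhdsWithin l (Set.Ioi l)) (nhds (Gc l)))
    (c : ℝ≥0∞) (hc : c ≠ ⊤) (l m : ℝ) (hl0 : 0 < l) (hlm : l < m) (hmL : m ≤ L)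
    (hlt : c * Gr l < ENNReal.ofReal (Gc l)) :
    ∃ l' b, l ≤ l' ∧ l' < m ∧ l' < b ∧
      ∀ x ∈ Set.Ico l' b, c * Gr x < ENNReal.ofReal (Gc x) := by
  by_cases hlam : l ∈ (Lam : Set ℝ)
  · obtain ⟨ν, hν1, hν2⟩ := exists_between hlt
    have hfreq : ∃ᶠ s in 𝓝[>] l, c * Gr s < ν := by
      intro hcon
      have hcon' : ∀ᶠ s in 𝓝[>] l, ν / c ≤ Gr s := by
        filter_upwards [hcon] with s hs
        exact ENNReal.div_le_of_le_mul' (not_lt.1 hs)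
      have h1 : ν / c ≤ Gr l := by
        rw [hGrLam l hlam]
        exact le_liminf_of_le (by isBoundedDefault) hcon'
      rcases eq_or_ne c 0 with h0 | h0
      · obtain ⟨s, hs⟩ := hcon.exists
        apply hs
        rw [h0, zero_mul] at hν1 ⊢
        exact hν1
      · rw [ENNReal.div_le_iff h0 hc, mul_comm] at h1
        exact absurd hν1 (not_lt.2 h1)
    have hev1 := (ENNReal.tendsto_ofReal (hGcrc l ⟨hl0, hlm.trans_le hmL⟩)).eventually_const_lt hν2
    have hev2 : ∀ᶠ s in 𝓝[>] l, s ∉ (Lam : Set ℝ) := by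
      have h1 : ((Lam : Set ℝ) \ {l})ᶜ ∈ 𝓝 l :=
        (Lam.finite_toSet.subset Set.sdiff_subset).isClosed.isOpen_compl.mem_nhds (by simp)
      filter_upwards [mem_nhdsWithin_of_mem_nhds h1, self_mem_nhdsWithin] with s hs hs' hs''
      exact hs ⟨hs'', ne_of_gt hs'⟩
    obtain ⟨s, hs, h1, h2, h3⟩ :=
      (hfreq.and_eventually (hev1.and (hev2.and (Ioo_mem_nhdsGT hlm)))).exists
    obtain ⟨b, hb, hG⟩ := griffith_aux_reg L Lam E hE1 Gr hGr Gc hGcrc c hc s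
      ⟨⟨hl0.trans h3.1, h3.2.trans_le hmL⟩, h2⟩ (hs.trans h1)
    exact ⟨s, b, h3.1.le, h3.2, hb, hG⟩
  · obtain ⟨b, hb, hG⟩ := griffith_aux_reg L Lam E hE1 Gr hGr Gc hGcrc c hc l
      ⟨⟨hl0, hlm.trans_le hmL⟩, hlam⟩ hlt
    exact ⟨l, b, le_rfl, hlm, hb, hG⟩

/-- Uniqueness: two non-decreasing right-continuous evolutions starting
from `L0` and satisfying Griffith's criterion (i)–(iii) coincide on `[0,T)`. -/
theorem griffith_evolution_unique
    (L0 L T : ℝ) (hL0 : 0 < L0) (hL0L : L0 < L) (hT : 0 < T)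
    (f : ℝ → ℝ) (hf : ContDiffOn ℝ 1 f (Set.Icc 0 T)) (hf0 : f 0 = 0)
    (hf' : ∀ t ∈ Set.Icc (0:ℝ) T, 0 < derivWithin f (Set.Icc 0 T) t)
    (Lam : Finset ℝ) (hLam : (Lam : Set ℝ) ⊆ Set.Ioo 0 L)
    (E : ℝ → ℝ) (hEc : ContinuousOn E (Set.Ioc 0 L)) (hEm : AntitoneOn E (Set.Ioc 0 L))
    (hE1 : ContDiffOn ℝ 1 E (Set.Ioo 0 L \ (Lam : Set ℝ)))
    (Gr : ℝ → ℝ≥0∞)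
    (hGr : ∀ l ∈ Set.Ioo 0 L \ (Lam : Set ℝ), Gr l = ENNReal.ofReal (-(deriv E l)))
    (hGrL : Gr L = 0)
    (hGrLam : ∀ l ∈ (Lam : Set ℝ), Gr l = Filter.liminf Gr (nhdsWithin l (Set.Ioi l)))
    (GA GB : ℝ) (hGA : 0 < GA) (hGB : 0 < GB)
    (Gc : ℝ → ℝ) (hGcv : ∀ l ∈ Set.Ioc (0:ℝ) L, Gc l = GA ∨ Gc l = GB)
    (hGcrc : ∀ l ∈ Set.Ioo (0:ℝ) L,
      Filter.Tendsto Gc (nhdsWithin l (Set.Ioi l)) (nhds (Gc l)))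
    (hGcc : ∀ l₁ ∈ Set.Ioo 0 L \ (Lam : Set ℝ), ∀ l₂ ∈ Set.Ioo 0 L \ (Lam : Set ℝ),
      l₁ ≤ l₂ → (∀ s ∈ Set.Icc l₁ l₂, s ∉ (Lam : Set ℝ)) → Gc l₁ = Gc l₂)
    (ℓ₁ ℓ₂ : ℝ → ℝ)
    (h₁ : GriffithCriterion L0 L T f Gr Gc ℓ₁)
    (h₂ : GriffithCriterion L0 L T f Gr Gc ℓ₂) :
    Set.EqOn ℓ₁ ℓ₂ (Set.Ico 0 T) := by
  have hfm : StrictMonoOn f (Set.Icc 0 T) := by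
    refine strictMonoOn_of_deriv_pos (convex_Icc 0 T) hf.continuousOn ?_
    intro x hx
    rw [← derivWithin_of_mem_nhds (mem_interior_iff_mem_nhds.1 hx)]
    exact hf' x (interior_subset hx)
  have hfn : ∀ s ∈ Set.Icc 0 T, 0 ≤ f s := by
    intro s hs
    rw [← hf0]
    exact hfm.monotoneOn ⟨le_rfl, hT.le⟩ hs hs.1
  have hF : ∀ s t, 0 ≤ s → s ≤ t → t < T → f s ^ 2 ≤ f t ^ 2 := by
    intro s t hs hst ht
    have hsm : s ∈ Set.Icc 0 T := ⟨hs, hst.trans ht.le⟩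
    exact pow_le_pow_left₀ (hfn s hsm) (hfm.monotoneOn hsm ⟨hs.trans hst, ht.le⟩ hst) 2
  have key : ∀ ℓ, GriffithCriterion L0 L T f Gr Gc ℓ → ∀ t ∈ Set.Ico 0 T, ∀ l, L0 ≤ l →
      l < ℓ t → ENNReal.ofReal (Gc l) ≤ ENNReal.ofReal (f t ^ 2) * Gr l := by
    intro ℓ h t ht l hl hlt
    by_contra hcon
    obtain ⟨l', b, h1, h2, h3, h4⟩ := griffith_aux_loc L Lam E hE1 Gr hGr hGrLam Gc hGcrc
      _ ENNReal.ofReal_ne_top l (ℓ t) (hL0.trans_le hl) hlt (h.2.2.2.1 t ht).2 (not_le.1 hcon)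
    exact griffith_aux_barrier L0 L T f Gr Gc hF ℓ h t ht l' b (hl.trans h1) h2 h3 h4
  have main : ∀ ℓ ℓ', GriffithCriterion L0 L T f Gr Gc ℓ → GriffithCriterion L0 L T f Gr Gc ℓ' →
      ∀ t ∈ Set.Ico 0 T, ℓ' t ≤ ℓ t := by
    intro ℓ ℓ' h h' t ht
    by_contra hcon
    rw [not_le] at hcon
    have hrc := h.2.1 t ht
    rw [nhdsWithin_Ioo_eq_nhdsGT ht.2] at hrc
    obtain ⟨s, hs1, hs2⟩ := ((hrc.eventually_lt_const hcon).and (Ioo_mem_nhdsGT ht.2)).exists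
    have hsm : s ∈ Set.Ico 0 T := ⟨ht.1.trans hs2.1.le, hs2.2⟩
    have hr := h.2.2.2.1 s hsm
    have ha := key ℓ' h' t ht (ℓ s) hr.1 hs1
    have hb := h.2.2.2.2.1 s hsm
    have hpos : 0 < Gc (ℓ s) := by
      rcases hGcv (ℓ s) ⟨hL0.trans_le hr.1, hr.2⟩ with e | e <;> rw [e] <;> assumption
    have hpos' := ENNReal.ofReal_pos.2 hpos
    have hft : f t < f s := hfm ⟨ht.1, ht.2.le⟩ ⟨hsm.1, hsm.2.le⟩ hs2.1
    have hft0 : 0 ≤ f t := hfn t ⟨ht.1, ht.2.le⟩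
    have hsq : ENNReal.ofReal (f t ^ 2) < ENNReal.ofReal (f s ^ 2) :=
      (ENNReal.ofReal_lt_ofReal_iff (pow_pos (hft0.trans_lt hft) 2)).2
        (pow_lt_pow_left₀ hft hft0 two_ne_zero)
    have hg0 : Gr (ℓ s) ≠ 0 := by
      intro e
      rw [e, mul_zero] at ha
      exact absurd hpos' (not_lt.2 ha)
    have hgt : Gr (ℓ s) ≠ ⊤ := by
      intro e
      rw [e, ENNReal.mul_top (ne_of_gt (lt_of_le_of_lt bot_le hsq))] at hb
      exact absurd (top_le_iff.1 hb) ENNReal.ofReal_ne_top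
    exact absurd (ENNReal.mul_lt_mul_left hg0 hgt hsq) (not_lt.2 (hb.trans ha))
  intro t ht
  exact le_antisymm (main _ _ h₂ h₁ t ht) (main _ _ h₁ h₂ t ht)
end

section
/- Let μ : [0,T] → [L0,L] be non-decreasing (not necessarily right-continuous) with μ(0) = L0, and suppose: (i) G(t,μ(t)) ≤ Gc(μ(t)) for every t ∈ [0,T]; (ii) if G(t,μ(t)) < Gc(μ(t)) and t < T, then the right derivative of μ at t exists and equals 0; (iii) at every jump point t of μ one has G(t,l) ≥ Gc(l) for every l ∈ [μ⁻(t), μ⁺(t)), where μ⁻ and μ⁺ denote the one-sided limits (with μ⁻(0) := L0 and μ⁺(T) := μ(T)). Then the right-continuous representative μ̂(t) := lim_{s→t⁺} μ(s) coincides on [0,T) with the function ℓ(t) = inf{ l ∈ [L0,L] : G(t,l) < Gc(l) }. -/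
open Set Filter Topology MeasureTheory
open scoped ENNReal

/-- From a point `l0 < m` where `c * Gr < Gc` one finds a whole open interval in `(L0, m)`
on which the strict inequality holds. -/
lemma griffith_interval (L0 L m : ℝ) (hL0 : 0 < L0) (hmL : m ≤ L)
    (Lam : Finset ℝ) (E : ℝ → ℝ)
    (hE1 : ContDiffOn ℝ 1 E (Set.Ioo 0 L \ (Lam : Set ℝ)))
    (Gr : ℝ → ℝ≥0∞)
    (hGr : ∀ l ∈ Set.Ioo 0 L \ (Lam : Set ℝ), Gr l = ENNReal.ofReal (-(deriv E l)))
    (hGrLam : ∀ l ∈ (Lam : Set ℝ), Gr l = Filter.liminf Gr (nhdsWithin l (Set.Ioi l)))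
    (Gc : ℝ → ℝ)
    (hGcrc : ∀ l ∈ Set.Ioo (0:ℝ) L,
      Filter.Tendsto Gc (nhdsWithin l (Set.Ioi l)) (nhds (Gc l)))
    (hGcc : ∀ l₁ ∈ Set.Ioo 0 L \ (Lam : Set ℝ), ∀ l₂ ∈ Set.Ioo 0 L \ (Lam : Set ℝ),
      l₁ ≤ l₂ → (∀ s ∈ Set.Icc l₁ l₂, s ∉ (Lam : Set ℝ)) → Gc l₁ = Gc l₂)
    (c : ℝ≥0∞) (hc : c ≠ ⊤) (l0 : ℝ) (hl0 : L0 ≤ l0) (hl0m : l0 < m)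
    (hlt : c * Gr l0 < ENNReal.ofReal (Gc l0)) :
    ∃ a l b, L0 ≤ a ∧ a < l ∧ l < b ∧ b ≤ m ∧
      ∀ l' ∈ Ioo a b, c * Gr l' < ENNReal.ofReal (Gc l') := by
  have hU : IsOpen (Ioo 0 L \ (Lam : Set ℝ)) := isOpen_Ioo.sdiff Lam.finite_toSet.isClosed
  have key : ∀ x ∈ Ioo 0 L \ (Lam : Set ℝ), c * Gr x < ENNReal.ofReal (Gc x) →
      ∀ᶠ y in 𝓝 x, c * Gr y < ENNReal.ofReal (Gc y) := by
    intro x hx hxlt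
    have hcd : ContinuousAt (deriv E) x :=
      (hE1.continuousOn_deriv_of_isOpen hU le_rfl).continuousAt (hU.mem_nhds hx)
    have hGrc : ContinuousAt Gr x := by
      have h1 : ContinuousAt (fun y => ENNReal.ofReal (-(deriv E y))) x :=
        ENNReal.continuous_ofReal.continuousAt.comp hcd.neg
      refine h1.congr ?_
      filter_upwards [hU.mem_nhds hx] with y hy
      exact (hGr y hy).symm
    have hcG : ContinuousAt (fun y => c * Gr y) x :=
      (ENNReal.continuous_const_mul hc).continuousAt.comp hGrc
    obtain ⟨r, hr, hball⟩ := Metric.isOpen_iff.mp hU x hx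
    filter_upwards [hcG.eventually_lt_const hxlt, Metric.ball_mem_nhds x hr] with y hy hyb
    have hsub : Set.uIcc x y ⊆ Ioo 0 L \ (Lam : Set ℝ) := by
      refine Subset.trans ?_ hball
      have hconv := (convex_ball x r).ordConnected
      exact hconv.uIcc_subset (Metric.mem_ball_self hr) hyb
    have heq : Gc y = Gc x := by
      rcases le_total x y with h | h
      · rw [Set.uIcc_of_le h] at hsub
        exact (hGcc x hx y (hball hyb) h (fun s hs => (hsub hs).2)).symm
      · rw [Set.uIcc_of_ge h] at hsub
        exact hGcc y (hball hyb) x hx h (fun s hs => (hsub hs).2)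
    rw [heq]; exact hy
  have hl0I : l0 ∈ Ioo 0 L := ⟨by linarith, by linarith⟩
  have hfreq : ∃ᶠ y in 𝓝[>] l0, c * Gr y < ENNReal.ofReal (Gc y) := by
    by_cases hmem : l0 ∈ (Lam : Set ℝ)
    · obtain ⟨r, hr1, hr2⟩ := exists_between hlt
      have hGcev : ∀ᶠ y in 𝓝[>] l0, r < ENNReal.ofReal (Gc y) :=
        ((ENNReal.continuous_ofReal.tendsto _).comp (hGcrc l0 hl0I)).eventually_const_lt hr2
      by_cases hc0 : c = 0
      · apply Eventually.frequently
        filter_upwards [hGcev] with y hy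
        rw [hc0, zero_mul]
        exact lt_of_le_of_lt zero_le hy
      · have h1 : Gr l0 < r / c := by
          rw [ENNReal.lt_div_iff_mul_lt (Or.inl hc0) (Or.inl hc), mul_comm]
          exact hr1
        rw [hGrLam l0 hmem] at h1
        refine ((frequently_lt_of_liminf_lt (by isBoundedDefault) h1).and_eventually hGcev).mono ?_
        rintro y ⟨hy1, hy2⟩
        rw [ENNReal.lt_div_iff_mul_lt (Or.inl hc0) (Or.inl hc), mul_comm] at hy1
        exact hy1.trans hy2
    · exact ((key l0 ⟨hl0I, hmem⟩ hlt).filter_mono nhdsWithin_le_nhds).frequently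
  have hnot : ∀ᶠ y in 𝓝[>] l0, y ∉ (Lam : Set ℝ) := by
    have h1 : IsClosed ((Lam : Set ℝ) \ {l0}) := (Lam.finite_toSet.subset sdiff_subset).isClosed
    have h2 : ∀ᶠ y in 𝓝 l0, y ∉ (Lam : Set ℝ) \ {l0} :=
      h1.isOpen_compl.mem_nhds (by simp)
    filter_upwards [h2.filter_mono nhdsWithin_le_nhds, self_mem_nhdsWithin] with y hy hy2 hy3
    exact hy ⟨hy3, ne_of_gt hy2⟩
  obtain ⟨l, hl1, hl2, hl3⟩ :=
    (hfreq.and_eventually (hnot.and (Ioo_mem_nhdsGT hl0m))).exists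
  have hlU : l ∈ Ioo 0 L \ (Lam : Set ℝ) :=
    ⟨⟨by linarith [hl3.1], by linarith [hl3.2]⟩, hl2⟩
  have hev := (key l hlU hl1).and (Ioo_mem_nhds hl3.1 hl3.2)
  obtain ⟨r, hr, hball⟩ := Metric.eventually_nhds_iff_ball.mp hev
  refine ⟨max L0 (l - r), l, min m (l + r), le_max_left _ _, max_lt (by linarith [hl3.1])
    (by linarith), lt_min hl3.2 (by linarith), min_le_left _ _, ?_⟩
  intro y hy
  apply (hball y ?_).1
  rw [Real.ball_eq_Ioo]
  exact ⟨lt_of_le_of_lt (le_max_right _ _) hy.1, lt_of_lt_of_le hy.2 (min_le_right _ _)⟩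

/-- If `μ : [0,T] → [L0,L]` is non-decreasing (not necessarily right
continuous), starts from `L0` and satisfies Griffith's criterion (i)–(iii) — with one-sided
limits `μ⁻(t) = sSup (μ '' [0,t))` (and `μ⁻(0) := L0`) and `μ⁺(t) = sInf (μ '' (t,T])`
(and `μ⁺(T) := μ(T)`), jump points being those `t` with `μ⁻(t) ≠ μ⁺(t)` — then the
right-continuous representative `μ̂(t) = lim_{s→t⁺} μ(s) = sInf (μ '' (t,T])` coincides on
`[0,T)` with `ℓ(t) = inf{ l ∈ [L0,L] : G(t,l) < Gc(l) }`. -/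
theorem griffith_right_continuous_representative
    (L0 L T : ℝ) (hL0 : 0 < L0) (hL0L : L0 < L) (hT : 0 < T)
    (f : ℝ → ℝ) (hf : ContDiffOn ℝ 1 f (Set.Icc 0 T)) (hf0 : f 0 = 0)
    (hf' : ∀ t ∈ Set.Icc (0:ℝ) T, 0 < derivWithin f (Set.Icc 0 T) t)
    (Lam : Finset ℝ) (hLam : (Lam : Set ℝ) ⊆ Set.Ioo 0 L)
    (E : ℝ → ℝ) (hEc : ContinuousOn E (Set.Ioc 0 L)) (hEm : AntitoneOn E (Set.Ioc 0 L))
    (hE1 : ContDiffOn ℝ 1 E (Set.Ioo 0 L \ (Lam : Set ℝ)))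
    (Gr : ℝ → ℝ≥0∞)
    (hGr : ∀ l ∈ Set.Ioo 0 L \ (Lam : Set ℝ), Gr l = ENNReal.ofReal (-(deriv E l)))
    (hGrL : Gr L = 0)
    (hGrLam : ∀ l ∈ (Lam : Set ℝ), Gr l = Filter.liminf Gr (nhdsWithin l (Set.Ioi l)))
    (GA GB : ℝ) (hGA : 0 < GA) (hGB : 0 < GB)
    (Gc : ℝ → ℝ) (hGcv : ∀ l ∈ Set.Ioc (0:ℝ) L, Gc l = GA ∨ Gc l = GB)
    (hGcrc : ∀ l ∈ Set.Ioo (0:ℝ) L,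
      Filter.Tendsto Gc (nhdsWithin l (Set.Ioi l)) (nhds (Gc l)))
    (hGcc : ∀ l₁ ∈ Set.Ioo 0 L \ (Lam : Set ℝ), ∀ l₂ ∈ Set.Ioo 0 L \ (Lam : Set ℝ),
      l₁ ≤ l₂ → (∀ s ∈ Set.Icc l₁ l₂, s ∉ (Lam : Set ℝ)) → Gc l₁ = Gc l₂)
    (μ : ℝ → ℝ) (hμmono : MonotoneOn μ (Set.Icc 0 T)) (hμ0 : μ 0 = L0)
    (hμrange : ∀ t ∈ Set.Icc (0:ℝ) T, μ t ∈ Set.Icc L0 L)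
    (μm : ℝ → ℝ) (hμm : μm = fun t => if t = 0 then L0 else sSup (μ '' Set.Ico 0 t))
    (μp : ℝ → ℝ) (hμp : μp = fun t => if t = T then μ T else sInf (μ '' Set.Ioc t T))
    (hi : ∀ t ∈ Set.Icc (0:ℝ) T,
      ENNReal.ofReal (f t ^ 2) * Gr (μ t) ≤ ENNReal.ofReal (Gc (μ t)))
    (hii : ∀ t ∈ Set.Ico (0:ℝ) T,
      ENNReal.ofReal (f t ^ 2) * Gr (μ t) < ENNReal.ofReal (Gc (μ t)) →
      HasDerivWithinAt μ 0 (Set.Icc t T) t)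
    (hiii : ∀ t ∈ Set.Icc (0:ℝ) T, μm t ≠ μp t →
      ∀ l, μm t ≤ l → l < μp t → ENNReal.ofReal (Gc l) ≤ ENNReal.ofReal (f t ^ 2) * Gr l) :
    ∀ t ∈ Set.Ico (0:ℝ) T, sInf (μ '' Set.Ioc t T) = griffithEvolution L0 L f Gr Gc t := by
  classical
  have hfc : ContinuousOn f (Icc 0 T) := hf.continuousOn
  have hfmono : StrictMonoOn f (Icc 0 T) := by
    apply strictMonoOn_of_deriv_pos (convex_Icc 0 T) hfc
    intro x hx
    rw [interior_Icc] at hx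
    have h1 := hf' x ⟨hx.1.le, hx.2.le⟩
    rwa [derivWithin_of_mem_nhds (Icc_mem_nhds hx.1 hx.2)] at h1
  have hf_nonneg : ∀ s ∈ Icc (0:ℝ) T, 0 ≤ f s := by
    intro s hs
    have := hfmono.monotoneOn ⟨le_refl _, hT.le⟩ hs hs.1
    rwa [hf0] at this
  have hGcpos : ∀ l ∈ Icc L0 L, 0 < ENNReal.ofReal (Gc l) := by
    intro l hl
    rw [ENNReal.ofReal_pos]
    rcases hGcv l ⟨by linarith [hl.1], hl.2⟩ with h | h <;> rw [h] <;> assumption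
  intro t ht
  have htT : t ∈ Icc (0:ℝ) T := ⟨ht.1, ht.2.le⟩
  have hbddb : ∀ s, 0 ≤ s → BddBelow (μ '' Ioc s T) := by
    rintro s hs
    refine ⟨L0, ?_⟩
    rintro _ ⟨x, hx, rfl⟩
    exact (hμrange x ⟨by linarith [hx.1], hx.2⟩).1
  have hne : ∀ s, s < T → (μ '' Ioc s T).Nonempty := fun s hs => ⟨μ T, T, ⟨hs, le_refl _⟩, rfl⟩
  have hbdda : ∀ s, s ≤ T → BddAbove (μ '' Ico 0 s) := by
    rintro s hs
    refine ⟨L, ?_⟩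
    rintro _ ⟨x, hx, rfl⟩
    exact (hμrange x ⟨hx.1, by linarith [hx.2]⟩).2
  have hne' : ∀ s, 0 < s → (μ '' Ico 0 s).Nonempty := fun s hs => ⟨μ 0, 0, ⟨le_refl _, hs⟩, rfl⟩
  unfold griffithEvolution
  set m := sInf (μ '' Ioc t T) with hm
  have hmle : ∀ s ∈ Ioc t T, m ≤ μ s := fun s hs => csInf_le (hbddb t ht.1) ⟨s, hs, rfl⟩
  have hmL : m ≤ L := (hmle T ⟨ht.2, le_refl _⟩).trans (hμrange T ⟨hT.le, le_refl _⟩).2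
  apply le_antisymm
  · -- hard direction
    have hLmem : L ∈ {l | l ∈ Icc L0 L ∧
        ENNReal.ofReal (f t ^ 2) * Gr l < ENNReal.ofReal (Gc l)} := by
      refine ⟨⟨hL0L.le, le_refl _⟩, ?_⟩
      rw [hGrL, mul_zero]
      exact hGcpos L ⟨hL0L.le, le_refl _⟩
    apply le_csInf ⟨L, hLmem⟩
    rintro l0 ⟨hl0, hlt0⟩
    by_contra hcon
    push Not at hcon
    obtain ⟨a, l, b, haL0, hal, hlb, hbm, hI⟩ :=
      griffith_interval L0 L m hL0 hmL Lam E hE1 Gr hGr hGrLam Gc hGcrc hGcc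
        (ENNReal.ofReal (f t ^ 2)) ENNReal.ofReal_ne_top l0 hl0.1 hcon hlt0
    have hIs : ∀ s ∈ Icc (0:ℝ) t, ∀ l' ∈ Ioo a b,
        ENNReal.ofReal (f s ^ 2) * Gr l' < ENNReal.ofReal (Gc l') := by
      intro s hs l' hl'
      refine lt_of_le_of_lt ?_ (hI l' hl')
      have hsT : s ∈ Icc (0:ℝ) T := ⟨hs.1, hs.2.trans ht.2.le⟩
      have h1 := hfmono.monotoneOn hsT htT hs.2
      have h2 := hf_nonneg s hsT
      gcongr
    have hmm : ∀ s, s ∈ Ioo 0 T → μm s ≤ μ s := by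
      intro s hs
      rw [hμm]
      simp only [hs.1.ne', if_false]
      apply csSup_le (hne' s hs.1)
      rintro _ ⟨x, hx, rfl⟩
      exact hμmono ⟨hx.1, by linarith [hx.2, hs.2]⟩ ⟨hs.1.le, hs.2.le⟩ hx.2.le
    have hmp : ∀ s, s ∈ Ico 0 T → μ s ≤ μp s := by
      intro s hs
      rw [hμp]
      simp only [hs.2.ne, if_false]
      apply le_csInf (hne s hs.2)
      rintro _ ⟨x, hx, rfl⟩
      exact hμmono ⟨hs.1, hs.2.le⟩ ⟨by linarith [hx.1, hs.1], hx.2⟩ hx.1.le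
    have hnojump : ∀ s ∈ Icc (0:ℝ) t, ∀ l' ∈ Ioo a b, μm s ≤ l' → μp s ≤ l' := by
      intro s hs l' hl' h1
      by_contra h2
      push Not at h2
      have h3 := hiii s ⟨hs.1, hs.2.trans ht.2.le⟩ (by linarith) l' h1 h2
      exact absurd (hIs s hs l' hl') (not_lt.mpr h3)
    set J := {s | s ∈ Icc (0:ℝ) T ∧ μ s ≤ l} with hJ
    have h0J : (0:ℝ) ∈ J := ⟨⟨le_refl _, hT.le⟩, by rw [hμ0]; linarith⟩
    have hJt : ∀ s ∈ J, s ≤ t := by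
      rintro s ⟨hs, hsl⟩
      by_contra h
      push Not at h
      have := hmle s ⟨h, hs.2⟩
      linarith
    have hJb : BddAbove J := ⟨t, hJt⟩
    set q := sSup J with hq
    have hq0 : 0 ≤ q := le_csSup hJb h0J
    have hqt : q ≤ t := csSup_le ⟨0, h0J⟩ hJt
    have hqT : q < T := lt_of_le_of_lt hqt ht.2
    have hlow : ∀ s, 0 ≤ s → s < q → μ s ≤ l := by
      intro s hs0 hs
      obtain ⟨x, hx, hsx⟩ := exists_lt_of_lt_csSup ⟨0, h0J⟩ hs
      exact (hμmono ⟨hs0, by linarith⟩ hx.1 hsx.le).trans hx.2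
    have hhigh : ∀ s, q < s → s ≤ T → l < μ s := by
      intro s hs hsT
      by_contra h
      push Not at h
      have := le_csSup hJb (show s ∈ J from ⟨⟨by linarith, hsT⟩, h⟩)
      linarith
    have hmq : μm q ≤ l := by
      rw [hμm]
      by_cases h : q = 0
      · simp only [h, if_true]; linarith
      · simp only [h, if_false]
        apply csSup_le (hne' q (lt_of_le_of_ne hq0 (Ne.symm h)))
        rintro _ ⟨x, hx, rfl⟩
        exact hlow x hx.1 hx.2
    have hpq : l ≤ μp q := by
      rw [hμp]
      simp only [hqT.ne, if_false]
      apply le_csInf (hne q hqT)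
      rintro _ ⟨x, hx, rfl⟩
      exact (hhigh x hx.1 hx.2).le
    have hpq' : μp q ≤ l := hnojump q ⟨hq0, hqt⟩ l ⟨hal, hlb⟩ hmq
    have hmq' : l ≤ μm q := by
      by_contra h
      push Not at h
      have h1 : max (μm q) ((a + l) / 2) < l := max_lt h (by linarith)
      have h2 := hnojump q ⟨hq0, hqt⟩ (max (μm q) ((a + l) / 2))
        ⟨lt_of_lt_of_le (by linarith) (le_max_right _ _), by linarith⟩ (le_max_left _ _)
      linarith
    have hqpos : 0 < q := by
      rcases hq0.lt_or_eq with h | h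
      · exact h
      · exfalso
        rw [hμm, ← h] at hmq'
        simp only [if_true] at hmq'
        linarith
    have hμq : μ q = l :=
      le_antisymm ((hmp q ⟨hq0, hqT⟩).trans hpq') (hmq'.trans (hmm q ⟨hqpos, hqT⟩))
    have hpb : sInf (μ '' Ioc q T) < b := by
      rw [hμp] at hpq'
      simp only [hqT.ne, if_false] at hpq'
      linarith
    obtain ⟨_, ⟨e, he, rfl⟩, heb⟩ := exists_lt_of_csInf_lt (hne q hqT) hpb
    have het : e ≤ t := by
      by_contra h
      push Not at h
      have := hmle e ⟨h, he.2⟩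
      linarith
    have hrange : ∀ s ∈ Icc q e, μ s ∈ Ioo a b := by
      intro s hs
      have h1 := hμmono ⟨hq0, hqT.le⟩ ⟨hq0.trans hs.1, hs.2.trans he.2⟩ hs.1
      have h2 := hμmono ⟨hq0.trans hs.1, hs.2.trans he.2⟩ ⟨hq0.trans he.1.le, he.2⟩ hs.2
      exact ⟨by linarith, by linarith⟩
    have hcont : ContinuousOn μ (Icc q e) := by
      intro s hs
      apply ContinuousAt.continuousWithinAt
      have hs0 : 0 < s := lt_of_lt_of_le hqpos hs.1
      have hst : s ≤ t := hs.2.trans het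
      have hsT : s < T := lt_of_le_of_lt hst ht.2
      have h1 : l ≤ μm s := by
        rcases hs.1.lt_or_eq with h | h
        · rw [hμm]
          simp only [hs0.ne', if_false]
          rw [← hμq]
          exact le_csSup (hbdda s hsT.le) ⟨q, ⟨hq0, h⟩, rfl⟩
        · rw [← h]; exact hmq'
      have h2 := hmm s ⟨hs0, hsT⟩
      have h3 := hmp s ⟨hs0.le, hsT⟩
      have h4 := hrange s hs
      have h5 := hnojump s ⟨hs0.le, hst⟩ (μm s) ⟨by linarith, by linarith [h4.2]⟩ le_rfl
      have h6 : sSup (μ '' Ico 0 s) = μ s := by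
        have : μm s = μ s := by linarith
        rw [hμm] at this
        simpa only [hs0.ne', if_false] using this
      have h7 : sInf (μ '' Ioc s T) = μ s := by
        have : μp s = μ s := by linarith
        rw [hμp] at this
        simpa only [hsT.ne, if_false] using this
      rw [Metric.continuousAt_iff']
      intro ε hε
      obtain ⟨_, ⟨x, hx, rfl⟩, hxe⟩ := exists_lt_of_lt_csSup (hne' s hs0)
        (show μ s - ε < sSup (μ '' Ico 0 s) by linarith)
      obtain ⟨_, ⟨y, hy, rfl⟩, hye⟩ := exists_lt_of_csInf_lt (hne s hsT)
        (show sInf (μ '' Ioc s T) < μ s + ε by linarith)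
      filter_upwards [Ioo_mem_nhds hx.2 hy.1] with z hz
      have hzT : z ∈ Icc 0 T := ⟨hx.1.trans hz.1.le, hz.2.le.trans hy.2⟩
      have h8 := hμmono ⟨hx.1, hx.2.le.trans hsT.le⟩ hzT hz.1.le
      have h9 := hμmono hzT ⟨hs0.le.trans hy.1.le, hy.2⟩ hz.2.le
      rw [Real.dist_eq, abs_lt]
      constructor <;> linarith
    have hder : ∀ s ∈ Ico q e, HasDerivWithinAt μ 0 (Ici s) s := by
      intro s hs
      have hst : s ≤ t := hs.2.le.trans het
      have hsT : s < T := lt_of_le_of_lt hst ht.2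
      have hs0 : 0 ≤ s := hq0.trans hs.1
      have := hii s ⟨hs0, hsT⟩ (hIs s ⟨hs0, hst⟩ _ (hrange s ⟨hs.1, hs.2.le⟩))
      exact this.mono_of_mem_nhdsWithin (Icc_mem_nhdsGE hsT)
    have hfin := constant_of_has_deriv_right_zero hcont hder e ⟨he.1.le, le_rfl⟩
    have := hhigh e he.1 he.2
    linarith
  · -- easy direction
    apply le_csInf (hne t ht.2)
    rintro _ ⟨s, hs, rfl⟩
    have hsT : s ∈ Icc (0:ℝ) T := ⟨by linarith [hs.1, ht.1], hs.2⟩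
    apply csInf_le ⟨L0, fun x hx => hx.1.1⟩
    refine ⟨hμrange s hsT, ?_⟩
    have hpos := hGcpos _ (hμrange s hsT)
    have h1 := hi s hsT
    have h2 : f t < f s := hfmono htT hsT hs.1
    have h3 := hf_nonneg t htT
    have h4 : f t ^ 2 < f s ^ 2 := by gcongr
    have h5 : 0 < f s ^ 2 := lt_of_le_of_lt (sq_nonneg _) h4
    by_cases hG : Gr (μ s) = 0
    · rw [hG, mul_zero]; exact hpos
    · have hGt : Gr (μ s) ≠ ⊤ := by
        intro h
        rw [h, ENNReal.mul_top (ENNReal.ofReal_pos.mpr h5).ne'] at h1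
        exact ENNReal.ofReal_ne_top (top_le_iff.mp h1)
      refine lt_of_lt_of_le ?_ h1
      exact (ENNReal.mul_lt_mul_iff_left hG hGt).mpr ((ENNReal.ofReal_lt_ofReal_iff h5).mpr h4)
end

section
/- Let ℓ : [0,T) → [L0,L] be given by ℓ(t) = inf{ l ∈ [L0,L] : G(t,l) < Gc(l) }. If t ∈ (0,T) and G(t,ℓ(t)) < Gc(ℓ(t)), then there exists δ > 0 such that ℓ is constant on [t, t+δ) ∩ [0,T). -/
open Set Filter Topology MeasureTheory
open scoped ENNReal

/-- If `t ∈ (0,T)` and `G(t,ℓ(t)) < Gc(ℓ(t))` then `ℓ` is constant on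
`[t, t+δ) ∩ [0,T)` for some `δ > 0`. -/
theorem griffith_locally_constant_right
    (L0 L T : ℝ) (hL0 : 0 < L0) (hL0L : L0 < L) (hT : 0 < T)
    (f : ℝ → ℝ) (hf : ContDiffOn ℝ 1 f (Set.Icc 0 T)) (hf0 : f 0 = 0)
    (hf' : ∀ t ∈ Set.Icc (0:ℝ) T, 0 < derivWithin f (Set.Icc 0 T) t)
    (Lam : Finset ℝ) (hLam : (Lam : Set ℝ) ⊆ Set.Ioo 0 L)
    (E : ℝ → ℝ) (hEc : ContinuousOn E (Set.Ioc 0 L)) (hEm : AntitoneOn E (Set.Ioc 0 L))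
    (hE1 : ContDiffOn ℝ 1 E (Set.Ioo 0 L \ (Lam : Set ℝ)))
    (Gr : ℝ → ℝ≥0∞)
    (hGr : ∀ l ∈ Set.Ioo 0 L \ (Lam : Set ℝ), Gr l = ENNReal.ofReal (-(deriv E l)))
    (hGrL : Gr L = 0)
    (hGrLam : ∀ l ∈ (Lam : Set ℝ), Gr l = Filter.liminf Gr (nhdsWithin l (Set.Ioi l)))
    (GA GB : ℝ) (hGA : 0 < GA) (hGB : 0 < GB)
    (Gc : ℝ → ℝ) (hGcv : ∀ l ∈ Set.Ioc (0:ℝ) L, Gc l = GA ∨ Gc l = GB)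
    (hGcrc : ∀ l ∈ Set.Ioo (0:ℝ) L,
      Filter.Tendsto Gc (nhdsWithin l (Set.Ioi l)) (nhds (Gc l)))
    (hGcc : ∀ l₁ ∈ Set.Ioo 0 L \ (Lam : Set ℝ), ∀ l₂ ∈ Set.Ioo 0 L \ (Lam : Set ℝ),
      l₁ ≤ l₂ → (∀ s ∈ Set.Icc l₁ l₂, s ∉ (Lam : Set ℝ)) → Gc l₁ = Gc l₂)
    (ℓ : ℝ → ℝ) (hℓ : ℓ = griffithEvolution L0 L f Gr Gc)
    (t : ℝ) (ht0 : 0 < t) (htT : t < T)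
    (hlt : ENNReal.ofReal (f t ^ 2) * Gr (ℓ t) < ENNReal.ofReal (Gc (ℓ t))) :
    ∃ δ > (0:ℝ), ∀ s ∈ Set.Ico t (t + δ) ∩ Set.Ico 0 T, ℓ s = ℓ t := by
  have hcont : ContinuousOn f (Set.Icc 0 T) := hf.continuousOn
  have hmono : StrictMonoOn f (Set.Icc 0 T) := by
    apply strictMonoOn_of_deriv_pos (convex_Icc 0 T) hcont
    intro x hx
    rw [interior_Icc] at hx
    rw [← derivWithin_of_mem_nhds (Icc_mem_nhds hx.1 hx.2)]
    exact hf' x (Ioo_subset_Icc_self hx)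
  have htm : t ∈ Set.Icc 0 T := ⟨ht0.le, htT.le⟩
  have hft : 0 < f t := by
    have := hmono ⟨le_rfl, hT.le⟩ htm ht0
    rwa [hf0] at this
  have hLS : ∀ s, L ∈ {l | l ∈ Set.Icc L0 L ∧
      ENNReal.ofReal (f s ^ 2) * Gr l < ENNReal.ofReal (Gc l)} := by
    intro s
    refine ⟨⟨hL0L.le, le_rfl⟩, ?_⟩
    rw [hGrL, mul_zero, ENNReal.ofReal_pos]
    rcases hGcv L ⟨hL0.trans hL0L, le_rfl⟩ with h | h <;> rw [h] <;> assumption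
  have hbdd : ∀ s, BddBelow {l | l ∈ Set.Icc L0 L ∧
      ENNReal.ofReal (f s ^ 2) * Gr l < ENNReal.ofReal (Gc l)} :=
    fun s => ⟨L0, fun l hl => hl.1.1⟩
  have hlm : ℓ t ∈ Set.Icc L0 L := by
    rw [hℓ]
    exact ⟨le_csInf ⟨L, hLS t⟩ fun l hl => hl.1.1, csInf_le (hbdd t) (hLS t)⟩
  have hfin : Gr (ℓ t) ≠ ⊤ := by
    intro h
    rw [h, ENNReal.mul_top (by rw [Ne, ENNReal.ofReal_eq_zero, not_le]; positivity)] at hlt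
    exact not_top_lt hlt
  have htend : Tendsto (fun s => ENNReal.ofReal (f s ^ 2) * Gr (ℓ t)) (𝓝[Set.Icc 0 T] t)
      (𝓝 (ENNReal.ofReal (f t ^ 2) * Gr (ℓ t))) :=
    ENNReal.Tendsto.mul_const (ENNReal.tendsto_ofReal ((hcont t htm).pow 2)) (Or.inr hfin)
  have hev := htend.eventually (gt_mem_nhds hlt)
  obtain ⟨δ, hδ, hball⟩ := Metric.mem_nhdsWithin_iff.1 hev
  refine ⟨δ, hδ, ?_⟩
  rintro s ⟨⟨hs1, hs2⟩, hs3, hs4⟩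
  have hsm : s ∈ Set.Icc 0 T := ⟨hs3, hs4.le⟩
  have hs : ENNReal.ofReal (f s ^ 2) * Gr (ℓ t) < ENNReal.ofReal (Gc (ℓ t)) := by
    refine hball ⟨?_, hsm⟩
    rw [Metric.mem_ball, Real.dist_eq, abs_lt]
    constructor <;> linarith
  have hfs : f t ≤ f s := hmono.monotoneOn htm hsm hs1
  apply le_antisymm
  · have : griffithEvolution L0 L f Gr Gc s ≤ ℓ t := csInf_le (hbdd s) ⟨hlm, hs⟩
    rwa [← hℓ] at this
  · rw [hℓ]
    refine csInf_le_csInf (hbdd t) ⟨L, hLS s⟩ ?_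
    rintro l ⟨hl1, hl2⟩
    refine ⟨hl1, lt_of_le_of_lt ?_ hl2⟩
    gcongr
end

section
/- Let ℓ : [0,T) → [L0,L] be given by ℓ(t) = inf{ l ∈ [L0,L] : G(t,l) < Gc(l) }. Define the dissipated energy D(l) = ∫_{L0}^{l} Gc(s) ds and the potential energy F(t,l) = f(t)²·E(l) + D(l). Then for every t ∈ [0,T) the energy identity holds: F(t,ℓ(t)) = ∫₀ᵗ 2 f(τ) f'(τ) E(ℓ(τ)) dτ + Σ_{τ ∈ J(ℓ) ∩ [0,t]} ( F(τ,ℓ(τ)) − F(τ,ℓ⁻(τ)) ), where J(ℓ) denotes the (at most countable) set of jump points of ℓ, ℓ⁻(τ) the left limit of ℓ at τ (with ℓ⁻(0) := L0), each summand F(τ,ℓ(τ)) − F(τ,ℓ⁻(τ)) is ≤ 0, and the series converges absolutely. -/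
open Set Filter Topology MeasureTheory
open scoped ENNReal

/-- First hitting time of the level `l`. -/
theorem griffith_hit (T : ℝ) (ℓ : ℝ → ℝ) (hmono : MonotoneOn ℓ (Set.Ico 0 T))
    (hRC : ∀ τ ∈ Set.Ico 0 T, ∀ l, (∀ s ∈ Set.Ioo τ T, l ≤ ℓ s) → l ≤ ℓ τ)
    (t l : ℝ) (ht : t ∈ Set.Ico 0 T) (hl : l ≤ ℓ t) (hl0 : ℓ 0 < l) :
    ∃ σ ∈ Set.Ioc 0 t, l ≤ ℓ σ ∧ ∀ s, 0 ≤ s → s < σ → ℓ s < l := by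
  set S : Set ℝ := {τ | τ ∈ Set.Ico 0 T ∧ l ≤ ℓ τ} with hS
  have htS : t ∈ S := ⟨ht, hl⟩
  have hbd : BddBelow S := ⟨0, fun x hx => hx.1.1⟩
  have h0 : 0 ≤ sInf S := le_csInf ⟨t, htS⟩ fun x hx => hx.1.1
  have h1 : sInf S ≤ t := csInf_le hbd htS
  have hm : sInf S ∈ Set.Ico 0 T := ⟨h0, h1.trans_lt ht.2⟩
  have h2 : l ≤ ℓ (sInf S) := by
    apply hRC _ hm
    intro s hs
    obtain ⟨τ, hτ, hτs⟩ := exists_lt_of_csInf_lt ⟨t, htS⟩ hs.1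
    exact hτ.2.trans (hmono hτ.1 ⟨h0.trans hs.1.le, hs.2⟩ hτs.le)
  refine ⟨sInf S, ⟨?_, h1⟩, h2, ?_⟩
  · rcases h0.eq_or_lt with h | h
    · rw [← h] at h2; exact absurd h2 (not_le.2 hl0)
    · exact h
  · intro s hs0 hs
    by_contra hc
    exact absurd (csInf_le hbd (show s ∈ S from ⟨⟨hs0, hs.trans hm.2⟩, not_lt.1 hc⟩)) (not_le.2 hs)

/-- Fubini step. -/
theorem griffith_fubini (L0 L T : ℝ) (ℓ p E g g' σ : ℝ → ℝ)
    (hmono : MonotoneOn ℓ (Set.Ico 0 T))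
    (hℓ : ∀ t ∈ Set.Ico 0 T, ℓ t ∈ Set.Icc L0 L)
    (hp : IntegrableOn p (Set.Ioc L0 L))
    (hE : ∀ a b, L0 ≤ a → a ≤ b → b ≤ L → ∫ l in Set.Ioc a b, p l = E a - E b)
    (hg'i : ∀ x ∈ Set.Ico 0 T, IntegrableOn g' (Set.Ioc 0 x))
    (hg : ∀ x ∈ Set.Ico 0 T, ∫ s in Set.Ioc 0 x, g' s = g x)
    (t : ℝ) (ht : t ∈ Set.Ico 0 T)
    (hσ : ∀ l ∈ Set.Ioc L0 (ℓ t), σ l ∈ Set.Ioc 0 t ∧ l ≤ ℓ (σ l) ∧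
      ∀ s, 0 ≤ s → s < σ l → ℓ s < l) :
    IntegrableOn (fun l => g (σ l) * p l) (Set.Ioc L0 (ℓ t)) ∧
    ∫ s in Set.Ioc 0 t, g' s * E (ℓ s) =
      g t * E (ℓ t) + ∫ l in Set.Ioc L0 (ℓ t), g (σ l) * p l := by
  have hsub : Set.Ioc 0 t ⊆ Set.Ico 0 T := fun x hx => ⟨hx.1.le, hx.2.trans_lt ht.2⟩
  set μ := (volume : Measure ℝ).restrict (Set.Ioc 0 t)
  set ν := (volume : Measure ℝ).restrict (Set.Ioc L0 (ℓ t))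
  have hpi : IntegrableOn p (Set.Ioc L0 (ℓ t)) :=
    hp.mono_set (Set.Ioc_subset_Ioc_right (hℓ t ht).2)
  have hmeas : AEMeasurable ℓ μ :=
    aemeasurable_restrict_of_monotoneOn measurableSet_Ioc (hmono.mono hsub)
  have hN : NullMeasurableSet {z : ℝ × ℝ | ℓ z.1 < z.2} (μ.prod ν) :=
    nullMeasurableSet_lt hmeas.comp_fst measurable_snd.aemeasurable
  have hI : Integrable ({z : ℝ × ℝ | ℓ z.1 < z.2}.indicator (fun z => g' z.1 * p z.2)) (μ.prod ν) :=
    ((hg'i t ht).integrable.mul_prod hpi.integrable).indicator₀ hN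
  have hleft : ∀ s ∈ Set.Ioc 0 t,
      ∫ l, {z : ℝ × ℝ | ℓ z.1 < z.2}.indicator (fun z => g' z.1 * p z.2) (s, l) ∂ν
        = g' s * (E (ℓ s) - E (ℓ t)) := by
    intro s hs
    have h1 : ∀ l, {z : ℝ × ℝ | ℓ z.1 < z.2}.indicator (fun z => g' z.1 * p z.2) (s, l)
        = (Set.Ioi (ℓ s)).indicator (fun l => g' s * p l) l := by
      intro l; simp only [Set.indicator, Set.mem_ofPred_eq, Set.mem_Ioi]
    simp only [h1]
    rw [setIntegral_indicator measurableSet_Ioi, integral_const_mul]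
    have h2 : Set.Ioc L0 (ℓ t) ∩ Set.Ioi (ℓ s) = Set.Ioc (ℓ s) (ℓ t) := by
      have := (hℓ s (hsub hs)).1
      ext x; simp only [Set.mem_inter_iff, Set.mem_Ioc, Set.mem_Ioi]
      constructor
      · rintro ⟨⟨a, b⟩, c⟩; exact ⟨c, b⟩
      · rintro ⟨a, b⟩; exact ⟨⟨by linarith, b⟩, a⟩
    rw [h2, hE _ _ (hℓ s (hsub hs)).1 (hmono (hsub hs) ht hs.2) (hℓ t ht).2]
  have hright : ∀ l ∈ Set.Ioc L0 (ℓ t),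
      ∫ s, {z : ℝ × ℝ | ℓ z.1 < z.2}.indicator (fun z => g' z.1 * p z.2) (s, l) ∂μ
        = g (σ l) * p l := by
    intro l hl
    obtain ⟨h1, h2, h3⟩ := hσ l hl
    have e1 : ∫ s, {z : ℝ × ℝ | ℓ z.1 < z.2}.indicator (fun z => g' z.1 * p z.2) (s, l) ∂μ
        = ∫ s, (Set.Iio (σ l)).indicator (fun s => g' s * p l) s ∂μ := by
      apply setIntegral_congr_fun measurableSet_Ioc
      intro s hs
      simp only [Set.indicator, Set.mem_ofPred_eq, Set.mem_Iio]
      have : ℓ s < l ↔ s < σ l := by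
        constructor
        · intro h
          by_contra hc
          have := hmono (hsub h1) (hsub hs) (not_lt.1 hc)
          linarith
        · exact h3 s hs.1.le
      simp only [this]
    rw [e1, setIntegral_indicator measurableSet_Iio, integral_mul_const]
    have h4 : Set.Ioc 0 t ∩ Set.Iio (σ l) = Set.Ioo 0 (σ l) := by
      have := h1.2
      ext x; simp only [Set.mem_inter_iff, Set.mem_Ioc, Set.mem_Iio, Set.mem_Ioo]
      constructor
      · rintro ⟨⟨a, b⟩, c⟩; exact ⟨a, c⟩
      · rintro ⟨a, b⟩; exact ⟨⟨a, by linarith⟩, b⟩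
    rw [h4, ← integral_Ioc_eq_integral_Ioo, hg _ (hsub h1)]
  have hL := hI.integral_prod_left
  have hR := hI.integral_prod_right
  have hswap := integral_integral_swap (μ := μ) (ν := ν)
    (f := fun s l => {z : ℝ × ℝ | ℓ z.1 < z.2}.indicator (fun z => g' z.1 * p z.2) (s, l)) hI
  have hL' : IntegrableOn (fun s => g' s * (E (ℓ s) - E (ℓ t))) (Set.Ioc 0 t) :=
    IntegrableOn.congr_fun hL hleft measurableSet_Ioc
  have hR' : IntegrableOn (fun l => g (σ l) * p l) (Set.Ioc L0 (ℓ t)) :=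
    IntegrableOn.congr_fun hR hright measurableSet_Ioc
  refine ⟨hR', ?_⟩
  rw [setIntegral_congr_fun measurableSet_Ioc hleft,
    setIntegral_congr_fun measurableSet_Ioc hright] at hswap
  rw [← hswap, ← hg t ht, ← integral_mul_const, ← integral_add ((hg'i t ht).integrable.mul_const _) hL']
  congr 1; ext s; ring

theorem griffith_core (L0 L T : ℝ) (ℓ ℓm p Gc E g g' : ℝ → ℝ) (Lam : Finset ℝ)
    (hmono : MonotoneOn ℓ (Set.Ico 0 T)) (hℓ0 : ℓ 0 = L0)
    (hℓ : ∀ t ∈ Set.Ico 0 T, ℓ t ∈ Set.Icc L0 L)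
    (hRC : ∀ τ ∈ Set.Ico 0 T, ∀ l, (∀ s ∈ Set.Ioo τ T, l ≤ ℓ s) → l ≤ ℓ τ)
    (hp : IntegrableOn p (Set.Ioc L0 L)) (hGc : IntegrableOn Gc (Set.Ioc L0 L))
    (hpc : ∀ l ∈ Set.Ioo L0 L \ (Lam : Set ℝ), ContinuousAt p l)
    (hGcc : ∀ l ∈ Set.Ioo L0 L \ (Lam : Set ℝ), ContinuousAt Gc l)
    (hE : ∀ a b, L0 ≤ a → a ≤ b → b ≤ L → ∫ l in Set.Ioc a b, p l = E a - E b)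
    (hgc : ContinuousOn g (Set.Ico 0 T))
    (hg'i : ∀ x ∈ Set.Ico 0 T, IntegrableOn g' (Set.Ioc 0 x))
    (hg : ∀ x ∈ Set.Ico 0 T, ∫ s in Set.Ioc 0 x, g' s = g x)
    (P1 : ∀ t ∈ Set.Ico 0 T, ∀ l ∈ Set.Ioo L0 L \ (Lam : Set ℝ), l < ℓ t → Gc l ≤ g t * p l)
    (P2 : ∀ t ∈ Set.Ico 0 T, ∀ ε > 0, ∃ l, ℓ t ≤ l ∧ l < ℓ t + ε ∧
      (l ∈ Set.Ioo L0 L \ (Lam : Set ℝ) → g t * p l ≤ Gc l))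
    (hm0 : ℓm 0 = L0) (hm1 : ∀ τ ∈ Set.Ioo 0 T, ℓm τ = sSup (ℓ '' Set.Ico 0 τ))
    (D : ℝ → ℝ) (hD : D = fun l => ∫ s in L0..l, Gc s)
    (F : ℝ → ℝ → ℝ) (hF : F = fun t l => g t * E l + D l)
    (J : Set ℝ) (hJ : J = {τ | τ ∈ Set.Ico 0 T ∧ ℓm τ ≠ ℓ τ}) :
    J.Countable ∧
    ∀ t ∈ Set.Ico (0:ℝ) T,
      (∀ τ ∈ J ∩ Set.Icc 0 t, F τ (ℓ τ) - F τ (ℓm τ) ≤ 0) ∧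
      Summable (fun τ : (J ∩ Set.Icc 0 t : Set ℝ) => F τ.1 (ℓ τ.1) - F τ.1 (ℓm τ.1)) ∧
      F t (ℓ t) =
        (∫ τ in (0:ℝ)..t, g' τ * E (ℓ τ)) +
          ∑' τ : (J ∩ Set.Icc 0 t : Set ℝ), (F τ.1 (ℓ τ.1) - F τ.1 (ℓm τ.1)) := by
  -- facts about the left limit
  have hbdd : ∀ τ ∈ Set.Ioo 0 T, ∀ x ∈ ℓ '' Set.Ico 0 τ, x ≤ ℓ τ := by
    rintro τ hτ _ ⟨s, hs, rfl⟩
    exact hmono ⟨hs.1, hs.2.trans hτ.2⟩ ⟨hτ.1.le, hτ.2⟩ hs.2.le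
  have M1 : ∀ τ ∈ Set.Ioo 0 T, ∀ s ∈ Set.Ico 0 τ, ℓ s ≤ ℓm τ := by
    intro τ hτ s hs
    rw [hm1 τ hτ]
    exact le_csSup ⟨ℓ τ, hbdd τ hτ⟩ ⟨s, hs, rfl⟩
  have M2 : ∀ τ ∈ Set.Ioo 0 T, ∀ x, (∀ s ∈ Set.Ico 0 τ, ℓ s ≤ x) → ℓm τ ≤ x := by
    intro τ hτ x hx
    rw [hm1 τ hτ]
    refine csSup_le (Set.Nonempty.image ℓ (Set.nonempty_Ico.2 hτ.1)) ?_
    rintro _ ⟨s, hs, rfl⟩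
    exact hx s hs
  have M3 : ∀ τ ∈ Set.Ioo 0 T, ∀ x < ℓm τ, ∃ s ∈ Set.Ico 0 τ, x < ℓ s := by
    intro τ hτ x hx
    by_contra! hc
    exact absurd (M2 τ hτ x hc) (not_le.2 hx)
  have hJ1 : ∀ τ ∈ J, τ ∈ Set.Ioo 0 T ∧ ℓm τ < ℓ τ := by
    intro τ hτ
    rw [hJ] at hτ
    obtain ⟨h1, h2⟩ := hτ
    have h3 : τ ∈ Set.Ioo 0 T := by
      refine ⟨lt_of_le_of_ne h1.1 ?_, h1.2⟩
      rintro rfl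
      exact h2 (by rw [hm0, hℓ0])
    exact ⟨h3, lt_of_le_of_ne (M2 τ h3 _ fun s hs => hbdd τ h3 _ ⟨s, hs, rfl⟩) h2⟩
  have hJL : ∀ τ ∈ Set.Ioo 0 T, L0 ≤ ℓm τ := fun τ hτ => by
    rw [← hℓ0]; exact M1 τ hτ 0 ⟨le_rfl, hτ.1⟩
  have hdisj' : ∀ a ∈ J, ∀ b ∈ J, a < b →
      Disjoint (Set.Ioc (ℓm a) (ℓ a)) (Set.Ioc (ℓm b) (ℓ b)) := by
    intro a ha b hb hab
    rw [Set.disjoint_left]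
    intro x hx hx'
    have := M1 b (hJ1 b hb).1 a ⟨(hJ1 a ha).1.1.le, hab⟩
    linarith [hx.2, hx'.1]
  have hdisj : J.PairwiseDisjoint (fun τ => Set.Ioc (ℓm τ) (ℓ τ)) := by
    intro a ha b hb hab
    rcases lt_or_gt_of_ne hab with h | h
    · exact hdisj' a ha b hb h
    · exact (hdisj' b hb a ha h).symm
  have hJc : J.Countable := by
    apply hdisj.countable_of_nonempty_interior
    intro τ hτ
    rw [interior_Ioc]
    exact Set.nonempty_Ioo.2 (hJ1 τ hτ).2
  have hDsub : ∀ a b, L0 ≤ a → a ≤ b → b ≤ L → D b - D a = ∫ l in Set.Ioc a b, Gc l := by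
    intro a b ha hab hb
    have i1 : ∀ x, L0 ≤ x → x ≤ L → IntervalIntegrable Gc volume L0 x := fun x h1 h2 =>
      (intervalIntegrable_iff_integrableOn_Ioc_of_le h1).2
        (hGc.mono_set (Set.Ioc_subset_Ioc_right h2))
    rw [hD]
    simp only
    rw [intervalIntegral.integral_interval_sub_left (i1 b (ha.trans hab) hb) (i1 a ha (hab.trans hb)),
      intervalIntegral.integral_of_le hab]
  have hjump : ∀ τ ∈ J, F τ (ℓ τ) - F τ (ℓm τ) =
      ∫ l in Set.Ioc (ℓm τ) (ℓ τ), (Gc l - g τ * p l) := by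
    intro τ hτ
    obtain ⟨h1, h2⟩ := hJ1 τ hτ
    have hu := (hℓ τ ⟨h1.1.le, h1.2⟩).2
    have hl := hJL τ h1
    have hs : Set.Ioc (ℓm τ) (ℓ τ) ⊆ Set.Ioc L0 L := Set.Ioc_subset_Ioc hl hu
    rw [integral_sub (hGc.mono_set hs) ((hp.mono_set hs).integrable.const_mul _), integral_const_mul,
      hE _ _ hl h2.le hu, ← hDsub _ _ hl h2.le hu, hF]
    ring
  have hae : ∀ᵐ l : ℝ, l ∉ (Lam : Set ℝ) ∧ l ≠ L := by
    have h1 : ∀ᵐ l : ℝ, l ∉ (Lam : Set ℝ) := Lam.countable_toSet.ae_notMem _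
    have h2 : ∀ᵐ l : ℝ, l ≠ L := Measure.ae_ne _ L
    filter_upwards [h1, h2] with l a b using ⟨a, b⟩
  refine ⟨hJc, fun t ht => ⟨?_, ?_⟩⟩
  · rintro τ ⟨hτ, -⟩
    rw [hjump τ hτ]
    obtain ⟨h1, h2⟩ := hJ1 τ hτ
    have hu := (hℓ τ ⟨h1.1.le, h1.2⟩).2
    have hl := hJL τ h1
    rw [integral_Ioc_eq_integral_Ioo]
    apply setIntegral_nonpos_ae measurableSet_Ioo
    filter_upwards [hae] with l hl' hlm
    have := P1 τ ⟨h1.1.le, h1.2⟩ l ⟨⟨hl.trans_lt hlm.1, hlm.2.trans_le hu⟩, hl'.1⟩ hlm.2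
    linarith
  have hhit : ∀ l, ∃ σ, l ∈ Set.Ioc L0 (ℓ t) → σ ∈ Set.Ioc 0 t ∧ l ≤ ℓ σ ∧
      ∀ s, 0 ≤ s → s < σ → ℓ s < l := by
    intro l
    by_cases hl : l ∈ Set.Ioc L0 (ℓ t)
    · obtain ⟨σ, h1, h2⟩ := griffith_hit T ℓ hmono hRC t l ht hl.2 (hℓ0 ▸ hl.1)
      exact ⟨σ, fun _ => ⟨h1, h2⟩⟩
    · exact ⟨0, fun h => absurd h hl⟩
  choose σ hσ using hhit
  obtain ⟨hint, hfub⟩ := griffith_fubini L0 L T ℓ p E g g' σ hmono hℓ hp hE hg'i hg t ht hσ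
  have hGcI : IntegrableOn Gc (Set.Ioc L0 (ℓ t)) :=
    hGc.mono_set (Set.Ioc_subset_Ioc_right (hℓ t ht).2)
  have hhI : IntegrableOn (fun l => Gc l - g (σ l) * p l) (Set.Ioc L0 (ℓ t)) := hGcI.sub hint
  -- union of jump intervals
  have hUsub : (⋃ τ : (J ∩ Set.Icc 0 t : Set ℝ), Set.Ioc (ℓm τ.1) (ℓ τ.1)) ⊆ Set.Ioc L0 (ℓ t) := by
    apply Set.iUnion_subset
    rintro ⟨τ, hτ, hτt⟩
    have h := hJ1 τ hτ
    exact Set.Ioc_subset_Ioc (hJL τ h.1) (hmono ⟨hτt.1, h.1.2⟩ ht hτt.2)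
  have hσJ : ∀ τ ∈ J ∩ Set.Icc 0 t, ∀ l ∈ Set.Ioc (ℓm τ) (ℓ τ), σ l = τ := by
    rintro τ ⟨hτ, hτt⟩ l hl
    have h := hJ1 τ hτ
    obtain ⟨h1, h2, h3⟩ := hσ l (hUsub (Set.mem_iUnion.2 ⟨⟨τ, hτ, hτt⟩, hl⟩))
    apply le_antisymm
    · by_contra! hc
      exact absurd (h3 τ hτt.1 hc) (not_lt.2 hl.2)
    · by_contra! hc
      have := M1 τ h.1 (σ l) ⟨h1.1.le, hc⟩
      linarith [hl.1]
  have : Countable (J ∩ Set.Icc 0 t : Set ℝ) := (hJc.mono Set.inter_subset_left).to_subtype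
  have hsum := hasSum_integral_iUnion
    (s := fun τ : (J ∩ Set.Icc 0 t : Set ℝ) => Set.Ioc (ℓm τ.1) (ℓ τ.1))
    (fun _ => measurableSet_Ioc)
    (fun a b hab => hdisj a.2.1 b.2.1 (fun h => hab (Subtype.ext h)))
    (hhI.mono_set hUsub)
  have hterm : ∀ τ : (J ∩ Set.Icc 0 t : Set ℝ),
      ∫ l in Set.Ioc (ℓm τ.1) (ℓ τ.1), (Gc l - g (σ l) * p l) = F τ.1 (ℓ τ.1) - F τ.1 (ℓm τ.1) := by
    intro τ
    rw [hjump τ.1 τ.2.1]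
    apply setIntegral_congr_fun measurableSet_Ioc
    intro l hl
    simp only [hσJ τ.1 τ.2 l hl]
  simp only [hterm] at hsum
  refine ⟨hsum.summable, ?_⟩
  rw [hsum.tsum_eq]
  have hzero : ∫ l in Set.Ioc L0 (ℓ t), (Gc l - g (σ l) * p l) =
      ∫ l in ⋃ τ : (J ∩ Set.Icc 0 t : Set ℝ), Set.Ioc (ℓm τ.1) (ℓ τ.1), (Gc l - g (σ l) * p l) := by
    apply setIntegral_eq_of_subset_of_ae_sdiff_eq_zero measurableSet_Ioc.nullMeasurableSet hUsub
    filter_upwards [hae] with l hl' hl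
    obtain ⟨hl, hnU⟩ := hl
    obtain ⟨h1, h2, h3⟩ := hσ l hl
    have hlL : l ∈ Set.Ioo L0 L \ (Lam : Set ℝ) :=
      ⟨⟨hl.1, lt_of_le_of_ne (hl.2.trans (hℓ t ht).2) hl'.2⟩, hl'.1⟩
    have hσT : σ l ∈ Set.Ioo 0 T := ⟨h1.1, h1.2.trans_lt ht.2⟩
    have hσT' : σ l ∈ Set.Ico 0 T := ⟨h1.1.le, h1.2.trans_lt ht.2⟩
    have h4 : ℓm (σ l) ≤ l := M2 _ hσT _ fun s hs => (h3 s hs.1 hs.2).le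
    have h5 : ℓm (σ l) = l := by
      by_contra hne
      have h6 : ℓm (σ l) < l := lt_of_le_of_ne h4 hne
      apply hnU
      refine Set.mem_iUnion.2 ⟨⟨σ l, ?_, ⟨h1.1.le, h1.2⟩⟩, ⟨h6, h2⟩⟩
      rw [hJ]
      exact ⟨hσT', (h6.trans_le h2).ne⟩
    have hopen : ∀ᶠ x in 𝓝 l, x ∈ Set.Ioo L0 L \ (Lam : Set ℝ) :=
      (isOpen_Ioo.sdiff Lam.finite_toSet.isClosed).mem_nhds hlL
    have hge : Gc l ≤ g (σ l) * p l := by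
      have t1 : Tendsto Gc (𝓝[<] l) (𝓝 (Gc l)) := (hGcc l hlL).tendsto.mono_left nhdsWithin_le_nhds
      have t2 : Tendsto (fun x => g (σ l) * p x) (𝓝[<] l) (𝓝 (g (σ l) * p l)) :=
        ((hpc l hlL).tendsto.mono_left nhdsWithin_le_nhds).const_mul _
      apply le_of_tendsto_of_tendsto t1 t2
      filter_upwards [nhdsWithin_le_nhds hopen, self_mem_nhdsWithin] with x hx hx'
      exact P1 _ hσT' x hx (lt_of_lt_of_le hx' h2)
    have hle : g (σ l) * p l ≤ Gc l := by
      -- frequently argument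
      by_contra! hc
      have hq : Tendsto (fun z : ℝ × ℝ => g z.1 * p z.2 - Gc z.2)
          (𝓝[Set.Ico 0 T] (σ l) ×ˢ 𝓝 l) (𝓝 (g (σ l) * p l - Gc l)) := by
        have a1 : Tendsto (fun z : ℝ × ℝ => g z.1) (𝓝[Set.Ico 0 T] (σ l) ×ˢ 𝓝 l) (𝓝 (g (σ l))) :=
          (hgc _ hσT').tendsto.comp tendsto_fst
        have a2 : Tendsto (fun z : ℝ × ℝ => p z.2) (𝓝[Set.Ico 0 T] (σ l) ×ˢ 𝓝 l) (𝓝 (p l)) :=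
          (hpc l hlL).tendsto.comp tendsto_snd
        have a3 : Tendsto (fun z : ℝ × ℝ => Gc z.2) (𝓝[Set.Ico 0 T] (σ l) ×ˢ 𝓝 l) (𝓝 (Gc l)) :=
          (hGcc l hlL).tendsto.comp tendsto_snd
        exact (a1.mul a2).sub a3
      have hev := hq.eventually (lt_mem_nhds (sub_pos.2 hc))
      obtain ⟨pa, hpa, pb, hpb, hab⟩ := Filter.eventually_prod_iff.1 hev
      obtain ⟨δ, hδ, hδ'⟩ := Metric.eventually_nhds_iff.1 (hpb.and hopen)
      obtain ⟨η, hη, hη'⟩ := Metric.eventually_nhds_iff.1 (eventually_nhdsWithin_iff.1 hpa)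
      obtain ⟨s1, hs1, hs1'⟩ := M3 _ hσT (l - δ) (by rw [h5]; linarith)
      set s := max s1 (σ l - η / 2) with hs
      have hss : s < σ l := max_lt hs1.2 (by linarith)
      have hs0 : 0 ≤ s := hs1.1.trans (le_max_left _ _)
      have hsT : s ∈ Set.Ico 0 T := ⟨hs0, hss.trans hσT.2⟩
      have hls : l - δ < ℓ s :=
        hs1'.trans_le (hmono ⟨hs1.1, hs1.2.trans hσT.2⟩ hsT (le_max_left _ _))
      have hls' : ℓ s < l := h3 s hs0 hss
      obtain ⟨x, hx1, hx2, hx3⟩ := P2 s hsT (l - ℓ s) (by linarith)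
      have hx : dist x l < δ := by
        rw [Real.dist_eq, abs_lt]; constructor <;> linarith
      have hd : dist s (σ l) < η := by
        have := le_max_right s1 (σ l - η / 2)
        rw [Real.dist_eq, abs_lt]; constructor <;> linarith
      have := hab (hη' hd hsT) (hδ' hx).1
      have := hx3 (hδ' hx).2
      simp only at *
      linarith
    linarith
  rw [← hzero, integral_sub hGcI hint, intervalIntegral.integral_of_le ht.1, hfub,
    ← hDsub L0 (ℓ t) le_rfl (hℓ t ht).1 (hℓ t ht).2, hF]
  have : D L0 = 0 := by rw [hD]; simp
  rw [this]
  ring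

/-- Energy identity for the quasi-static evolution
`ℓ(t) = inf{ l ∈ [L0,L] : G(t,l) < Gc(l) }`:  with the dissipated energy
`D(l) = ∫_{L0}^l Gc(s) ds` and the potential energy `F(t,l) = f(t)²E(l) + D(l)`, the jump
set `J(ℓ)` is at most countable and, for every `t ∈ [0,T)`,
`F(t,ℓ(t)) = ∫₀ᵗ 2 f f' E(ℓ) dτ + Σ_{τ ∈ J(ℓ) ∩ [0,t]} (F(τ,ℓ(τ)) − F(τ,ℓ⁻(τ)))`,
where every jump term is `≤ 0` and the series converges absolutely (`Summable`). -/
theorem griffith_energy_identity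
    (L0 L T : ℝ) (hL0 : 0 < L0) (hL0L : L0 < L) (hT : 0 < T)
    (f : ℝ → ℝ) (hf : ContDiffOn ℝ 1 f (Set.Icc 0 T)) (hf0 : f 0 = 0)
    (hf' : ∀ t ∈ Set.Icc (0:ℝ) T, 0 < derivWithin f (Set.Icc 0 T) t)
    (Lam : Finset ℝ) (hLam : (Lam : Set ℝ) ⊆ Set.Ioo 0 L)
    (E : ℝ → ℝ) (hEc : ContinuousOn E (Set.Ioc 0 L)) (hEm : AntitoneOn E (Set.Ioc 0 L))
    (hE1 : ContDiffOn ℝ 1 E (Set.Ioo 0 L \ (Lam : Set ℝ)))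
    (Gr : ℝ → ℝ≥0∞)
    (hGr : ∀ l ∈ Set.Ioo 0 L \ (Lam : Set ℝ), Gr l = ENNReal.ofReal (-(deriv E l)))
    (hGrL : Gr L = 0)
    (hGrLam : ∀ l ∈ (Lam : Set ℝ), Gr l = Filter.liminf Gr (nhdsWithin l (Set.Ioi l)))
    (GA GB : ℝ) (hGA : 0 < GA) (hGB : 0 < GB)
    (Gc : ℝ → ℝ) (hGcv : ∀ l ∈ Set.Ioc (0:ℝ) L, Gc l = GA ∨ Gc l = GB)
    (hGcrc : ∀ l ∈ Set.Ioo (0:ℝ) L,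
      Filter.Tendsto Gc (nhdsWithin l (Set.Ioi l)) (nhds (Gc l)))
    (hGcc : ∀ l₁ ∈ Set.Ioo 0 L \ (Lam : Set ℝ), ∀ l₂ ∈ Set.Ioo 0 L \ (Lam : Set ℝ),
      l₁ ≤ l₂ → (∀ s ∈ Set.Icc l₁ l₂, s ∉ (Lam : Set ℝ)) → Gc l₁ = Gc l₂)
    (ℓ : ℝ → ℝ) (hℓ : ℓ = griffithEvolution L0 L f Gr Gc)
    (D : ℝ → ℝ) (hD : D = fun l => ∫ s in L0..l, Gc s)
    (F : ℝ → ℝ → ℝ) (hF : F = fun t l => f t ^ 2 * E l + D l)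
    (ℓm : ℝ → ℝ) (hℓm : ℓm = fun t => if t = 0 then L0 else sSup (ℓ '' Set.Ico 0 t))
    (J : Set ℝ) (hJ : J = {τ | τ ∈ Set.Ico 0 T ∧ ℓm τ ≠ ℓ τ}) :
    J.Countable ∧
    ∀ t ∈ Set.Ico (0:ℝ) T,
      (∀ τ ∈ J ∩ Set.Icc 0 t, F τ (ℓ τ) - F τ (ℓm τ) ≤ 0) ∧
      Summable (fun τ : (J ∩ Set.Icc 0 t : Set ℝ) => F τ.1 (ℓ τ.1) - F τ.1 (ℓm τ.1)) ∧
      F t (ℓ t) =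
        (∫ τ in (0:ℝ)..t, 2 * f τ * derivWithin f (Set.Icc 0 T) τ * E (ℓ τ)) +
          ∑' τ : (J ∩ Set.Icc 0 t : Set ℝ), (F τ.1 (ℓ τ.1) - F τ.1 (ℓm τ.1)) := by
  subst hℓ
  set A : ℝ → Set ℝ := fun t => {l | l ∈ Set.Icc L0 L ∧
    ENNReal.ofReal (f t ^ 2) * Gr l < ENNReal.ofReal (Gc l)} with hA
  have hℓdef : ∀ t, griffithEvolution L0 L f Gr Gc t = sInf (A t) := fun t => rfl
  generalize griffithEvolution L0 L f Gr Gc = ℓ at *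
  have hGcpos : ∀ l ∈ Set.Ioc (0:ℝ) L, 0 < Gc l := by
    intro l hl
    rcases hGcv l hl with h | h <;> rw [h] <;> assumption
  have hLA : ∀ t, L ∈ A t := by
    intro t
    refine ⟨⟨hL0L.le, le_rfl⟩, ?_⟩
    rw [hGrL, mul_zero]
    exact ENNReal.ofReal_pos.2 (hGcpos L ⟨hL0.trans hL0L, le_rfl⟩)
  have hbd : ∀ t, BddBelow (A t) := fun t => ⟨L0, fun x hx => hx.1.1⟩
  have hℓle : ∀ t, ∀ l ∈ A t, ℓ t ≤ l := fun t l hl => by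
    rw [hℓdef]; exact csInf_le (hbd t) hl
  have hℓmem : ∀ t, ℓ t ∈ Set.Icc L0 L := fun t =>
    ⟨by rw [hℓdef]; exact le_csInf ⟨L, hLA t⟩ fun x hx => hx.1.1, hℓle t L (hLA t)⟩
  -- facts on f
  have hfd : ∀ x ∈ Set.Ioo 0 T, HasDerivAt f (derivWithin f (Set.Icc 0 T) x) x := by
    intro x hx
    have h1 := (hf.differentiableOn one_ne_zero x (Set.Ioo_subset_Icc_self hx)).hasDerivWithinAt
    exact h1.hasDerivAt (Icc_mem_nhds hx.1 hx.2)
  have hfsm : StrictMonoOn f (Set.Icc 0 T) := by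
    apply strictMonoOn_of_deriv_pos (convex_Icc 0 T) hf.continuousOn
    intro x hx
    rw [interior_Icc] at hx
    rw [(hfd x hx).deriv]
    exact hf' x (Set.Ioo_subset_Icc_self hx)
  have hfnn : ∀ x ∈ Set.Icc 0 T, 0 ≤ f x := by
    intro x hx
    rw [← hf0]
    exact hfsm.monotoneOn ⟨le_rfl, hT.le⟩ hx hx.1
  have hIco : ∀ x ∈ Set.Ico 0 T, x ∈ Set.Icc 0 T := fun x hx => ⟨hx.1, hx.2.le⟩
  have hmono : MonotoneOn ℓ (Set.Ico 0 T) := by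
    intro a ha b hb hab
    rw [hℓdef a, hℓdef b]
    apply csInf_le_csInf (hbd a) ⟨L, hLA b⟩
    intro l hl
    refine ⟨hl.1, lt_of_le_of_lt ?_ hl.2⟩
    gcongr
    · exact hfnn a (hIco a ha)
    · exact hfsm.monotoneOn (hIco a ha) (hIco b hb) hab
  have hℓ0 : ℓ 0 = L0 := by
    apply le_antisymm _ (hℓmem 0).1
    apply hℓle
    refine ⟨⟨le_rfl, hL0L.le⟩, ?_⟩
    rw [hf0]
    simp only [ne_eq, OfNat.ofNat_ne_zero, not_false_eq_true, zero_pow, ENNReal.ofReal_zero, zero_mul]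
    exact ENNReal.ofReal_pos.2 (hGcpos L0 ⟨hL0, hL0L.le⟩)
  have hsub : Set.Ioo L0 L \ (Lam : Set ℝ) ⊆ Set.Ioo 0 L \ (Lam : Set ℝ) :=
    fun x hx => ⟨⟨hL0.trans hx.1.1, hx.1.2⟩, hx.2⟩
  have hopen : IsOpen (Set.Ioo 0 L \ (Lam : Set ℝ)) :=
    isOpen_Ioo.sdiff Lam.finite_toSet.isClosed
  have hRC : ∀ τ ∈ Set.Ico 0 T, ∀ l, (∀ s ∈ Set.Ioo τ T, l ≤ ℓ s) → l ≤ ℓ τ := by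
    intro τ hτ l hs
    by_contra! hc
    obtain ⟨l', hl'A, hl'l, hl't⟩ : ∃ l' ∈ A τ, l' < l ∧ Gr l' ≠ ⊤ := by
      rcases hτ.1.eq_or_lt with h | h
      · have hne : (Set.Ioo L0 (min l L) \ (Lam : Set ℝ)).Nonempty := by
          have h1 : L0 < min l L := lt_min (by rw [← hℓ0, h]; exact hc) hL0L
          exact ((Set.Ioo_infinite h1).sdiff Lam.finite_toSet).nonempty
        obtain ⟨x, hx1, hx2⟩ := hne
        have hxl := hx1.2.trans_le (min_le_left _ _)
        have hxL := hx1.2.trans_le (min_le_right _ _)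
        refine ⟨x, ⟨⟨hx1.1.le, hxL.le⟩, ?_⟩, hxl, ?_⟩
        · rw [← h, hf0]
          simp only [ne_eq, OfNat.ofNat_ne_zero, not_false_eq_true, zero_pow, ENNReal.ofReal_zero,
            zero_mul]
          exact ENNReal.ofReal_pos.2 (hGcpos x ⟨hL0.trans hx1.1, hxL.le⟩)
        · rw [hGr x (hsub ⟨⟨hx1.1, hxL⟩, hx2⟩)]
          exact ENNReal.ofReal_ne_top
      · rw [hℓdef] at hc
        obtain ⟨x, hx, hxl⟩ := exists_lt_of_csInf_lt ⟨L, hLA τ⟩ hc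
        refine ⟨x, hx, hxl, ?_⟩
        intro htop
        have h1 := hx.2
        have h2 : 0 < f τ := by
          rw [← hf0]; exact hfsm ⟨le_rfl, hT.le⟩ (hIco τ hτ) h
        rw [htop, ENNReal.mul_top (ENNReal.ofReal_pos.2 (by positivity)).ne'] at h1
        exact absurd h1 not_top_lt
    have htd : Tendsto (fun s => ENNReal.ofReal (f s ^ 2) * Gr l') (𝓝[Set.Ioo τ T] τ)
        (𝓝 (ENNReal.ofReal (f τ ^ 2) * Gr l')) := by
      apply ENNReal.Tendsto.mul_const _ (Or.inr hl't)
      apply ENNReal.tendsto_ofReal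
      have := ((hf.continuousOn τ (hIco τ hτ)).mono
        (fun x hx => ⟨hτ.1.trans hx.1.le, hx.2.le⟩ : Set.Ioo τ T ⊆ Set.Icc 0 T)).tendsto
      exact this.pow 2
    have hev := htd.eventually (gt_mem_nhds hl'A.2)
    have : (𝓝[Set.Ioo τ T] τ).NeBot := left_nhdsWithin_Ioo_neBot hτ.2
    obtain ⟨s, hs1, hs2⟩ := (hev.and self_mem_nhdsWithin).exists
    have := hℓle s l' ⟨hl'A.1, hs1⟩
    linarith [hs s hs2]
  -- facts on E
  have hEd : ∀ x ∈ Set.Ioo 0 L \ (Lam : Set ℝ), HasDerivAt E (deriv E x) x := fun x hx =>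
    ((hE1.differentiableOn one_ne_zero x hx).differentiableAt (hopen.mem_nhds hx)).hasDerivAt
  have hE'c : ContinuousOn (deriv E) (Set.Ioo 0 L \ (Lam : Set ℝ)) :=
    hE1.continuousOn_deriv_of_isOpen hopen le_rfl
  have hpnn : ∀ x ∈ Set.Ioo 0 L \ (Lam : Set ℝ), 0 ≤ -(deriv E x) := by
    intro x hx
    have h1 := hEm.derivWithin_nonpos (x := x)
    rw [derivWithin_of_mem_nhds (Ioc_mem_nhds hx.1.1 hx.1.2)] at h1
    linarith
  have hIL : Set.Icc L0 L ⊆ Set.Ioc 0 L := fun x hx => ⟨hL0.trans_le hx.1, hx.2⟩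
  have hpI : IntegrableOn (fun l => -(deriv E l)) (Set.Ioc L0 L) := by
    have h1 : MonotoneOn (fun x => - E x) (Set.uIcc L0 L) := by
      rw [Set.uIcc_of_le hL0L.le]
      exact (hEm.mono hIL).neg
    have h2 := h1.intervalIntegrable_deriv
    rw [intervalIntegrable_iff_integrableOn_Ioc_of_le hL0L.le] at h2
    have h3 : deriv (fun x => - E x) = fun l => -(deriv E l) := by
      ext x; exact deriv.fun_neg
    rwa [h3] at h2
  have hEint : ∀ a b, L0 ≤ a → a ≤ b → b ≤ L → ∫ l in Set.Ioc a b, -(deriv E l) = E a - E b := by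
    intro a b ha hab hb
    have h := integral_eq_of_hasDerivAt_off_countable_of_le (fun x => - E x)
      (fun l => -(deriv E l)) hab Lam.countable_toSet
      (hEc.mono ((Set.Icc_subset_Icc ha hb).trans hIL)).neg
      (fun x hx => (hEd x ⟨⟨hL0.trans_le (ha.trans hx.1.1.le), hx.1.2.trans_le hb⟩, hx.2⟩).fun_neg)
      ((intervalIntegrable_iff_integrableOn_Ioc_of_le hab).2
        (hpI.mono_set (Set.Ioc_subset_Ioc ha hb)))
    rw [intervalIntegral.integral_of_le hab] at h
    rw [h]; ring
  -- facts on Gc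
  have hGcca : ∀ l ∈ Set.Ioo 0 L \ (Lam : Set ℝ), ContinuousAt Gc l := by
    intro l hl
    obtain ⟨ε, hε, hb⟩ := Metric.isOpen_iff.1 hopen l hl
    have : Gc =ᶠ[𝓝 l] fun _ => Gc l := by
      filter_upwards [Metric.ball_mem_nhds l hε] with x hx
      have hcx := (convex_ball l ε).ordConnected
      have hlb := Metric.mem_ball_self (x := l) hε
      rcases le_total x l with h | h
      · exact hGcc x (hb hx) l hl h fun s hs => (hb (hcx.out hx hlb hs)).2
      · exact (hGcc l hl x (hb hx) h fun s hs => (hb (hcx.out hlb hx hs)).2).symm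
    exact continuousAt_const.congr this.symm
  have hGcI : IntegrableOn Gc (Set.Ioc L0 L) := by
    have hset : (Set.Ioo L0 L \ (Lam : Set ℝ) : Set ℝ) =ᵐ[volume] Set.Ioc L0 L := by
      have h1 : ∀ᵐ l : ℝ, l ∉ (Lam : Set ℝ) := Lam.countable_toSet.ae_notMem _
      have h2 : ∀ᵐ l : ℝ, l ≠ L := Measure.ae_ne _ L
      rw [Filter.eventuallyEq_set]
      filter_upwards [h1, h2] with l a b
      constructor
      · rintro ⟨h, -⟩; exact ⟨h.1, h.2.le⟩
      · intro h; exact ⟨⟨h.1, lt_of_le_of_ne h.2 b⟩, a⟩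
    have hms : AEStronglyMeasurable Gc (volume.restrict (Set.Ioc L0 L)) := by
      rw [← Measure.restrict_congr_set hset]
      apply ContinuousOn.aestronglyMeasurable
      · intro x hx; exact (hGcca x (hsub hx)).continuousWithinAt
      · exact measurableSet_Ioo.diff Lam.measurableSet
    refine Integrable.of_bound (C := max GA GB) hms ?_
    filter_upwards [ae_restrict_mem measurableSet_Ioc] with x hx
    have hx' : x ∈ Set.Ioc 0 L := ⟨hL0.trans hx.1, hx.2⟩
    rw [Real.norm_of_nonneg (hGcpos x hx').le]
    rcases hGcv x hx' with h | h <;> rw [h]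
    · exact le_max_left _ _
    · exact le_max_right _ _
  have hiff : ∀ t, ∀ l ∈ Set.Ioo L0 L \ (Lam : Set ℝ), (l ∈ A t ↔ f t ^ 2 * -(deriv E l) < Gc l) := by
    intro t l hl
    have hG := hGcpos l ⟨hL0.trans hl.1.1, hl.1.2.le⟩
    have : l ∈ A t ↔ ENNReal.ofReal (f t ^ 2) * Gr l < ENNReal.ofReal (Gc l) :=
      ⟨fun h => h.2, fun h => ⟨Set.Ioo_subset_Icc_self hl.1, h⟩⟩
    rw [this, hGr l (hsub hl), ← ENNReal.ofReal_mul (sq_nonneg _), ENNReal.ofReal_lt_ofReal_iff hG]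
  -- facts on g
  have hg'c : ContinuousOn (fun s => 2 * f s * derivWithin f (Set.Icc 0 T) s) (Set.Icc 0 T) :=
    (continuousOn_const.mul hf.continuousOn).mul
      (hf.continuousOn_derivWithin (uniqueDiffOn_Icc hT) le_rfl)
  have hg'i : ∀ x ∈ Set.Ico 0 T,
      IntegrableOn (fun s => 2 * f s * derivWithin f (Set.Icc 0 T) s) (Set.Ioc 0 x) := fun x hx =>
    (hg'c.integrableOn_Icc).mono_set
      (fun y hy => ⟨hy.1.le, hy.2.trans hx.2.le⟩)
  apply griffith_core L0 L T ℓ ℓm (fun l => -(deriv E l)) Gc E (fun t => f t ^ 2)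
    (fun s => 2 * f s * derivWithin f (Set.Icc 0 T) s) Lam hmono hℓ0 (fun t _ => hℓmem t) hRC hpI hGcI
    ?_ (fun l hl => hGcca l (hsub hl)) hEint ?_ hg'i ?_ ?_ ?_ ?_ ?_ D hD F hF J hJ
  · intro l hl
    exact ((hE'c l (hsub hl)).continuousAt (hopen.mem_nhds (hsub hl))).neg
  · exact (hf.continuousOn.mono hIco).pow 2
  · intro x hx
    have h := integral_eq_of_hasDerivAt_off_countable_of_le (fun s => f s ^ 2)
      (fun s => 2 * f s * derivWithin f (Set.Icc 0 T) s) hx.1 Set.countable_empty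
      ((hf.continuousOn.mono (Set.Icc_subset_Icc_right hx.2.le)).pow 2)
      (fun y hy => by
        have := (hfd y ⟨hy.1.1, hy.1.2.trans hx.2⟩).fun_pow 2
        simpa using this)
      ((intervalIntegrable_iff_integrableOn_Ioc_of_le hx.1).2 (hg'i x hx))
    rw [intervalIntegral.integral_of_le hx.1] at h
    rw [h, hf0]; ring
  · intro t ht l hl hlt
    by_contra! hc
    have := hℓle t l ((hiff t l hl).2 hc)
    linarith
  · intro t ht ε hε
    obtain ⟨x, hx, hxl⟩ := exists_lt_of_csInf_lt ⟨L, hLA t⟩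
      (show sInf (A t) < ℓ t + ε by rw [← hℓdef]; linarith)
    exact ⟨x, hℓle t x hx, hxl, fun h => ((hiff t x h).1 hx).le⟩
  · rw [hℓm]; simp
  · intro τ hτ
    rw [hℓm]
    simp only [hτ.1.ne', if_false]
end

section
/- For every l ∈ (0,L) there exist sequences (l_n^♯) and (l_n^♭) in (l, L) with l_n^♯ → l and l_n^♭ → l such that limsup_{n→∞} 𝒢_n(l_n^♯) ≤ 𝒢_hom(l) and liminf_{n→∞} 𝒢_n(l_n^♭) ≥ 𝒢_hom(l). -/
open Set Filter Topology MeasureTheory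
open scoped ENNReal

lemma diag_aux (l L : ℝ) (hl : l < L) (Q : ℕ → ℕ → ℝ → Prop)
    (hanti : ∀ j k n x, j ≤ k → Q k n x → Q j n x)
    (h : ∀ k : ℕ, ∀ᶠ n in atTop, ∃ x ∈ Ioo l L, x < l + 1 / ((k : ℝ) + 1) ∧ Q k n x) :
    ∃ u : ℕ → ℝ, (∀ n, u n ∈ Ioo l L) ∧ Tendsto u atTop (𝓝 l) ∧
      ∀ k, ∀ᶠ n in atTop, Q k n (u n) := by
  classical
  let P : ℕ → ℕ → Prop := fun n k => ∃ x ∈ Ioo l L, x < l + 1 / ((k : ℝ) + 1) ∧ Q k n x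
  let K : ℕ → ℕ := fun n => Nat.findGreatest (P n) n
  have hex : ∀ n, ∃ x, x ∈ Ioo l L ∧ (P n (K n) → x < l + 1 / ((K n : ℝ) + 1) ∧ Q (K n) n x) := by
    intro n
    by_cases hp : P n (K n)
    · obtain ⟨x, hx, h1⟩ := hp
      exact ⟨x, hx, fun _ => h1⟩
    · obtain ⟨x, hx⟩ := exists_between hl
      exact ⟨x, hx, fun h => absurd h hp⟩
  choose u hu hu2 using hex
  have key : ∀ k : ℕ, ∀ᶠ n in atTop, u n < l + 1 / ((k : ℝ) + 1) ∧ Q k n (u n) := by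
    intro k
    filter_upwards [h k, eventually_ge_atTop k] with n hn hkn
    have hk : k ≤ K n := Nat.le_findGreatest hkn hn
    have hP : P n (K n) := Nat.findGreatest_spec (P := P n) hkn hn
    obtain ⟨h1, h2⟩ := hu2 n hP
    refine ⟨h1.trans_le ?_, hanti _ _ _ _ hk h2⟩
    have : (k : ℝ) ≤ K n := by exact_mod_cast hk
    gcongr
  refine ⟨u, hu, ?_, fun k => (key k).mono fun n hn => hn.2⟩
  rw [tendsto_order]
  refine ⟨fun a ha => Eventually.of_forall fun n => ha.trans (hu n).1, fun a ha => ?_⟩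
  obtain ⟨k, hk⟩ := exists_nat_one_div_lt (sub_pos.2 ha)
  filter_upwards [key k] with n hn
  linarith [hn.1]

lemma slope_aux (E : ℝ → ℝ) (l L D ε δ : ℝ) (hl : l < L) (hε : 0 < ε) (hδ : 0 < δ)
    (hD : HasDerivAt E (-D) l) :
    ∃ h : ℝ, 0 < h ∧ h < δ ∧ l + h < L ∧ E l - E (l + h) < (D + ε) * h ∧
      (D - ε) * h < E l - E (l + h) := by
  have h1 := hD.tendsto_slope_zero_right
  have h2 := h1.eventually (Ioo_mem_nhds (show -D - ε < -D by linarith)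
    (show -D < -D + ε by linarith))
  have h3 : ∀ᶠ t in 𝓝[>] (0:ℝ), t ∈ Ioo 0 (min δ (L - l)) :=
    Ioo_mem_nhdsGT (lt_min hδ (by linarith))
  obtain ⟨t, ⟨ha, hb⟩, hc, hd⟩ := (h2.and h3).exists
  have hd1 := hd.trans_le (min_le_left _ _)
  have hd2 := hd.trans_le (min_le_right _ _)
  rw [smul_eq_mul, inv_mul_eq_div] at ha hb
  rw [lt_div_iff₀ hc] at ha
  rw [div_lt_iff₀ hc] at hb
  exact ⟨t, hc, hd1, by linarith, by nlinarith, by nlinarith⟩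

/-- For every `l ∈ (0,L)` there are sequences `lₙ^♯ → l` and `lₙ^♭ → l`
in `(l,L)` with `limsup_n 𝒢ₙ(lₙ^♯) ≤ 𝒢_hom(l)` and `𝒢_hom(l) ≤ liminf_n 𝒢ₙ(lₙ^♭)`. -/
theorem recovery_sequences_for_energy_release
    (L : ℝ) (hL : 0 < L)
    (Gn : ℕ → ℝ → ℝ≥0∞) (hmeas : ∀ n, Measurable (Gn n))
    (En : ℕ → ℝ → ℝ)
    (hInt : ∀ n, ∀ l₁ l₂ : ℝ, 0 < l₁ → l₁ < l₂ → l₂ < L →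
      ENNReal.ofReal (En n l₁ - En n l₂) = ∫⁻ s in Set.Ioc l₁ l₂, Gn n s)
    (Ehom : ℝ → ℝ) (hEh : ContDiffOn ℝ 1 Ehom (Set.Ioo 0 L))
    (Ghom : ℝ → ℝ) (hGhom : Ghom = fun l => -(deriv Ehom l))
    (hconv : ∀ l ∈ Set.Ioo (0:ℝ) L,
      Filter.Tendsto (fun n => En n l) Filter.atTop (nhds (Ehom l)))
    :
    ∀ l ∈ Set.Ioo (0:ℝ) L,
      ∃ lsharp lflat : ℕ → ℝ,
        (∀ n, lsharp n ∈ Set.Ioo l L) ∧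
        Filter.Tendsto lsharp Filter.atTop (nhds l) ∧
        Filter.limsup (fun n => Gn n (lsharp n)) Filter.atTop ≤ ENNReal.ofReal (Ghom l) ∧
        (∀ n, lflat n ∈ Set.Ioo l L) ∧
        Filter.Tendsto lflat Filter.atTop (nhds l) ∧
        ENNReal.ofReal (Ghom l) ≤ Filter.liminf (fun n => Gn n (lflat n)) Filter.atTop := by
  intro l hl
  have hD : HasDerivAt Ehom (-(Ghom l)) l := by
    rw [hGhom]
    simp only [neg_neg]
    exact ((hEh.differentiableOn one_ne_zero).differentiableAt
      (Ioo_mem_nhds hl.1 hl.2)).hasDerivAt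
  have core : ∀ k : ℕ, ∃ h : ℝ, 0 < h ∧ h < 1 / ((k : ℝ) + 1) ∧ l + h < L ∧
      ∀ᶠ n in atTop, (⨍⁻ s in Ioc l (l + h), Gn n s ∂volume) ≤ ENNReal.ofReal (Ghom l + 1 / ((k : ℝ) + 1)) ∧
        ENNReal.ofReal (Ghom l - 1 / ((k : ℝ) + 1)) ≤ (⨍⁻ s in Ioc l (l + h), Gn n s ∂volume) ∧
        (∫⁻ s in Ioc l (l + h), Gn n s) ≠ ∞ := by
    intro k
    have hk : (0 : ℝ) < 1 / ((k : ℝ) + 1) := by positivity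
    obtain ⟨h, h0, h1, h2, h3, h4⟩ := slope_aux Ehom l L (Ghom l) _ _ hl.2 hk hk hD
    refine ⟨h, h0, h1, h2, ?_⟩
    have ht := (hconv l hl).sub (hconv (l + h) ⟨by linarith [hl.1], h2⟩)
    filter_upwards [ht.eventually_lt_const h3, ht.eventually_const_lt h4] with n hn1 hn2
    have hI := hInt n l (l + h) hl.1 (by linarith) h2
    rw [setLAverage_eq, ← hI, Real.volume_Ioc, add_sub_cancel_left, ← ENNReal.ofReal_div_of_pos h0]
    refine ⟨ENNReal.ofReal_le_ofReal ?_, ENNReal.ofReal_le_ofReal ?_, ENNReal.ofReal_ne_top⟩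
    · rw [div_le_iff₀ h0]; exact hn1.le
    · rw [le_div_iff₀ h0]; exact hn2.le
  have mono : ∀ j k : ℕ, j ≤ k → 1 / ((k : ℝ) + 1) ≤ 1 / ((j : ℝ) + 1) := by
    intro j k hjk
    have : (j : ℝ) ≤ k := by exact_mod_cast hjk
    gcongr
  have hlim : Tendsto (fun k : ℕ => 1 / ((k : ℝ) + 1)) atTop (𝓝 0) :=
    tendsto_one_div_add_atTop_nhds_zero_nat
  obtain ⟨u, hu1, hu2, hu3⟩ := diag_aux l L hl.2
    (fun k n x => Gn n x ≤ ENNReal.ofReal (Ghom l + 1 / ((k : ℝ) + 1)))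
    (fun j k n x hjk hx => hx.trans (ENNReal.ofReal_le_ofReal (by linarith [mono j k hjk])))
    (by
      intro k
      obtain ⟨h, h0, h1, h2, h3⟩ := core k
      filter_upwards [h3] with n hn
      obtain ⟨x, hx, hx2⟩ := exists_le_setLAverage (μ := volume) (s := Ioc l (l + h)) (f := Gn n)
        (by simp [h0]) (by simp) (hmeas n).aemeasurable
      exact ⟨x, ⟨hx.1, by linarith [hx.2]⟩, by linarith [hx.2], hx2.trans hn.1⟩)
  obtain ⟨v, hv1, hv2, hv3⟩ := diag_aux l L hl.2
    (fun k n x => ENNReal.ofReal (Ghom l - 1 / ((k : ℝ) + 1)) ≤ Gn n x)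
    (fun j k n x hjk hx => (ENNReal.ofReal_le_ofReal (by linarith [mono j k hjk])).trans hx)
    (by
      intro k
      obtain ⟨h, h0, h1, h2, h3⟩ := core k
      filter_upwards [h3] with n hn
      obtain ⟨x, hx, hx2⟩ := exists_setLAverage_le (μ := volume) (s := Ioc l (l + h)) (f := Gn n)
        (by simp [h0]) measurableSet_Ioc.nullMeasurableSet hn.2.2
      exact ⟨x, ⟨hx.1, by linarith [hx.2]⟩, by linarith [hx.2], hn.2.1.trans hx2⟩)
  refine ⟨u, v, hu1, hu2, ?_, hv1, hv2, ?_⟩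
  · have ht := (ENNReal.continuous_ofReal.tendsto _).comp (hlim.const_add (Ghom l))
    rw [add_zero] at ht
    exact ge_of_tendsto' ht fun k => limsup_le_of_le (h := hu3 k)
  · have ht := (ENNReal.continuous_ofReal.tendsto _).comp (hlim.const_sub (Ghom l))
    rw [sub_zero] at ht
    exact le_of_tendsto' ht fun k => le_liminf_of_le (h := hv3 k)
end

section
/- If 𝒢_hom(l) ≤ (Γ-liminf_n 𝒢_n)(l) for every l ∈ (0,L), then for every l ∈ (0,L) one has (Γ-limsup_n 𝒢_n)(l) = (Γ-liminf_n 𝒢_n)(l) = 𝒢_hom(l); that is, 𝒢_hom is the Γ-limit of the sequence 𝒢_n on (0,L). -/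
open Set Filter Topology MeasureTheory
open scoped ENNReal

/-- The Γ-lower limit at `l` of a sequence of functions `h n : (0,L) → ℝ≥0∞`:
`inf { liminf_n h n (lₙ) : (lₙ) ⊆ (0,L), lₙ → l }`. -/
noncomputable def gammaLiminfIoo (L : ℝ) (h : ℕ → ℝ → ℝ≥0∞) (l : ℝ) : ℝ≥0∞ :=
  ⨅ (seq : ℕ → ℝ) (_ : ∀ n, seq n ∈ Set.Ioo 0 L)
    (_ : Filter.Tendsto seq Filter.atTop (nhds l)),
    Filter.liminf (fun n => h n (seq n)) Filter.atTop

/-- The Γ-upper limit at `l` of a sequence of functions `h n : (0,L) → ℝ≥0∞`: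
`inf { limsup_n h n (lₙ) : (lₙ) ⊆ (0,L), lₙ → l }`. -/
noncomputable def gammaLimsupIoo (L : ℝ) (h : ℕ → ℝ → ℝ≥0∞) (l : ℝ) : ℝ≥0∞ :=
  ⨅ (seq : ℕ → ℝ) (_ : ∀ n, seq n ∈ Set.Ioo 0 L)
    (_ : Filter.Tendsto seq Filter.atTop (nhds l)),
    Filter.limsup (fun n => h n (seq n)) Filter.atTop

/-- Eventually there are points close to `l` with small value. -/
theorem exists_small_value
    (L : ℝ) (Gn : ℕ → ℝ → ℝ≥0∞) (En : ℕ → ℝ → ℝ)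
    (hInt : ∀ n, ∀ l₁ l₂ : ℝ, 0 < l₁ → l₁ < l₂ → l₂ < L →
      ENNReal.ofReal (En n l₁ - En n l₂) = ∫⁻ s in Set.Ioc l₁ l₂, Gn n s)
    (Ehom : ℝ → ℝ)
    (hconv : ∀ l ∈ Set.Ioo (0:ℝ) L,
      Filter.Tendsto (fun n => En n l) Filter.atTop (nhds (Ehom l)))
    (l : ℝ) (hl : l ∈ Set.Ioo (0:ℝ) L) (hd : DifferentiableAt ℝ Ehom l)
    (c : ℝ≥0∞) (hc : ENNReal.ofReal (-(deriv Ehom l)) < c) (δ : ℝ) (hδ : 0 < δ) :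
    ∀ᶠ n in atTop, ∃ s, (s ∈ Set.Ioo (0:ℝ) L ∧ Gn n s < c) ∧ dist l s < δ := by
  obtain ⟨r, hr1, hr2⟩ := ENNReal.lt_iff_exists_nnreal_btwn.1 hc
  have hr0 : (0:ℝ) < r := by
    have : (0:ℝ≥0∞) < r := lt_of_le_of_lt bot_le hr1
    exact_mod_cast this
  have hr3 : -(deriv Ehom l) < (r:ℝ) := by
    rw [← ENNReal.ofReal_coe_nnreal, ENNReal.ofReal_lt_ofReal_iff hr0] at hr1
    exact hr1
  have hs := (hasDerivWithinAt_iff_tendsto_slope' (s := Ioi l) (by simp)).1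
    hd.hasDerivAt.hasDerivWithinAt
  have h1 : ∀ᶠ y in 𝓝[>] l, -(r:ℝ) < slope Ehom l y :=
    hs.eventually (lt_mem_nhds (by linarith))
  have h2 : ∀ᶠ y in 𝓝[>] l, y ∈ Ioo l (min (l + δ) L) :=
    Ioo_mem_nhdsGT (lt_min (by linarith) hl.2)
  obtain ⟨y, hy1, hy2, hy3⟩ := (h1.and h2).exists
  have hyδ : y < l + δ := lt_of_lt_of_le hy3 (min_le_left _ _)
  have hyL : y < L := lt_of_lt_of_le hy3 (min_le_right _ _)
  have hpos : 0 < y - l := by linarith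
  have hE : Ehom l - Ehom y < r * (y - l) := by
    rw [slope_def_field, lt_div_iff₀ hpos] at hy1
    linarith
  have ht := ((hconv l hl).sub (hconv y ⟨by linarith [hl.1], hyL⟩)).eventually (gt_mem_nhds hE)
  filter_upwards [ht] with n hn
  by_contra! hcon
  have hge : ∀ s ∈ Ioc l y, (r:ℝ≥0∞) ≤ Gn n s := by
    intro s hs
    by_contra! hlt
    have := hcon s ⟨⟨by linarith [hl.1, hs.1], by linarith [hs.2]⟩, hlt.trans hr2⟩
    rw [dist_comm, Real.dist_eq, abs_of_pos (by linarith [hs.1])] at this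
    linarith [hs.2]
  have hi : (r:ℝ≥0∞) * ENNReal.ofReal (y - l) ≤ ∫⁻ s in Set.Ioc l y, Gn n s := by
    rw [← Real.volume_Ioc, ← setLIntegral_const]
    exact setLIntegral_mono' measurableSet_Ioc hge
  rw [← hInt n l y hl.1 hy2 hyL, ← ENNReal.ofReal_coe_nnreal,
    ← ENNReal.ofReal_mul hr0.le] at hi
  have hp : 0 < (r:ℝ) * (y - l) := mul_pos hr0 hpos
  have := (ENNReal.ofReal_lt_ofReal_iff hp).2 hn
  exact absurd hi (not_le.2 this)

/-- Diagonal choice of a recovery sequence. -/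
theorem limsup_le_of_small (L : ℝ) (Gn : ℕ → ℝ → ℝ≥0∞) (l : ℝ) (hl : l ∈ Set.Ioo (0:ℝ) L)
    (c : ℝ≥0∞)
    (h : ∀ δ : ℝ, 0 < δ →
      ∀ᶠ n in atTop, ∃ s, (s ∈ Set.Ioo (0:ℝ) L ∧ Gn n s < c) ∧ dist l s < δ) :
    gammaLimsupIoo L Gn l ≤ c := by
  let S : ℕ → Set ℝ := fun n => {s | s ∈ Set.Ioo (0:ℝ) L ∧ Gn n s < c}
  have hex : ∀ n, ∃ x, x ∈ Set.Ioo (0:ℝ) L ∧ ((S n).Nonempty →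
      x ∈ S n ∧ dist l x < Metric.infDist l (S n) + 1 / ((n:ℝ) + 1)) := by
    intro n
    by_cases hne : (S n).Nonempty
    · obtain ⟨x, hx, hd⟩ := (Metric.infDist_lt_iff (x := l)
        (r := Metric.infDist l (S n) + 1 / ((n:ℝ) + 1)) hne).1
        (lt_add_of_pos_right _ (by positivity))
      exact ⟨x, hx.1, fun _ => ⟨hx, hd⟩⟩
    · exact ⟨l, hl, fun h => absurd h hne⟩
  choose x hx hx2 using hex
  have htend : Tendsto x atTop (𝓝 l) := by
    rw [Metric.tendsto_nhds]
    intro ε hε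
    have h3 : ∀ᶠ n : ℕ in atTop, 1 / ((n:ℝ) + 1) < ε / 2 :=
      tendsto_one_div_add_atTop_nhds_zero_nat.eventually (gt_mem_nhds (by linarith))
    filter_upwards [h (ε / 2) (by linarith), h3] with n hn h3n
    obtain ⟨s, hs, hsd⟩ := hn
    have h4 := (hx2 n ⟨s, hs⟩).2
    have h5 : Metric.infDist l (S n) ≤ dist l s := Metric.infDist_le_dist_of_mem hs
    rw [dist_comm]
    linarith
  have hle : limsup (fun n => Gn n (x n)) atTop ≤ c := by
    refine limsup_le_of_le (by isBoundedDefault) ?_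
    filter_upwards [h 1 one_pos] with n hn
    obtain ⟨s, hs, _⟩ := hn
    exact (hx2 n ⟨s, hs⟩).1.2.le
  unfold gammaLimsupIoo
  exact iInf_le_of_le x (iInf_le_of_le hx (iInf_le_of_le htend hle))

/-- If `𝒢_hom ≤ Γ-liminf 𝒢ₙ` on `(0,L)`, then `𝒢_hom` is the Γ-limit of
the sequence `𝒢ₙ` on `(0,L)`: the Γ-upper and Γ-lower limits both equal `𝒢_hom`. -/
theorem gamma_limit_of_liminf_bound
    (L : ℝ) (hL : 0 < L)
    (Gn : ℕ → ℝ → ℝ≥0∞) (hmeas : ∀ n, Measurable (Gn n))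
    (En : ℕ → ℝ → ℝ)
    (hInt : ∀ n, ∀ l₁ l₂ : ℝ, 0 < l₁ → l₁ < l₂ → l₂ < L →
      ENNReal.ofReal (En n l₁ - En n l₂) = ∫⁻ s in Set.Ioc l₁ l₂, Gn n s)
    (Ehom : ℝ → ℝ) (hEh : ContDiffOn ℝ 1 Ehom (Set.Ioo 0 L))
    (Ghom : ℝ → ℝ) (hGhom : Ghom = fun l => -(deriv Ehom l))
    (hconv : ∀ l ∈ Set.Ioo (0:ℝ) L,
      Filter.Tendsto (fun n => En n l) Filter.atTop (nhds (Ehom l)))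
    (hlb : ∀ l ∈ Set.Ioo (0:ℝ) L, ENNReal.ofReal (Ghom l) ≤ gammaLiminfIoo L Gn l) :
    ∀ l ∈ Set.Ioo (0:ℝ) L,
      gammaLimsupIoo L Gn l = ENNReal.ofReal (Ghom l) ∧
      gammaLiminfIoo L Gn l = ENNReal.ofReal (Ghom l) := by
  intro l hl
  have hd : DifferentiableAt ℝ Ehom l :=
    (hEh.differentiableOn (by norm_num)).differentiableAt (isOpen_Ioo.mem_nhds hl)
  have hsup : gammaLimsupIoo L Gn l ≤ ENNReal.ofReal (Ghom l) := by
    refine le_of_forall_gt_imp_ge_of_dense fun c hc => ?_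
    rw [hGhom] at hc
    exact limsup_le_of_small L Gn l hl c
      (exists_small_value L Gn En hInt Ehom hconv l hl hd c hc)
  have hle : gammaLiminfIoo L Gn l ≤ gammaLimsupIoo L Gn l :=
    iInf_mono fun _ => iInf_mono fun _ => iInf_mono fun _ => liminf_le_limsup
  have hb := hlb l hl
  exact ⟨le_antisymm hsup (hb.trans hle), le_antisymm (hle.trans hsup) hb⟩
end

section
/- The effective toughness Gc_eff is upper semicontinuous on (0,L), and Gc_eff(l) ≥ min{G_A, G_B} for every l ∈ (0,L). Moreover, (Γ-liminf_n (𝒢_n/Gc_n))(l) ≤ 𝒢_hom(l)/min{G_A, G_B} < +∞ for every l ∈ (0,L). -/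
open Set Filter Topology MeasureTheory
open scoped ENNReal

/-- The Γ-lower limit at `l` of a sequence of functions `h n : (0,L] → ℝ≥0∞`:
`(Γ-liminf h)(l) = inf { liminf_n h n (lₙ) : (lₙ) ⊆ (0,L], lₙ → l }`. -/
noncomputable def gammaLiminf (L : ℝ) (h : ℕ → ℝ → ℝ≥0∞) (l : ℝ) : ℝ≥0∞ :=
  ⨅ (seq : ℕ → ℝ) (_ : ∀ n, seq n ∈ Set.Ioc 0 L)
    (_ : Filter.Tendsto seq Filter.atTop (nhds l)),
    Filter.liminf (fun n => h n (seq n)) Filter.atTop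

lemma gammaLiminf_le_of_frequently {L : ℝ} {h : ℕ → ℝ → ℝ≥0∞} {l : ℝ} {c : ℝ≥0∞}
    (hl : l ∈ Set.Ioc 0 L)
    (H : ∀ δ : ℝ, 0 < δ → ∃ᶠ n in atTop, ∃ s ∈ Set.Ioc 0 L, |s - l| < δ ∧ h n s ≤ c) :
    gammaLiminf L h l ≤ c := by
  obtain ⟨φ, hφ, hP⟩ := Filter.extraction_forall_of_frequently
    (fun k : ℕ => H (1 / ((k : ℝ) + 1)) (by positivity))
  choose s hs hsl hsc using hP
  have hinj : Function.Injective φ := hφ.injective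
  have hext : ∀ k, Function.extend φ s (fun _ => l) (φ k) = s k :=
    fun k => hinj.extend_apply _ _ k
  have h1 : ∀ n, Function.extend φ s (fun _ => l) n ∈ Set.Ioc 0 L := by
    intro n
    by_cases hn : ∃ k, φ k = n
    · obtain ⟨k, rfl⟩ := hn
      rw [hext]; exact hs k
    · rw [Function.extend_apply' _ _ _ hn]; exact hl
  have h2 : Tendsto (Function.extend φ s (fun _ => l)) atTop (nhds l) := by
    rw [Metric.tendsto_atTop]
    intro ε hε
    obtain ⟨k0, hk0⟩ := exists_nat_one_div_lt hε
    refine ⟨φ k0, fun n hn => ?_⟩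
    by_cases hn' : ∃ k, φ k = n
    · obtain ⟨k, rfl⟩ := hn'
      rw [hext, Real.dist_eq]
      have hk : k0 ≤ k := hφ.le_iff_le.1 hn
      refine (hsl k).trans (lt_of_le_of_lt ?_ hk0)
      exact Nat.one_div_le_one_div hk
    · rw [Function.extend_apply' _ _ _ hn']; simpa using hε
  unfold gammaLiminf
  refine iInf_le_of_le (Function.extend φ s (fun _ => l)) ?_
  refine iInf_le_of_le h1 ?_
  refine iInf_le_of_le h2 ?_
  refine Filter.liminf_le_of_frequently_le' ?_
  refine hφ.tendsto_atTop.frequently (Eventually.frequently (Eventually.of_forall fun k => ?_))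
  rw [hext]; exact hsc k

lemma frequently_of_gammaLiminf_lt {L : ℝ} {h : ℕ → ℝ → ℝ≥0∞} {l : ℝ} {c : ℝ≥0∞}
    (H : gammaLiminf L h l < c) (δ : ℝ) (hδ : 0 < δ) :
    ∃ᶠ n in atTop, ∃ s ∈ Set.Ioc 0 L, |s - l| < δ ∧ h n s ≤ c := by
  unfold gammaLiminf at H
  simp only [iInf_lt_iff] at H
  obtain ⟨s, hs, hsl, hlt⟩ := H
  have h1 := Filter.frequently_lt_of_liminf_lt (by isBoundedDefault) hlt
  have h2 : ∀ᶠ n in atTop, |s n - l| < δ := by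
    have := Metric.tendsto_nhds.1 hsl δ hδ
    simpa [Real.dist_eq] using this
  exact (h1.and_eventually h2).mono fun n hn => ⟨s n, hs n, hn.2, hn.1.le⟩

lemma gammaLiminf_eventually_lt {L : ℝ} {h : ℕ → ℝ → ℝ≥0∞} {l : ℝ} {b : ℝ≥0∞}
    (hl : l ∈ Set.Ioc 0 L) (hb : b < gammaLiminf L h l) :
    ∀ᶠ x in 𝓝 l, b < gammaLiminf L h x := by
  obtain ⟨b', hbb', hb'⟩ := exists_between hb
  have : ∃ δ : ℝ, 0 < δ ∧ ¬ ∃ᶠ n in atTop, ∃ s ∈ Set.Ioc 0 L, |s - l| < δ ∧ h n s ≤ b' := by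
    by_contra hcon
    push Not at hcon
    exact absurd (gammaLiminf_le_of_frequently hl
      (fun δ hδ => hcon δ hδ)) (not_le.2 hb')
  obtain ⟨δ, hδ, hn⟩ := this
  filter_upwards [Metric.ball_mem_nhds l (half_pos hδ)] with x hx
  by_contra hc
  have hlt : gammaLiminf L h x < b' := lt_of_le_of_lt (not_lt.1 hc) hbb'
  refine hn ((frequently_of_gammaLiminf_lt hlt (δ/2) (half_pos hδ)).mono ?_)
  rintro n ⟨s, hs, hsx, hsb⟩
  refine ⟨s, hs, ?_, hsb⟩
  rw [Metric.mem_ball, Real.dist_eq] at hx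
  calc |s - l| = |(s - x) + (x - l)| := by ring_nf
    _ ≤ |s - x| + |x - l| := abs_add_le _ _
    _ < δ := by linarith

/-- The effective toughness `Gc_eff` is upper semicontinuous on `(0,L)`
and bounded below by `min{G_A,G_B}`; moreover
`(Γ-liminf (𝒢ₙ/Gcₙ))(l) ≤ 𝒢_hom(l)/min{G_A,G_B} < +∞` for every `l ∈ (0,L)`. -/
theorem effective_toughness_usc_and_lower_bound
    (L0 L T : ℝ) (hL0 : 0 < L0) (hL0L : L0 < L) (hT : 0 < T)
    (f : ℝ → ℝ) (hf : ContDiffOn ℝ 1 f (Set.Icc 0 T)) (hf0 : f 0 = 0)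
    (hf' : ∀ t ∈ Set.Icc (0:ℝ) T, 0 < derivWithin f (Set.Icc 0 T) t)
    (Lam : ℕ → Finset ℝ) (hLam : ∀ n, (Lam n : Set ℝ) ⊆ Set.Ioo 0 L)
    (En : ℕ → ℝ → ℝ) (hEc : ∀ n, ContinuousOn (En n) (Set.Ioc 0 L))
    (hEm : ∀ n, AntitoneOn (En n) (Set.Ioc 0 L))
    (hE1 : ∀ n, ContDiffOn ℝ 1 (En n) (Set.Ioo 0 L \ (Lam n : Set ℝ)))
    (Gn : ℕ → ℝ → ℝ≥0∞)
    (hGn : ∀ n, ∀ l ∈ Set.Ioo 0 L \ (Lam n : Set ℝ),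
      Gn n l = ENNReal.ofReal (-(deriv (En n) l)))
    (hGnL : ∀ n, Gn n L = 0)
    (hGnLam : ∀ n, ∀ l ∈ (Lam n : Set ℝ),
      Gn n l = Filter.liminf (Gn n) (nhdsWithin l (Set.Ioi l)))
    (GA GB : ℝ) (hGA : 0 < GA) (hGB : 0 < GB)
    (Gcn : ℕ → ℝ → ℝ)
    (hGcv : ∀ n, ∀ l ∈ Set.Ioc (0:ℝ) L, Gcn n l = GA ∨ Gcn n l = GB)
    (hGcrc : ∀ n, ∀ l ∈ Set.Ioo (0:ℝ) L,
      Filter.Tendsto (Gcn n) (nhdsWithin l (Set.Ioi l)) (nhds (Gcn n l)))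
    (hGcc : ∀ n, ∀ l₁ ∈ Set.Ioo 0 L \ (Lam n : Set ℝ), ∀ l₂ ∈ Set.Ioo 0 L \ (Lam n : Set ℝ),
      l₁ ≤ l₂ → (∀ s ∈ Set.Icc l₁ l₂, s ∉ (Lam n : Set ℝ)) → Gcn n l₁ = Gcn n l₂)
    (Ehom : ℝ → ℝ) (hEhc : ContinuousOn Ehom (Set.Ioc 0 L))
    (hEh1 : ContDiffOn ℝ 1 Ehom (Set.Ioo 0 L))
    (Ghom : ℝ → ℝ) (hGhom : ∀ l ∈ Set.Ioo (0:ℝ) L, Ghom l = -(deriv Ehom l))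
    (hGhomL : Ghom L = 0)
    (hEconv : ∀ l ∈ Set.Ioc (0:ℝ) L,
      Filter.Tendsto (fun n => En n l) Filter.atTop (nhds (Ehom l)))
    (hInt : ∀ n, ∀ l₁ l₂ : ℝ, 0 < l₁ → l₁ < l₂ → l₂ < L →
      ENNReal.ofReal (En n l₁ - En n l₂) = ∫⁻ s in Set.Ioc l₁ l₂, Gn n s)
    (Gceff : ℝ → ℝ≥0∞)
    (hGceff : ∀ l ∈ Set.Ioc (0:ℝ) L, Gceff l =
      if Ghom l = 0 then ⊤
      else ENNReal.ofReal (Ghom l) /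
        gammaLiminf L (fun n s => Gn n s / ENNReal.ofReal (Gcn n s)) l)
    :
    UpperSemicontinuousOn Gceff (Set.Ioo 0 L) ∧
    ∀ l ∈ Set.Ioo (0:ℝ) L,
      ENNReal.ofReal (min GA GB) ≤ Gceff l ∧
      gammaLiminf L (fun n s => Gn n s / ENNReal.ofReal (Gcn n s)) l ≤
        ENNReal.ofReal (Ghom l / min GA GB) ∧
      gammaLiminf L (fun n s => Gn n s / ENNReal.ofReal (Gcn n s)) l < ⊤ := by
  set h : ℕ → ℝ → ℝ≥0∞ := fun n s => Gn n s / ENNReal.ofReal (Gcn n s) with hh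
  have hm : 0 < min GA GB := lt_min hGA hGB
  have hder : ∀ l ∈ Set.Ioo (0:ℝ) L, HasDerivAt Ehom (-(Ghom l)) l := by
    intro l hl
    rw [hGhom l hl, neg_neg]
    exact ((hEh1.differentiableOn (by norm_num)).differentiableAt
      (isOpen_Ioo.mem_nhds hl)).hasDerivAt
  have hGcont : ContinuousOn Ghom (Set.Ioo 0 L) :=
    ((hEh1.continuousOn_deriv_of_isOpen isOpen_Ioo le_rfl).neg).congr hGhom
  have hslope : ∀ l ∈ Set.Ioo (0:ℝ) L, ∀ ε : ℝ, 0 < ε → ∀ᶠ t in 𝓝[>] (0:ℝ),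
      Ehom l - Ehom (l + t) < t * (Ghom l + ε) := by
    intro l hl ε hε
    have h1 := (hasDerivAt_iff_tendsto_slope_zero.1 (hder l hl)).mono_left
      (nhdsWithin_mono (0:ℝ) (fun x (hx : x ∈ Set.Ioi (0:ℝ)) => ne_of_gt hx))
    have h2 := h1.eventually_const_lt (show -(Ghom l) - ε < -(Ghom l) by linarith)
    filter_upwards [h2, self_mem_nhdsWithin] with t ht ht0
    have ht0' : 0 < t := ht0
    rw [smul_eq_mul, inv_mul_eq_div, lt_div_iff₀ ht0'] at ht
    linarith
  have hanti : ∀ x ∈ Set.Ioc (0:ℝ) L, ∀ y ∈ Set.Ioc (0:ℝ) L, x ≤ y → Ehom y ≤ Ehom x :=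
    fun x hx y hy hxy => le_of_tendsto_of_tendsto' (hEconv y hy) (hEconv x hx)
      fun n => hEm n hx hy hxy
  have hlt : ∀ l ∈ Set.Ioo (0:ℝ) L, ∀ᶠ t in 𝓝[>] (0:ℝ), l + t < L := by
    intro l hl
    filter_upwards [Ioo_mem_nhdsGT (show (0:ℝ) < L - l by linarith [hl.2])] with t ht
    linarith [ht.2]
  have hGpos : ∀ l ∈ Set.Ioo (0:ℝ) L, 0 ≤ Ghom l := by
    intro l hl
    refine le_of_forall_pos_le_add fun ε hε => ?_
    obtain ⟨t, ⟨h1, h2⟩, h3⟩ :=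
      (((hslope l hl ε hε).and (hlt l hl)).and self_mem_nhdsWithin).exists
    have h3' : 0 < t := h3
    have := hanti l ⟨hl.1, hl.2.le⟩ (l + t) ⟨by linarith [hl.1], h2.le⟩ (by linarith)
    by_contra hc
    nlinarith
  have hbd : ∀ l ∈ Set.Ioo (0:ℝ) L, gammaLiminf L h l ≤ ENNReal.ofReal (Ghom l / min GA GB) := by
    intro l hl
    have key : ∀ ε : ℝ, 0 < ε →
        gammaLiminf L h l ≤ ENNReal.ofReal ((Ghom l + ε) / min GA GB) := by
      intro ε hε
      refine gammaLiminf_le_of_frequently ⟨hl.1, hl.2.le⟩ fun δ hδ => ?_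
      obtain ⟨t, ⟨⟨h1, h2⟩, h4⟩, h3⟩ := ((((hslope l hl ε hε).and (hlt l hl)).and
        (Ioo_mem_nhdsGT hδ)).and self_mem_nhdsWithin).exists
      have h3' : 0 < t := h3
      have hC : 0 < Ghom l + ε := by linarith [hGpos l hl]
      have hconv := (hEconv l ⟨hl.1, hl.2.le⟩).sub
        (hEconv (l + t) ⟨by linarith [hl.1], h2.le⟩)
      refine Eventually.frequently ?_
      filter_upwards [hconv.eventually_lt_const h1] with n hn
      have hex : ∃ s ∈ Set.Ioc l (l + t), Gn n s < ENNReal.ofReal (Ghom l + ε) := by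
        by_contra hcon
        push Not at hcon
        have hI := hInt n l (l + t) hl.1 (by linarith) h2
        have hle : ∫⁻ _ in Set.Ioc l (l + t), ENNReal.ofReal (Ghom l + ε)
            ≤ ∫⁻ s in Set.Ioc l (l + t), Gn n s :=
          setLIntegral_mono' measurableSet_Ioc hcon
        rw [← hI, setLIntegral_const, Real.volume_Ioc, add_sub_cancel_left,
          ← ENNReal.ofReal_mul hC.le] at hle
        have := (ENNReal.ofReal_lt_ofReal_iff (by positivity)).2 hn
        rw [mul_comm t] at this
        exact absurd hle (not_le.2 this)
      obtain ⟨s, hs, hsG⟩ := hex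
      have hsL : s ∈ Set.Ioc 0 L := ⟨by linarith [hs.1, hl.1], by linarith [hs.2]⟩
      refine ⟨s, hsL, ?_, ?_⟩
      · rw [abs_of_pos (by linarith [hs.1])]
        linarith [hs.2, h4.2]
      · rw [ENNReal.ofReal_div_of_pos hm]
        refine ENNReal.div_le_div hsG.le (ENNReal.ofReal_le_ofReal ?_)
        rcases hGcv n s hsL with h5 | h5 <;> rw [h5]
        · exact min_le_left _ _
        · exact min_le_right _ _
    have ht : Tendsto (fun ε : ℝ => ENNReal.ofReal ((Ghom l + ε) / min GA GB)) (𝓝[>] 0)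
        (𝓝 (ENNReal.ofReal (Ghom l / min GA GB))) := by
      have hc : Continuous (fun ε : ℝ => ENNReal.ofReal ((Ghom l + ε) / min GA GB)) :=
        ENNReal.continuous_ofReal.comp ((continuous_const.add continuous_id).div_const _)
      have := hc.tendsto 0
      rw [add_zero] at this
      exact this.mono_left nhdsWithin_le_nhds
    exact ge_of_tendsto ht (by filter_upwards [self_mem_nhdsWithin] with ε hε using key ε hε)
  refine ⟨?_, fun l hl => ⟨?_, hbd l hl, (hbd l hl).trans_lt ENNReal.ofReal_lt_top⟩⟩
  · intro l hl c hc
    have hlc : l ∈ Set.Ioc (0:ℝ) L := ⟨hl.1, hl.2.le⟩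
    rw [hGceff l hlc] at hc
    split_ifs at hc with h0
    · exact absurd hc not_top_lt
    have hG0 : 0 < Ghom l := lt_of_le_of_ne (hGpos l hl) (Ne.symm h0)
    have hGo : ENNReal.ofReal (Ghom l) ≠ 0 := by simpa using hG0
    have hg0 : gammaLiminf L h l ≠ 0 := by
      intro h1
      rw [h1, ENNReal.div_zero hGo] at hc
      exact absurd hc not_top_lt
    have hb : ∃ b, b ≠ 0 ∧ b < gammaLiminf L h l ∧ ENNReal.ofReal (Ghom l) / b < c := by
      have ht : Tendsto (fun b => ENNReal.ofReal (Ghom l) / b) (𝓝[<] (gammaLiminf L h l))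
          (𝓝 (ENNReal.ofReal (Ghom l) / gammaLiminf L h l)) := by
        refine Tendsto.mono_left ?_ nhdsWithin_le_nhds
        exact ENNReal.Tendsto.const_div tendsto_id (Or.inr ENNReal.ofReal_ne_top)
      have hpos : 0 < gammaLiminf L h l := pos_iff_ne_zero.2 hg0
      have hne : (𝓝[<] (gammaLiminf L h l)).NeBot := nhdsLT_neBot_of_exists_lt ⟨0, hpos⟩
      obtain ⟨b, hb1, hb2⟩ := ((ht.eventually_lt_const hc).and (Ioo_mem_nhdsLT hpos)).exists
      exact ⟨b, hb2.1.ne', hb2.2, hb1⟩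
    obtain ⟨b, hb0, hbg, hbc⟩ := hb
    have hGl : Tendsto Ghom (𝓝 l) (𝓝 (Ghom l)) :=
      hGcont.continuousAt (isOpen_Ioo.mem_nhds hl)
    have hT2 : Tendsto (fun x => ENNReal.ofReal (Ghom x) / b) (𝓝 l)
        (𝓝 (ENNReal.ofReal (Ghom l) / b)) :=
      ENNReal.Tendsto.div_const (ENNReal.tendsto_ofReal hGl) (Or.inr hb0)
    refine Filter.Eventually.filter_mono nhdsWithin_le_nhds ?_
    filter_upwards [gammaLiminf_eventually_lt hlc hbg, hT2.eventually_lt_const hbc,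
      hGl.eventually_const_lt hG0, isOpen_Ioo.mem_nhds hl] with x h1 h2 h3 h4
    rw [hGceff x ⟨h4.1, h4.2.le⟩, if_neg h3.ne']
    exact (ENNReal.div_le_div_left h1.le _).trans_lt h2
  · rw [hGceff l ⟨hl.1, hl.2.le⟩]
    split_ifs with h0
    · exact le_top
    have hG0 : 0 < Ghom l := lt_of_le_of_ne (hGpos l hl) (Ne.symm h0)
    rw [ENNReal.le_div_iff_mul_le (Or.inr (by simpa using hG0)) (Or.inr ENNReal.ofReal_ne_top)]
    refine (mul_le_mul_right (hbd l hl) _).trans ?_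
    rw [← ENNReal.ofReal_mul hm.le, mul_div_cancel₀ _ hm.ne']
end

section
/- Assume 𝒢_n → 𝒢_hom locally uniformly on (0,L). Then for every l ∈ (0,L) with 𝒢_hom(l) ≠ 0 one has Gc_eff(l) = max{G_A, G_B}. -/
open Set Filter Topology MeasureTheory
open scoped ENNReal

/-- The interfaces of the `n`-periodic laminate on `(0,L)` with volume fraction `lam`:
`Λₙ = { kL/n : k = 1,…,n−1 } ∪ { (k+lam)L/n : k = 0,…,n−1 }`. -/
def lamSet (L lam : ℝ) (n : ℕ) : Set ℝ :=
  {x | ∃ k : ℕ, 1 ≤ k ∧ k ≤ n - 1 ∧ x = k * L / n} ∪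
    {x | ∃ k : ℕ, k ≤ n - 1 ∧ x = (k + lam) * L / n}

/-- If `𝒢ₙ → 𝒢_hom` locally uniformly on `(0,L)` (uniformly on every
compact subset, in the extended sense of `ℝ≥0∞`), then `Gc_eff(l) = max{G_A,G_B}` at every
`l ∈ (0,L)` with `𝒢_hom(l) ≠ 0`. -/
theorem effective_toughness_of_uniform_convergence
    (L0 L T : ℝ) (hL0 : 0 < L0) (hL0L : L0 < L) (hT : 0 < T)
    (f : ℝ → ℝ) (hf : ContDiffOn ℝ 1 f (Set.Icc 0 T)) (hf0 : f 0 = 0)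
    (hf' : ∀ t ∈ Set.Icc (0:ℝ) T, 0 < derivWithin f (Set.Icc 0 T) t)
    (GA GB : ℝ) (hGA : 0 < GA) (hGB : 0 < GB)
    (lam : ℝ) (hlam : lam ∈ Set.Ioo (0:ℝ) 1)
    (Gcn : ℕ → ℝ → ℝ)
    (hGcn : ∀ n : ℕ, 1 ≤ n → ∀ l : ℝ,
      Gcn n l = if Int.fract (n * l / L) < lam then GA else GB)
    (En : ℕ → ℝ → ℝ) (hEc : ∀ n : ℕ, 1 ≤ n → ContinuousOn (En n) (Set.Ioc 0 L))
    (hEm : ∀ n : ℕ, 1 ≤ n → AntitoneOn (En n) (Set.Ioc 0 L))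
    (hE1 : ∀ n : ℕ, 1 ≤ n → ContDiffOn ℝ 1 (En n) (Set.Ioo 0 L \ lamSet L lam n))
    (Gn : ℕ → ℝ → ℝ≥0∞)
    (hGn : ∀ n : ℕ, 1 ≤ n → ∀ l ∈ Set.Ioo 0 L \ lamSet L lam n,
      Gn n l = ENNReal.ofReal (-(deriv (En n) l)))
    (hGnL : ∀ n : ℕ, 1 ≤ n → Gn n L = 0)
    (hGnLam : ∀ n : ℕ, 1 ≤ n → ∀ l ∈ lamSet L lam n,
      Gn n l = Filter.liminf (Gn n) (nhdsWithin l (Set.Ioi l)))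
    (Ehom : ℝ → ℝ) (hEhc : ContinuousOn Ehom (Set.Ioc 0 L))
    (hEh1 : ContDiffOn ℝ 1 Ehom (Set.Ioo 0 L))
    (Ghom : ℝ → ℝ) (hGhom : ∀ l ∈ Set.Ioo (0:ℝ) L, Ghom l = -(deriv Ehom l))
    (hGhomL : Ghom L = 0)
    (hEconv : ∀ l ∈ Set.Ioc (0:ℝ) L,
      Filter.Tendsto (fun n => En n l) Filter.atTop (nhds (Ehom l)))
    (hInt : ∀ n : ℕ, 1 ≤ n → ∀ l₁ l₂ : ℝ, 0 < l₁ → l₁ < l₂ → l₂ < L →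
      ENNReal.ofReal (En n l₁ - En n l₂) = ∫⁻ s in Set.Ioc l₁ l₂, Gn n s)
    (Gceff : ℝ → ℝ≥0∞)
    (hGceff : ∀ l ∈ Set.Ioc (0:ℝ) L, Gceff l =
      if Ghom l = 0 then ⊤
      else ENNReal.ofReal (Ghom l) /
        gammaLiminf L (fun n s => Gn n s / ENNReal.ofReal (Gcn n s)) l)
    (hunif : ∀ K : Set ℝ, K ⊆ Set.Ioo 0 L → IsCompact K → ∀ ε : ℝ≥0∞, 0 < ε →
      ∀ᶠ n in Filter.atTop, ∀ x ∈ K,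
        (Gn n x - ENNReal.ofReal (Ghom x)) ⊔ (ENNReal.ofReal (Ghom x) - Gn n x) < ε) :
    ∀ l ∈ Set.Ioo (0:ℝ) L, Ghom l ≠ 0 → Gceff l = ENNReal.ofReal (max GA GB) := by
  intro l hl hne
  have hL : 0 < L := hL0.trans hL0L
  have hIoc : Set.Ioo (0:ℝ) L ⊆ Set.Ioc 0 L := Set.Ioo_subset_Ioc_self
  have hanti : AntitoneOn Ehom (Set.Ioo 0 L) := by
    intro x hx y hy hxy
    refine le_of_tendsto_of_tendsto (hEconv y (hIoc hy)) (hEconv x (hIoc hx)) ?_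
    filter_upwards [eventually_ge_atTop 1] with n hn
    exact hEm n hn (hIoc hx) (hIoc hy) hxy
  have hpos : 0 < Ghom l := by
    refine lt_of_le_of_ne ?_ (Ne.symm hne)
    have h1 := hanti.derivWithin_nonpos (x := l)
    rw [derivWithin_of_isOpen isOpen_Ioo hl] at h1
    rw [hGhom l hl]
    linarith
  have hcont : ContinuousAt Ghom l := by
    have h1 : ContinuousOn (deriv Ehom) (Set.Ioo 0 L) :=
      hEh1.continuousOn_deriv_of_isOpen isOpen_Ioo le_rfl
    have h2 : ContinuousAt (fun x => -(deriv Ehom x)) l :=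
      (h1.continuousAt (isOpen_Ioo.mem_nhds hl)).neg
    refine h2.congr ?_
    filter_upwards [isOpen_Ioo.mem_nhds hl] with x hx
    exact (hGhom x hx).symm
  have key : ∀ seq : ℕ → ℝ, Tendsto seq atTop (nhds l) →
      Tendsto (fun n => Gn n (seq n)) atTop (nhds (ENNReal.ofReal (Ghom l))) := by
    intro seq hseq
    have hg : Tendsto (fun n => ENNReal.ofReal (Ghom (seq n))) atTop
        (nhds (ENNReal.ofReal (Ghom l))) :=
      ENNReal.tendsto_ofReal (hcont.tendsto.comp hseq)
    obtain ⟨a, ha, ha'⟩ := exists_between hl.1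
    obtain ⟨b, hb, hb'⟩ := exists_between hl.2
    rw [ENNReal.tendsto_nhds ENNReal.ofReal_ne_top] at hg ⊢
    intro ε hε
    have hε2 : 0 < ε / 2 := ENNReal.half_pos hε.ne'
    have hK := hunif (Set.Icc a b) (fun x hx => ⟨ha.trans_le hx.1, hx.2.trans_lt hb'⟩)
      isCompact_Icc (ε / 2) hε2
    filter_upwards [hg (ε / 2) hε2, hK, hseq.eventually (Icc_mem_nhds ha' hb)] with n h1 h2 h3
    have h4 := h2 _ h3
    have h5 := (le_sup_left.trans_lt h4).le
    have h6 := (le_sup_right.trans_lt h4).le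
    rw [tsub_le_iff_left] at h5 h6
    have h7 := h1.1
    rw [tsub_le_iff_right] at h7
    constructor
    · rw [tsub_le_iff_right]
      calc _ ≤ _ := h7
        _ ≤ (Gn n (seq n) + ε / 2) + ε / 2 := by gcongr
        _ = _ := by rw [add_assoc, ENNReal.add_halves]
    · calc _ ≤ _ := h5
        _ ≤ (ENNReal.ofReal (Ghom l) + ε / 2) + ε / 2 := by gcongr; exact h1.2
        _ = _ := by rw [add_assoc, ENNReal.add_halves]
  have hc : 0 < max GA GB := lt_max_of_lt_left hGA
  have hc0 : ENNReal.ofReal (max GA GB) ≠ 0 := (ENNReal.ofReal_pos.2 hc).ne'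
  have keydiv : ∀ seq : ℕ → ℝ, Tendsto seq atTop (nhds l) →
      Tendsto (fun n => Gn n (seq n) / ENNReal.ofReal (max GA GB)) atTop
        (nhds (ENNReal.ofReal (Ghom l) / ENNReal.ofReal (max GA GB))) := fun seq hseq =>
    ENNReal.Tendsto.div_const (key seq hseq) (Or.inr hc0)
  have hgam : gammaLiminf L (fun n s => Gn n s / ENNReal.ofReal (Gcn n s)) l
      = ENNReal.ofReal (Ghom l) / ENNReal.ofReal (max GA GB) := by
    apply le_antisymm
    · obtain ⟨θ, hθ0, hθ1, hθ⟩ : ∃ θ : ℝ, 0 ≤ θ ∧ θ < 1 ∧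
          (if θ < lam then GA else GB) = max GA GB := by
        rcases le_total GA GB with h | h
        · exact ⟨lam, hlam.1.le, hlam.2, by simp [h]⟩
        · exact ⟨0, le_rfl, one_pos, by simp [h, hlam.1]⟩
      let s : ℕ → ℝ := fun n => (⌊(n:ℝ) * l / L⌋ + θ) * L / n
      have hs : Tendsto s atTop (nhds l) := by
        have hz : Tendsto (fun n : ℕ => L / (n:ℝ)) atTop (nhds 0) :=
          tendsto_const_div_atTop_nhds_zero_nat L
        rw [tendsto_iff_norm_sub_tendsto_zero]
        refine squeeze_zero' (Eventually.of_forall fun n => norm_nonneg _) ?_ hz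
        filter_upwards [eventually_ge_atTop 1] with n hn
        have hn' : (0:ℝ) < n := by exact_mod_cast hn
        have e : s n - l = (θ - Int.fract ((n:ℝ) * l / L)) * (L / n) := by
          simp only [s, Int.fract]
          field_simp
          ring
        rw [e, norm_mul, Real.norm_eq_abs, Real.norm_eq_abs, abs_of_pos (div_pos hL hn')]
        have h1 := Int.fract_nonneg ((n:ℝ) * l / L)
        have h2 := Int.fract_lt_one ((n:ℝ) * l / L)
        have h3 : |θ - Int.fract ((n:ℝ) * l / L)| ≤ 1 := by
          rw [abs_le]; constructor <;> linarith
        exact mul_le_of_le_one_left (div_pos hL hn').le h3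
      classical
      let r : ℕ → ℝ := fun n => if s n ∈ Set.Ioc 0 L then s n else l
      have hev : ∀ᶠ n in atTop, r n = s n := by
        filter_upwards [hs.eventually (isOpen_Ioo.mem_nhds hl)] with n hn
        exact if_pos (hIoc hn)
      have hr : Tendsto r atTop (nhds l) :=
        hs.congr' (hev.mono fun n h => h.symm)
      have hrm : ∀ n, r n ∈ Set.Ioc 0 L := by
        intro n
        by_cases h : s n ∈ Set.Ioc 0 L
        · simp only [r, if_pos h]; exact h
        · simp only [r, if_neg h]; exact hIoc hl
      unfold gammaLiminf
      refine (iInf₂_le_of_le r hrm (iInf_le _ hr)).trans ?_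
      refine le_of_eq (Tendsto.liminf_eq ((keydiv r hr).congr' ?_))
      filter_upwards [hev, eventually_ge_atTop 1] with n h1 hn
      have hn' : (0:ℝ) < n := by exact_mod_cast hn
      have e : (n:ℝ) * r n / L = ⌊(n:ℝ) * l / L⌋ + θ := by
        rw [h1]
        simp only [s]
        field_simp
      have e2 : Gcn n (r n) = max GA GB := by
        rw [hGcn n hn, e, Int.fract_intCast_add, Int.fract_eq_self.2 ⟨hθ0, hθ1⟩, hθ]
      simp only [e2]
    · refine le_iInf fun seq => le_iInf fun _ => le_iInf fun hseq => ?_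
      rw [← (keydiv seq hseq).liminf_eq]
      refine liminf_le_liminf ?_
      filter_upwards [eventually_ge_atTop 1] with n hn
      refine ENNReal.div_le_div_left (ENNReal.ofReal_le_ofReal ?_) _
      rw [hGcn n hn]
      split_ifs
      · exact le_max_left _ _
      · exact le_max_right _ _
  have hg0 : ENNReal.ofReal (Ghom l) ≠ 0 := by simpa using hpos
  rw [hGceff l (hIoc hl), if_neg hne, hgam]
  exact ENNReal.div_div_cancel hg0 ENNReal.ofReal_ne_top
end

section
/- Let ℓ_n(t) = inf{ l ∈ [L0,L] : f(t)²·𝒢_n(l) < Gc_n(l) }, suppose ℓ_n(t) → ℓ(t) for every t ∈ [0,T), and let ℓ_hom(t) := lim_{τ→t⁺} ℓ(τ) be the right-continuous representative of the limit. Let 0 ≤ t_a < t_b < T be such that ℓ_hom has no jump points in [t_a, t_b] and ℓ_hom(t_a) < ℓ_hom(t_b). Then the homogenized (averaged) toughness is dominated by the effective toughness on the traversed interval: λ·G_A + (1−λ)·G_B ≤ Gc_eff(l) for every l ∈ [ℓ_hom(t_a), ℓ_hom(t_b)]. -/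
open Set Filter Topology MeasureTheory
open scoped ENNReal

lemma gammaLiminf_le_of (L : ℝ) (hL : 0 < L) (h : ℕ → ℝ → ℝ≥0∞) (l : ℝ) (c : ℝ≥0∞)
    (H : ∀ ε > 0, ∀ᶠ n in atTop, ∃ x ∈ Set.Ioc 0 L, |x - l| < ε ∧ h n x ≤ c) :
    gammaLiminf L h l ≤ c := by
  classical
  let S : ℕ → Set ℝ := fun n => {x | x ∈ Set.Ioc 0 L ∧ h n x ≤ c}
  have key : ∀ n, ∃ x ∈ Set.Ioc 0 L, (S n).Nonempty →
      (h n x ≤ c ∧ dist l x < Metric.infDist l (S n) + 1 / ((n:ℝ) + 1)) := by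
    intro n
    by_cases hn : (S n).Nonempty
    · have : Metric.infDist l (S n) < Metric.infDist l (S n) + 1 / ((n:ℝ) + 1) := by
        have : (0:ℝ) < 1 / ((n:ℝ) + 1) := by positivity
        linarith
      obtain ⟨x, hx, hd⟩ := (Metric.infDist_lt_iff hn).1 this
      exact ⟨x, hx.1, fun _ => ⟨hx.2, hd⟩⟩
    · exact ⟨L, ⟨hL, le_rfl⟩, fun h => absurd h hn⟩
  choose seq hs1 hs2 using key
  have hlim : Tendsto seq atTop (𝓝 l) := by
    rw [Metric.tendsto_nhds]
    intro ε hε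
    have h1 : ∀ᶠ n : ℕ in atTop, 1 / ((n:ℝ) + 1) < ε / 2 :=
      (tendsto_order.1 (tendsto_one_div_add_atTop_nhds_zero_nat (𝕜 := ℝ))).2 _ (by linarith)
    filter_upwards [h1, H (ε/2) (by linarith)] with n hn1 ⟨x, hx, hxl, hxc⟩
    have hne : x ∈ S n := ⟨hx, hxc⟩
    have := (hs2 n ⟨x, hne⟩).2
    have h3 := Metric.infDist_le_dist_of_mem (x := l) hne
    rw [dist_comm l x, Real.dist_eq] at h3
    rw [dist_comm]
    linarith
  have hle : liminf (fun n => h n (seq n)) atTop ≤ c := by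
    have : liminf (fun n => h n (seq n)) atTop ≤ liminf (fun _ : ℕ => c) atTop := by
      refine liminf_le_liminf ?_
      filter_upwards [H 1 one_pos] with n ⟨x, hx, hxl, hxc⟩
      exact (hs2 n ⟨x, hx, hxc⟩).1
    simpa using this
  exact iInf_le_of_le seq (iInf_le_of_le hs1 (iInf_le_of_le hlim hle))

lemma per_integral (GA GB lam : ℝ) (hGA : 0 < GA) (hGB : 0 < GB) (hlam : lam ∈ Set.Ioo (0:ℝ) 1)
    (a b : ℝ) (hab : a ≤ b) (g : ℝ → ℝ) (hg : g = fun y => if Int.fract y < lam then GA else GB) :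
    (∀ a b, IntervalIntegrable g volume a b) ∧
    (b - a - 1) * (lam * GA + (1 - lam) * GB) ≤ ∫ y in a..b, g y := by
  have hm : Measurable g := by
    rw [hg]
    exact Measurable.ite (measurableSet_lt measurable_fract measurable_const)
      measurable_const measurable_const
  have hpos : ∀ y, 0 < g y := by
    intro y; rw [hg]; dsimp only; split_ifs <;> assumption
  have hbd : ∀ y, ‖g y‖ ≤ max GA GB := by
    intro y
    rw [Real.norm_of_nonneg (hpos y).le, hg]; dsimp only; split_ifs <;> simp
  have hint : ∀ a b, IntervalIntegrable g volume a b := by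
    intro a b
    refine (intervalIntegrable_const (c := max GA GB)).mono_fun' hm.aestronglyMeasurable ?_
    exact Eventually.of_forall hbd
  refine ⟨hint, ?_⟩
  have hper : Function.Periodic g 1 := by
    intro y; rw [hg]; simp
  have h01 : ∫ y in (0:ℝ)..1, g y = lam * GA + (1 - lam) * GB := by
    rw [← intervalIntegral.integral_add_adjacent_intervals (hint 0 lam) (hint lam 1)]
    have e1 : ∫ y in (0:ℝ)..lam, g y = ∫ y in (0:ℝ)..lam, GA := by
      rw [intervalIntegral.integral_of_le hlam.1.le, intervalIntegral.integral_of_le hlam.1.le,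
        integral_Ioc_eq_integral_Ioo, integral_Ioc_eq_integral_Ioo]
      refine setIntegral_congr_fun measurableSet_Ioo ?_
      intro y hy
      have : Int.fract y = y := Int.fract_eq_self.2 ⟨hy.1.le, hy.2.trans hlam.2⟩
      simp [hg, this, hy.2]
    have e2 : ∫ y in lam..1, g y = ∫ y in lam..1, GB := by
      rw [intervalIntegral.integral_of_le hlam.2.le, intervalIntegral.integral_of_le hlam.2.le,
        integral_Ioc_eq_integral_Ioo, integral_Ioc_eq_integral_Ioo]
      refine setIntegral_congr_fun measurableSet_Ioo ?_
      intro y hy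
      have : Int.fract y = y := Int.fract_eq_self.2 ⟨(hlam.1.trans hy.1).le, hy.2⟩
      simp [hg, this, hy.1.le]
    rw [e1, e2]; simp
  have hH : 0 < lam * GA + (1 - lam) * GB := by
    have := hlam.1; have := sub_pos.2 hlam.2; positivity
  have hfl : ((⌊b - a⌋ : ℤ) : ℝ) ≤ b - a := Int.floor_le _
  have hfl2 : b - a - 1 < ((⌊b - a⌋ : ℤ) : ℝ) := Int.sub_one_lt_floor _
  have e3 : ∫ y in a..(a + ⌊b - a⌋ • (1:ℝ)), g y = ⌊b-a⌋ • ∫ y in a..(a+1), g y :=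
    hper.intervalIntegral_add_zsmul_eq ⌊b - a⌋ a (hint)
  have e4 := hper.intervalIntegral_add_eq a 0
  rw [e4, zero_add, h01] at e3
  simp only [zsmul_eq_mul, mul_one] at e3
  rw [← intervalIntegral.integral_add_adjacent_intervals (hint a (a + ⌊b - a⌋)) (hint _ b), e3]
  have : 0 ≤ ∫ y in (a + ⌊b - a⌋)..b, g y :=
    intervalIntegral.integral_nonneg (by linarith) (fun y _ => (hpos y).le)
  nlinarith

lemma per_lintegral (GA GB lam : ℝ) (hGA : 0 < GA) (hGB : 0 < GB) (hlam : lam ∈ Set.Ioo (0:ℝ) 1)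
    (L : ℝ) (hL : 0 < L) (n : ℕ) (hn : 1 ≤ n) (l₁ l₂ : ℝ) (h12 : l₁ ≤ l₂) :
    ENNReal.ofReal ((l₂ - l₁ - L / n) * (lam * GA + (1 - lam) * GB)) ≤
      ∫⁻ s in Set.Ioc l₁ l₂, ENNReal.ofReal (if Int.fract (n * s / L) < lam then GA else GB) := by
  have hn0 : (0:ℝ) < n := by exact_mod_cast hn
  have hc : (0:ℝ) < n / L := by positivity
  obtain ⟨hi, hle⟩ := per_integral GA GB lam hGA hGB hlam (n / L * l₁) (n / L * l₂)
    (mul_le_mul_of_nonneg_left h12 hc.le) _ rfl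
  have hi2 := (hi (n / L * l₁) (n / L * l₂)).comp_mul_left (c := (n:ℝ) / L)
  have hcg : ∀ s : ℝ, n * s / L = n / L * s := fun s => by ring
  simp only [hcg]
  have hsub := intervalIntegral.integral_comp_mul_left (a := l₁) (b := l₂)
    (fun y => if Int.fract y < lam then GA else GB) hc.ne'
  rw [mul_div_cancel_left₀ _ hc.ne', mul_div_cancel_left₀ _ hc.ne'] at hi2
  rw [← ofReal_integral_eq_lintegral_ofReal]
  · apply ENNReal.ofReal_le_ofReal
    rw [← intervalIntegral.integral_of_le h12, hsub, smul_eq_mul]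
    calc _ = ((n:ℝ)/L)⁻¹ * ((n / L * l₂ - n / L * l₁ - 1) * (lam * GA + (1 - lam) * GB)) := by
            field_simp
      _ ≤ _ := mul_le_mul_of_nonneg_left hle (by positivity)
  · exact (intervalIntegrable_iff_integrableOn_Ioc_of_le h12).1 hi2
  · refine Eventually.of_forall fun s => ?_
    dsimp only; split_ifs <;> simp [hGA.le, hGB.le]

/-- Toughening: if the evolutions `ℓₙ` converge pointwise to `ℓ` and the
right-continuous representative `ℓ_hom` has no jump points in `[t_a,t_b] ⊆ [0,T)` with
`ℓ_hom(t_a) < ℓ_hom(t_b)`, then the homogenized toughness is dominated by the effective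
toughness on the traversed interval: `λ G_A + (1−λ) G_B ≤ Gc_eff(l)` for every
`l ∈ [ℓ_hom(t_a), ℓ_hom(t_b)]`. -/
theorem homogenized_toughness_le_effective_toughness
    (L0 L T : ℝ) (hL0 : 0 < L0) (hL0L : L0 < L) (hT : 0 < T)
    (f : ℝ → ℝ) (hf : ContDiffOn ℝ 1 f (Set.Icc 0 T)) (hf0 : f 0 = 0)
    (hf' : ∀ t ∈ Set.Icc (0:ℝ) T, 0 < derivWithin f (Set.Icc 0 T) t)
    (GA GB : ℝ) (hGA : 0 < GA) (hGB : 0 < GB)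
    (lam : ℝ) (hlam : lam ∈ Set.Ioo (0:ℝ) 1)
    (Gcn : ℕ → ℝ → ℝ)
    (hGcn : ∀ n : ℕ, 1 ≤ n → ∀ l : ℝ,
      Gcn n l = if Int.fract (n * l / L) < lam then GA else GB)
    (En : ℕ → ℝ → ℝ) (hEc : ∀ n : ℕ, 1 ≤ n → ContinuousOn (En n) (Set.Ioc 0 L))
    (hEm : ∀ n : ℕ, 1 ≤ n → AntitoneOn (En n) (Set.Ioc 0 L))
    (hE1 : ∀ n : ℕ, 1 ≤ n → ContDiffOn ℝ 1 (En n) (Set.Ioo 0 L \ lamSet L lam n))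
    (Gn : ℕ → ℝ → ℝ≥0∞)
    (hGn : ∀ n : ℕ, 1 ≤ n → ∀ l ∈ Set.Ioo 0 L \ lamSet L lam n,
      Gn n l = ENNReal.ofReal (-(deriv (En n) l)))
    (hGnL : ∀ n : ℕ, 1 ≤ n → Gn n L = 0)
    (hGnLam : ∀ n : ℕ, 1 ≤ n → ∀ l ∈ lamSet L lam n,
      Gn n l = Filter.liminf (Gn n) (nhdsWithin l (Set.Ioi l)))
    (Ehom : ℝ → ℝ) (hEhc : ContinuousOn Ehom (Set.Ioc 0 L))
    (hEh1 : ContDiffOn ℝ 1 Ehom (Set.Ioo 0 L))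
    (Ghom : ℝ → ℝ) (hGhom : ∀ l ∈ Set.Ioo (0:ℝ) L, Ghom l = -(deriv Ehom l))
    (hGhomL : Ghom L = 0)
    (hEconv : ∀ l ∈ Set.Ioc (0:ℝ) L,
      Filter.Tendsto (fun n => En n l) Filter.atTop (nhds (Ehom l)))
    (hInt : ∀ n : ℕ, 1 ≤ n → ∀ l₁ l₂ : ℝ, 0 < l₁ → l₁ < l₂ → l₂ < L →
      ENNReal.ofReal (En n l₁ - En n l₂) = ∫⁻ s in Set.Ioc l₁ l₂, Gn n s)
    (Gceff : ℝ → ℝ≥0∞)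
    (hGceff : ∀ l ∈ Set.Ioc (0:ℝ) L, Gceff l =
      if Ghom l = 0 then ⊤
      else ENNReal.ofReal (Ghom l) /
        gammaLiminf L (fun n s => Gn n s / ENNReal.ofReal (Gcn n s)) l)
    (ℓ : ℝ → ℝ)
    (hconv : ∀ t ∈ Set.Ico (0:ℝ) T,
      Filter.Tendsto (fun n => griffithEvolution L0 L f (Gn n) (Gcn n) t)
        Filter.atTop (nhds (ℓ t)))
    (ℓhom : ℝ → ℝ) (hℓhom : ℓhom = fun t => sInf (ℓ '' Set.Ioo t T))
    (ta tb : ℝ) (hta : 0 ≤ ta) (htab : ta < tb) (htb : tb < T)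
    (hnojump : ∀ t ∈ Set.Icc ta tb,
      (if t = 0 then L0 else sSup (ℓhom '' Set.Ico 0 t)) = ℓhom t)
    (hinc : ℓhom ta < ℓhom tb) :
    ∀ l ∈ Set.Icc (ℓhom ta) (ℓhom tb),
      ENNReal.ofReal (lam * GA + (1 - lam) * GB) ≤ Gceff l := by
  have hL : 0 < L := hL0.trans hL0L
  set H := lam * GA + (1 - lam) * GB with hHdef
  have hH : 0 < H := by
    have := hlam.1; have := sub_pos.2 hlam.2; positivity
  -- monotonicity of f
  have hfc : ContinuousOn f (Set.Icc 0 T) := hf.continuousOn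
  have hfmono : StrictMonoOn f (Set.Icc 0 T) := by
    refine strictMonoOn_of_deriv_pos (convex_Icc 0 T) hfc ?_
    intro x hx
    rw [interior_Icc] at hx
    rw [← derivWithin_of_mem_nhds (Icc_mem_nhds hx.1 hx.2)]
    exact hf' x (Ioo_subset_Icc_self hx)
  have hfnn : ∀ t ∈ Set.Icc 0 T, 0 ≤ f t := by
    intro t ht
    rw [← hf0]
    exact hfmono.monotoneOn ⟨le_rfl, hT.le⟩ ht ht.1
  have hfpos : ∀ t ∈ Set.Icc 0 T, 0 < t → 0 < f t := by
    intro t ht h0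
    rw [← hf0]
    exact hfmono ⟨le_rfl, hT.le⟩ ht h0
  have hfsq : ∀ s t, 0 ≤ s → s ≤ t → t ≤ T → f s ^ 2 ≤ f t ^ 2 := by
    intro s t hs hst ht
    have h1 := hfmono.monotoneOn ⟨hs, hst.trans ht⟩ ⟨hs.trans hst, ht⟩ hst
    have h2 := hfnn s ⟨hs, hst.trans ht⟩
    gcongr
  have hGcpos : ∀ n : ℕ, 1 ≤ n → ∀ l, 0 < Gcn n l := by
    intro n hn l
    rw [hGcn n hn]; split_ifs <;> assumption
  -- the set
  let S : ℕ → ℝ → Set ℝ := fun n t =>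
    {l | l ∈ Set.Icc L0 L ∧ ENNReal.ofReal (f t ^ 2) * Gn n l < ENNReal.ofReal (Gcn n l)}
  have hSne : ∀ n : ℕ, 1 ≤ n → ∀ t, L ∈ S n t := by
    intro n hn t
    refine ⟨⟨hL0L.le, le_rfl⟩, ?_⟩
    rw [hGnL n hn, mul_zero]
    exact ENNReal.ofReal_pos.2 (hGcpos n hn L)
  have hSbdd : ∀ n t, BddBelow (S n t) := fun n t => ⟨L0, fun x hx => hx.1.1⟩
  let e : ℕ → ℝ → ℝ := fun n t => griffithEvolution L0 L f (Gn n) (Gcn n) t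
  have he : ∀ n t, e n t = sInf (S n t) := fun n t => rfl
  have heL0 : ∀ n : ℕ, 1 ≤ n → ∀ t, L0 ≤ e n t := by
    intro n hn t
    exact le_csInf ⟨L, hSne n hn t⟩ (fun x hx => hx.1.1)
  have heL : ∀ n : ℕ, 1 ≤ n → ∀ t, e n t ≤ L := by
    intro n hn t
    exact csInf_le (hSbdd n t) (hSne n hn t)
  have hemono : ∀ n : ℕ, 1 ≤ n → ∀ s t, 0 ≤ s → s ≤ t → t ≤ T → e n s ≤ e n t := by
    intro n hn s t hs hst ht
    refine csInf_le_csInf (hSbdd n s) ⟨L, hSne n hn t⟩ ?_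
    intro x hx
    refine ⟨hx.1, lt_of_le_of_lt ?_ hx.2⟩
    exact mul_le_mul' (ENNReal.ofReal_le_ofReal (hfsq s t hs hst ht)) le_rfl
  have hlL0 : ∀ t ∈ Set.Ico (0:ℝ) T, L0 ≤ ℓ t := fun t ht =>
    ge_of_tendsto (hconv t ht) (by filter_upwards [eventually_ge_atTop 1] with n hn using heL0 n hn t)
  have hlL : ∀ t ∈ Set.Ico (0:ℝ) T, ℓ t ≤ L := fun t ht =>
    le_of_tendsto (hconv t ht) (by filter_upwards [eventually_ge_atTop 1] with n hn using heL n hn t)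
  have hlmono : ∀ s t, 0 ≤ s → s ≤ t → t < T → ℓ s ≤ ℓ t := fun s t hs hst ht =>
    le_of_tendsto_of_tendsto (hconv s ⟨hs, hst.trans_lt ht⟩) (hconv t ⟨hs.trans hst, ht⟩)
      (by filter_upwards [eventually_ge_atTop 1] with n hn using hemono n hn s t hs hst ht.le)
  -- ℓhom
  have hhom : ∀ t, ℓhom t = sInf (ℓ '' Set.Ioo t T) := fun t => by rw [hℓhom]
  have hbdd : ∀ t, 0 ≤ t → BddBelow (ℓ '' Set.Ioo t T) := by
    rintro t ht
    refine ⟨L0, ?_⟩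
    rintro _ ⟨s, hs, rfl⟩
    exact hlL0 s ⟨ht.trans hs.1.le, hs.2⟩
  have hhomle : ∀ t τ, 0 ≤ t → t < τ → τ < T → ℓhom t ≤ ℓ τ := by
    intro t τ h0 h1 h2
    rw [hhom]
    exact csInf_le (hbdd t h0) ⟨τ, ⟨h1, h2⟩, rfl⟩
  have hlehom : ∀ t, t < T → ∀ c, (∀ τ, t < τ → τ < T → c ≤ ℓ τ) → c ≤ ℓhom t := by
    intro t ht c hc
    rw [hhom]
    refine le_csInf ((nonempty_Ioo.2 ht).image _) ?_
    rintro _ ⟨s, hs, rfl⟩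
    exact hc s hs.1 hs.2
  have hhomL0 : ∀ t, 0 ≤ t → t < T → L0 ≤ ℓhom t := fun t h0 ht =>
    hlehom t ht _ fun τ h1 h2 => hlL0 τ ⟨h0.trans h1.le, h2⟩
  have hhomL : ∀ t, 0 ≤ t → t < T → ℓhom t ≤ L := by
    intro t h0 ht
    obtain ⟨τ, h1, h2⟩ := exists_between ht
    exact (hhomle t τ h0 h1 h2).trans (hlL τ ⟨h0.trans h1.le, h2⟩)
  have hhommono : ∀ s t, 0 ≤ s → s ≤ t → t < T → ℓhom s ≤ ℓhom t := by
    intro s t hs hst ht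
    exact hlehom t ht _ fun τ h1 h2 => hhomle s τ hs (hst.trans_lt h1) h2
  -- energy estimate
  have henergy : ∀ τ, 0 < τ → τ < T → ∀ l₁ l₂, L0 ≤ l₁ → l₁ < l₂ → l₂ < ℓ τ →
      H * (l₂ - l₁) ≤ f τ ^ 2 * (Ehom l₁ - Ehom l₂) := by
    intro τ h0 h1 l₁ l₂ hl1 hl12 hl2
    have hl2L : l₂ < L := hl2.trans_le (hlL τ ⟨h0.le, h1⟩)
    have hl10 : 0 < l₁ := hL0.trans_le hl1
    have hc := hconv τ ⟨h0.le, h1⟩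
    have hev : ∀ᶠ n : ℕ in atTop, (l₂ - l₁ - L / n) * H ≤ f τ ^ 2 * (En n l₁ - En n l₂) := by
      filter_upwards [eventually_ge_atTop 1, (tendsto_order.1 hc).1 _ hl2] with n hn hlt
      have hE : 0 ≤ En n l₁ - En n l₂ :=
        sub_nonneg.2 (hEm n hn ⟨hl10, (hl12.trans hl2L).le⟩ ⟨hl10.trans hl12, hl2L.le⟩ hl12.le)
      have h2 := per_lintegral GA GB lam hGA hGB hlam L hL n hn l₁ l₂ hl12.le
      have h3 : ∫⁻ s in Set.Ioc l₁ l₂,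
          ENNReal.ofReal (if Int.fract (n * s / L) < lam then GA else GB) ≤
          ∫⁻ s in Set.Ioc l₁ l₂, ENNReal.ofReal (f τ ^ 2) * Gn n s := by
        refine setLIntegral_mono' measurableSet_Ioc ?_
        intro s hs
        rw [← hGcn n hn s]
        by_contra hcon
        push Not at hcon
        have hsS : s ∈ S n τ := ⟨⟨hl1.trans hs.1.le, hs.2.trans hl2L.le⟩, hcon⟩
        have h5 : e n τ ≤ s := csInf_le (hSbdd n τ) hsS
        have h6 : l₂ < e n τ := hlt
        linarith [hs.2]
      rw [lintegral_const_mul' _ _ ENNReal.ofReal_ne_top, ← hInt n hn l₁ l₂ hl10 hl12 hl2L,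
        ← ENNReal.ofReal_mul (sq_nonneg _)] at h3
      exact (ENNReal.ofReal_le_ofReal_iff (mul_nonneg (sq_nonneg _) hE)).1 (h2.trans h3)
    have t1 : Tendsto (fun n : ℕ => (l₂ - l₁ - L / n) * H) atTop (𝓝 ((l₂ - l₁ - 0) * H)) :=
      (tendsto_const_nhds.sub (tendsto_const_div_atTop_nhds_zero_nat L)).mul_const H
    have t2 : Tendsto (fun n : ℕ => f τ ^ 2 * (En n l₁ - En n l₂)) atTop
        (𝓝 (f τ ^ 2 * (Ehom l₁ - Ehom l₂))) :=
      ((hEconv l₁ ⟨hl10, (hl12.trans hl2L).le⟩).sub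
        (hEconv l₂ ⟨hl10.trans hl12, hl2L.le⟩)).const_mul _
    have := le_of_tendsto_of_tendsto t1 t2 hev
    linarith
  -- key interior estimate
  have hinterior : ∀ l ∈ Set.Ioo (ℓhom ta) (ℓhom tb), l < L →
      0 < Ghom l ∧ ∀ ε > 0, ∀ᶠ n in atTop, ∃ x ∈ Set.Ioc 0 L, |x - l| < ε ∧
        Gn n x / ENNReal.ofReal (Gcn n x) ≤ ENNReal.ofReal (Ghom l / H) := by
    intro l hl hlL'
    have hL0l : L0 < l := (hhomL0 ta hta (htab.trans htb)).trans_lt hl.1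
    let A : Set ℝ := {s | s ∈ Set.Icc ta tb ∧ ℓhom s < l}
    have hAta : ta ∈ A := ⟨⟨le_rfl, htab.le⟩, hl.1⟩
    have hAb : BddAbove A := ⟨tb, fun s hs => hs.1.2⟩
    set t := sSup A with htdef
    have hta_t : ta ≤ t := le_csSup hAb hAta
    have ht_tb : t ≤ tb := csSup_le ⟨ta, hAta⟩ fun s hs => hs.1.2
    have ht0 : 0 ≤ t := hta.trans hta_t
    have htT : t < T := ht_tb.trans_lt htb
    have hgt : ∀ s, t < s → s < T → l ≤ ℓhom s := by
      intro s h1 h2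
      by_contra hcon
      push Not at hcon
      rcases le_total s tb with h3 | h3
      · exact absurd (le_csSup hAb (show s ∈ A from ⟨⟨hta_t.trans h1.le, h3⟩, hcon⟩))
          (not_le.2 h1)
      · linarith [hhommono tb s (hta.trans htab.le) h3 h2, hl.2]
    have hge : l ≤ ℓhom t := by
      refine hlehom t htT _ fun τ h1 h2 => ?_
      obtain ⟨s, hs1, hs2⟩ := exists_between h1
      exact (hgt s hs1 (hs2.trans h2)).trans (hhomle s τ (ht0.trans hs1.le) hs2 h2)
    have hnj := hnojump t ⟨hta_t, ht_tb⟩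
    have htne : t ≠ 0 := by
      intro h
      rw [if_pos h] at hnj
      linarith
    have htpos : 0 < t := lt_of_le_of_ne ht0 (Ne.symm htne)
    have heq : ℓhom t = l := by
      refine le_antisymm ?_ hge
      rw [if_neg htne] at hnj
      rw [← hnj]
      refine csSup_le ((nonempty_Ico.2 htpos).image _) ?_
      rintro _ ⟨s, hs, rfl⟩
      obtain ⟨s', hs', hss'⟩ := exists_lt_of_lt_csSup ⟨ta, hAta⟩ hs.2
      exact (hhommono s s' hs.1 hss'.le (hs'.1.2.trans_lt htb)).trans hs'.2.le
    have hft : 0 < f t := hfpos t ⟨ht0, htT.le⟩ htpos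
    -- estimate for τ → t
    have h1 : ∀ l₁ l₂, L0 ≤ l₁ → l₁ < l₂ → l₂ < l →
        H * (l₂ - l₁) ≤ f t ^ 2 * (Ehom l₁ - Ehom l₂) := by
      intro l₁ l₂ a1 a2 a3
      have hcf : Tendsto f (𝓝[>] t) (𝓝 (f t)) :=
        ((hfc.continuousAt (Icc_mem_nhds htpos htT)).tendsto).mono_left nhdsWithin_le_nhds
      refine ge_of_tendsto ((hcf.pow 2).mul_const (Ehom l₁ - Ehom l₂)) ?_
      filter_upwards [Ioo_mem_nhdsGT htT] with τ hτ
      exact henergy τ (htpos.trans hτ.1) hτ.2 l₁ l₂ a1 a2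
        (a3.trans_le (heq ▸ hhomle t τ ht0 hτ.1 hτ.2))
    have hlmem : l ∈ Set.Ioo 0 L := ⟨hL0.trans hL0l, hlL'⟩
    have hdiff : DifferentiableAt ℝ Ehom l :=
      (hEh1.differentiableOn (by norm_num)).differentiableAt (Ioo_mem_nhds hlmem.1 hlmem.2)
    have hcl : Tendsto Ehom (𝓝[<] l) (𝓝 (Ehom l)) :=
      hdiff.continuousAt.tendsto.mono_left nhdsWithin_le_nhds
    have h2 : ∀ l₁, L0 ≤ l₁ → l₁ < l → H * (l - l₁) ≤ f t ^ 2 * (Ehom l₁ - Ehom l) := by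
      intro l₁ a1 a2
      have hid : Tendsto (fun x : ℝ => x) (𝓝[<] l) (𝓝 l) := tendsto_id.mono_left nhdsWithin_le_nhds
      refine le_of_tendsto_of_tendsto ((hid.sub_const l₁).const_mul H)
        ((hcl.const_sub (Ehom l₁)).const_mul _) ?_
      filter_upwards [Ioo_mem_nhdsLT a2] with x hx
      exact h1 l₁ x a1 hx.1 hx.2
    have h3 : H ≤ f t ^ 2 * Ghom l := by
      have hs := hdiff.hasDerivAt.tendsto_slope
      have hs' : Tendsto (slope Ehom l) (𝓝[<] l) (𝓝 (deriv Ehom l)) :=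
        hs.mono_left (nhdsWithin_mono _ fun x hx => ne_of_lt hx)
      rw [hGhom l hlmem]
      refine ge_of_tendsto (hs'.neg.const_mul (f t ^ 2)) ?_
      filter_upwards [Ioo_mem_nhdsLT hL0l] with x hx
      have h4 := h2 x hx.1.le hx.2
      have h5 : 0 < l - x := sub_pos.2 hx.2
      have h6 : f t ^ 2 * -slope Ehom l x = f t ^ 2 * (Ehom x - Ehom l) / (l - x) := by
        rw [slope_def_field]
        have h7 : x - l ≠ 0 := by linarith
        have h8 : l - x ≠ 0 := h5.ne'
        rw [← neg_sub l x, div_neg, neg_neg, mul_div_assoc]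
      rw [h6, le_div_iff₀ h5]
      exact h4
    have hGpos : 0 < Ghom l := by
      by_contra hcon
      push Not at hcon
      nlinarith [sq_nonneg (f t)]
    refine ⟨hGpos, fun ε hε => ?_⟩
    obtain ⟨_, ⟨τ, hτ, rfl⟩, hτl⟩ : ∃ y ∈ ℓ '' Set.Ioo t T, y < l + ε / 2 := by
      refine exists_lt_of_csInf_lt ((nonempty_Ioo.2 htT).image _) ?_
      rw [← hhom, heq]; linarith
    have hlτ : l ≤ ℓ τ := heq ▸ hhomle t τ ht0 hτ.1 hτ.2
    have hc := hconv τ ⟨ht0.trans hτ.1.le, hτ.2⟩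
    filter_upwards [eventually_ge_atTop 1, (tendsto_order.1 hc).1 (l - ε) (by linarith),
      (tendsto_order.1 hc).2 (l + ε / 2) hτl] with n hn hn1 hn2
    have hn1' : l - ε < e n τ := hn1
    have hn2' : e n τ < l + ε / 2 := hn2
    obtain ⟨x, hx, hxlt⟩ := exists_lt_of_csInf_lt ⟨L, hSne n hn τ⟩
      (show sInf (S n τ) < l + ε by rw [← he]; linarith)
    have hxge : e n τ ≤ x := csInf_le (hSbdd n τ) hx
    refine ⟨x, ⟨hL0.trans_le hx.1.1, hx.1.2⟩, ?_, ?_⟩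
    · rw [abs_lt]; constructor <;> linarith
    · have hF : f t ^ 2 ≤ f τ ^ 2 := hfsq t τ ht0 hτ.1.le hτ.2.le
      have hFr : 1 ≤ f τ ^ 2 * (Ghom l / H) := by
        rw [← mul_div_assoc, le_div_iff₀ hH, one_mul]
        exact h3.trans (mul_le_mul_of_nonneg_right hF hGpos.le)
      refine ENNReal.div_le_of_le_mul ?_
      calc Gn n x = 1 * Gn n x := (one_mul _).symm
        _ ≤ ENNReal.ofReal (f τ ^ 2 * (Ghom l / H)) * Gn n x := by
            gcongr
            rw [← ENNReal.ofReal_one]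
            exact ENNReal.ofReal_le_ofReal hFr
        _ = ENNReal.ofReal (Ghom l / H) * (ENNReal.ofReal (f τ ^ 2) * Gn n x) := by
            rw [ENNReal.ofReal_mul (sq_nonneg _)]; ring
        _ ≤ ENNReal.ofReal (Ghom l / H) * ENNReal.ofReal (Gcn n x) := by
            gcongr
            exact hx.2.le
  -- conclusion
  intro l hl
  have hl0 : 0 < l := hL0.trans_le ((hhomL0 ta hta (htab.trans htb)).trans hl.1)
  have hlL' : l ≤ L := hl.2.trans (hhomL tb (hta.trans htab.le) htb)
  rw [hGceff l ⟨hl0, hlL'⟩]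
  split_ifs with hG0
  · exact le_top
  have hltL : l < L := lt_of_le_of_ne hlL' fun h => hG0 (h ▸ hGhomL)
  have hGc : ContinuousAt Ghom l := by
    have hd : ContinuousOn (deriv Ehom) (Set.Ioo 0 L) :=
      hEh1.continuousOn_deriv_of_isOpen isOpen_Ioo (by norm_num)
    have : ContinuousOn Ghom (Set.Ioo 0 L) := hd.neg.congr hGhom
    exact this.continuousAt (Ioo_mem_nhds hl0 hltL)
  have hnear : ∀ δ > 0, ∃ l' ∈ Set.Ioo (ℓhom ta) (ℓhom tb), l' < L ∧ |l' - l| < δ := by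
    intro δ hδ
    have hcl : l ∈ closure (Set.Ioo (ℓhom ta) (ℓhom tb)) := by
      rw [closure_Ioo hinc.ne]; exact hl
    obtain ⟨l', h1, h2⟩ := Metric.mem_closure_iff.1 hcl (min δ (L - l))
      (lt_min hδ (sub_pos.2 hltL))
    rw [dist_comm, Real.dist_eq, lt_min_iff] at h2
    exact ⟨l', h1, by linarith [(abs_lt.1 h2.2).2], h2.1⟩
  have hGnear : ∀ η > 0, ∀ δ > 0, ∃ l' ∈ Set.Ioo (ℓhom ta) (ℓhom tb), l' < L ∧ |l' - l| < δ ∧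
      |Ghom l' - Ghom l| < η := by
    intro η hη δ hδ
    obtain ⟨δ', hδ', hc⟩ := Metric.continuousAt_iff.1 hGc η hη
    obtain ⟨l', h1, h2, h3⟩ := hnear (min δ δ') (lt_min hδ hδ')
    rw [lt_min_iff] at h3
    exact ⟨l', h1, h2, h3.1, hc (by rw [Real.dist_eq]; exact h3.2)⟩
  have hGnn : 0 ≤ Ghom l := by
    refine le_of_forall_pos_le_add fun η hη => ?_
    obtain ⟨l', h1, h2, h3, h4⟩ := hGnear η hη 1 one_pos
    linarith [(hinterior l' h1 h2).1, (abs_lt.1 h4).2]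
  have hGpos : 0 < Ghom l := lt_of_le_of_ne hGnn (Ne.symm hG0)
  have hgam : gammaLiminf L (fun n s => Gn n s / ENNReal.ofReal (Gcn n s)) l ≤
      ENNReal.ofReal (Ghom l / H) := by
    have hη : ∀ η > 0, gammaLiminf L (fun n s => Gn n s / ENNReal.ofReal (Gcn n s)) l ≤
        ENNReal.ofReal ((Ghom l + η) / H) := by
      intro η hη
      refine gammaLiminf_le_of L hL _ l _ fun ε hε => ?_
      obtain ⟨l', h1, h2, h3, h4⟩ := hGnear η hη (ε / 2) (by linarith)
      filter_upwards [(hinterior l' h1 h2).2 (ε / 2) (by linarith)] with n ⟨x, hx, hxl, hxc⟩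
      refine ⟨x, hx, ?_, hxc.trans (ENNReal.ofReal_le_ofReal ?_)⟩
      · have := abs_sub_le x l' l
        linarith
      · gcongr
        linarith [(abs_lt.1 h4).2]
    have hid : Tendsto (fun η : ℝ => η) (𝓝[>] 0) (𝓝 0) := tendsto_id.mono_left nhdsWithin_le_nhds
    have ht : Tendsto (fun η : ℝ => ENNReal.ofReal ((Ghom l + η) / H)) (𝓝[>] 0)
        (𝓝 (ENNReal.ofReal ((Ghom l + 0) / H))) :=
      ENNReal.tendsto_ofReal ((hid.const_add (Ghom l)).div_const H)
    rw [add_zero] at ht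
    refine ge_of_tendsto ht ?_
    filter_upwards [self_mem_nhdsWithin] with η h using hη η h
  have hne : ENNReal.ofReal (Ghom l) ≠ 0 := (ENNReal.ofReal_pos.2 hGpos).ne'
  rw [ENNReal.le_div_iff_mul_le (Or.inr hne) (Or.inr ENNReal.ofReal_ne_top)]
  calc _ ≤ ENNReal.ofReal H * ENNReal.ofReal (Ghom l / H) := by gcongr
    _ = ENNReal.ofReal (Ghom l) := by
        rw [← ENNReal.ofReal_mul hH.le, mul_div_cancel₀ _ hH.ne']
end
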